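/- For any real number Λ > 0 there exists a strictly increasing sequence of positive integers (n_k)_{k≥1} with n_{k+1} − n_k ∈ {1,2} for all k ≥ 1 such that limsup_{N→∞} N·D_N*(⟨n_1 x⟩, …, ⟨n_N x⟩) / √(N log log N) = Λ for almost every real number x. -/

import Mathlib

open MeasureTheory Filter Finset Real

/-- The star-discrepancy of the points `y 1, …, y N`:
`D_N^*(y_1,…,y_N) = sup_{0 ≤ a ≤ 1} |(1/N) ∑_{k=1}^N 1_{[0,a]}(y_k) − a|`. -/
noncomputable def starDiscrepancy (N : ℕ) (y : ℕ → ℝ) : ℝ :=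
  sSup {v : ℝ | ∃ a : ℝ, 0 ≤ a ∧ a ≤ 1 ∧
    v = |(∑ k ∈ Finset.Icc 1 N, (if 0 ≤ y k ∧ y k ≤ a then (1:ℝ) else 0)) / N - a|}

/-! Part A: finite probability with random signs -/

/-- sign attached to a Boolean -/
noncomputable def bsg (b : Bool) : ℝ := if b then 1 else -1

/-- uniform probability on sign vectors -/
noncomputable def pr {κ : Type} [Fintype κ] [DecidableEq κ] (p : (κ → Bool) → Prop) : ℝ :=
  by classical exact ((Finset.univ.filter p).card : ℝ) / 2 ^ (Fintype.card κ)

section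
set_option linter.unusedSectionVars false
variable {κ : Type} [Fintype κ] [DecidableEq κ]

lemma pr_eq (p : (κ → Bool) → Prop) [DecidablePred p] :
    pr p = ((Finset.univ.filter p).card : ℝ) / 2 ^ (Fintype.card κ) := by
  unfold pr
  congr!

lemma one_add_sq_le_cosh (z : ℝ) : 1 + z ^ 2 / 2 ≤ Real.cosh z := by
  wlog h : 0 ≤ z generalizing z
  · have := this (-z) (by linarith)
    simpa using this
  have h1 : Real.cosh z = 1 + 2 * Real.sinh (z / 2) ^ 2 := by
    have := Real.cosh_two_mul (z / 2)
    have h3 := Real.cosh_sq (z / 2)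
    rw [show 2 * (z / 2) = z by ring] at this
    linarith
  have h2 : z / 2 ≤ Real.sinh (z / 2) := Real.self_le_sinh_iff.2 (by linarith)
  rw [h1]
  nlinarith

lemma pr_nonneg (p : (κ → Bool) → Prop) : 0 ≤ pr p := by
  unfold pr; positivity

lemma pr_mono {p p' : (κ → Bool) → Prop} (h : ∀ e, p e → p' e) : pr p ≤ pr p' := by
  classical
  unfold pr
  gcongr
  exact h _

lemma pr_or (p p' : (κ → Bool) → Prop) : pr (fun e => p e ∨ p' e) ≤ pr p + pr p' := by
  classical
  unfold pr
  rw [← add_div]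
  gcongr
  norm_cast
  refine le_trans (Finset.card_le_card ?_) (Finset.card_union_le _ _)
  intro e he
  simpa using he

lemma pr_exists {ι : Type} (s : Finset ι) (p : ι → (κ → Bool) → Prop) :
    pr (fun e => ∃ i ∈ s, p i e) ≤ ∑ i ∈ s, pr (p i) := by
  classical
  induction s using Finset.induction_on with
  | empty => simp [pr]
  | insert a s ha ih =>
    rw [Finset.sum_insert ha]
    refine le_trans ?_ (add_le_add_right ih _)
    refine le_trans (pr_mono ?_) (pr_or _ _)
    rintro e ⟨i, hi, hp⟩
    rcases Finset.mem_insert.1 hi with rfl | h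
    · exact Or.inl hp
    · exact Or.inr ⟨i, h, hp⟩

lemma mgf_bsg (w : κ → ℝ) :
    ∑ e : κ → Bool, Real.exp (∑ c, bsg (e c) * w c) = ∏ c, (2 * Real.cosh (w c)) := by
  have h1 : ∀ c, 2 * Real.cosh (w c) = ∑ b : Bool, Real.exp (bsg b * w c) := by
    intro c
    simp [bsg, Real.cosh_eq]
    ring
  simp_rw [h1]
  rw [Finset.prod_univ_sum, Fintype.piFinset_univ]
  exact Finset.sum_congr rfl (fun e _ => Real.exp_sum _ _)

lemma mgf_upper (w : κ → ℝ) (V : ℝ) (hV : ∑ c, w c ^ 2 ≤ V) (t : ℝ) :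
    ∑ e : κ → Bool, Real.exp (t * ∑ c, bsg (e c) * w c)
      ≤ 2 ^ (Fintype.card κ) * Real.exp (t ^ 2 * V / 2) := by
  have := mgf_bsg (fun c => t * w c)
  have h2 : ∀ e : κ → Bool, t * ∑ c, bsg (e c) * w c = ∑ c, bsg (e c) * (t * w c) := by
    intro e; rw [Finset.mul_sum]; congr 1; ext c; ring
  simp_rw [h2]
  rw [this, Finset.prod_mul_distrib]
  simp only [Finset.prod_const, Finset.card_univ]
  gcongr
  calc ∏ c, Real.cosh (t * w c) ≤ ∏ c, Real.exp ((t * w c) ^ 2 / 2) :=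
        Finset.prod_le_prod (fun c _ => (Real.cosh_pos _).le) (fun c _ => Real.cosh_le_exp_half_sq _)
    _ = Real.exp (∑ c, (t * w c) ^ 2 / 2) := (Real.exp_sum _ _).symm
    _ ≤ Real.exp (t ^ 2 * V / 2) := by
        gcongr
        have : ∑ c, (t * w c) ^ 2 / 2 = t ^ 2 * (∑ c, w c ^ 2) / 2 := by
          rw [Finset.mul_sum, Finset.sum_div]; congr 1; ext c; ring
        rw [this]; gcongr

lemma pr_le_exp (g : (κ → Bool) → ℝ) (p : (κ → Bool) → Prop) (h : ∀ e, p e → 1 ≤ g e)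
    (h0 : ∀ e, 0 ≤ g e) : pr p ≤ (∑ e, g e) / 2 ^ (Fintype.card κ) := by
  classical
  unfold pr
  gcongr
  rw [Finset.card_filter]
  push_cast
  apply Finset.sum_le_sum
  intro e _
  split_ifs with hp
  · simpa using h e hp
  · simpa using h0 e

lemma hoeffding_one (w : κ → ℝ) (V : ℝ) (hV0 : 0 < V) (hV : ∑ c, w c ^ 2 ≤ V) (l : ℝ)
    (hl : 0 ≤ l) :
    pr (fun e : κ → Bool => l ≤ ∑ c, bsg (e c) * w c) ≤ Real.exp (-(l ^ 2 / (2 * V))) := by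
  refine (pr_le_exp (fun e => Real.exp ((l / V) * ∑ c, bsg (e c) * w c) *
    Real.exp (-(l ^ 2 / V))) _ ?_ (fun e => by positivity)).trans ?_
  · intro e he
    rw [← Real.exp_add]
    apply Real.one_le_exp
    have : l / V * l ≤ (l / V) * ∑ c, bsg (e c) * w c := by gcongr
    have h2 : l / V * l = l ^ 2 / V := by ring
    linarith
  · rw [← Finset.sum_mul, div_le_iff₀ (by positivity)]
    have := mgf_upper w V hV (l / V)
    calc _ ≤ (2 ^ (Fintype.card κ) * Real.exp ((l / V) ^ 2 * V / 2)) * Real.exp (-(l ^ 2 / V)) := by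
          gcongr
      _ = Real.exp (-(l ^ 2 / (2 * V))) * 2 ^ (Fintype.card κ) := by
          rw [mul_assoc, ← Real.exp_add, mul_comm]
          congr 2
          field_simp
          ring

lemma hoeffding (w : κ → ℝ) (V : ℝ) (hV0 : 0 < V) (hV : ∑ c, w c ^ 2 ≤ V) (l : ℝ)
    (hl : 0 ≤ l) :
    pr (fun e : κ → Bool => l < |∑ c, bsg (e c) * w c|) ≤ 2 * Real.exp (-(l ^ 2 / (2 * V))) := by
  have h1 := hoeffding_one w V hV0 hV l hl
  have h2 := hoeffding_one (fun c => - w c) V hV0 (by simpa using hV) l hl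
  rw [two_mul]
  refine le_trans (pr_mono ?_) ((pr_or _ _).trans (add_le_add h1 h2))
  intro e he
  rcases lt_abs.1 he with h | h
  · exact Or.inl h.le
  · right
    simp only [mul_neg, Finset.sum_neg_distrib]
    exact h.le

/-- flip signs outside `U` -/
def flipOut (U : Finset κ) (e : κ → Bool) : κ → Bool := fun c => if c ∈ U then e c else !(e c)

lemma flipOut_invol (U : Finset κ) : Function.Involutive (flipOut U) := by
  intro e; ext c; unfold flipOut; split_ifs <;> simp

lemma levy {β ι : Type} [Fintype β] (U : β → Finset κ) (hU : ∀ b b', U b ⊆ U b' ∨ U b' ⊆ U b)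
    (W : Finset κ) (hW : ∀ b, U b ⊆ W) (v : κ → ι → ℝ) (l : ℝ) :
    pr (fun e : κ → Bool => ∃ b, ∃ a, l < |∑ c ∈ U b, bsg (e c) * v c a|) ≤
      2 * pr (fun e : κ → Bool => ∃ a, l < |∑ c ∈ W, bsg (e c) * v c a|) := by
  classical
  set C : Finset (Finset κ) := Finset.univ.image U with hC
  set ex : Finset κ → (κ → Bool) → Prop := fun S e => ∃ a, l < |∑ c ∈ S, bsg (e c) * v c a| with hex
  set A : Finset κ → Finset (κ → Bool) := fun S =>
    Finset.univ.filter (fun e => ex S e ∧ ∀ S' ∈ C, S' ⊂ S → ¬ ex S' e) with hA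
  set Gd : Finset (κ → Bool) := Finset.univ.filter (ex W) with hGd
  have exflip : ∀ S S' : Finset κ, S' ⊆ S → ∀ e, ex S' (flipOut S e) ↔ ex S' e := by
    intro S S' hs e
    simp only [hex]
    have : ∀ a, ∑ c ∈ S', bsg (flipOut S e c) * v c a = ∑ c ∈ S', bsg (e c) * v c a := by
      intro a
      apply Finset.sum_congr rfl
      intro c hc
      simp [flipOut, hs hc]
    simp_rw [this]
  have hAflip : ∀ S e, e ∈ A S → flipOut S e ∈ A S := by
    intro S e he
    simp only [hA, Finset.mem_filter, Finset.mem_univ, true_and] at he ⊢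
    refine ⟨(exflip S S (Finset.Subset.refl _) e).2 he.1, fun S' hS' hlt => ?_⟩
    rw [exflip S S' hlt.1]
    exact he.2 S' hS' hlt
  have key : ∀ S ∈ C, (A S).card ≤ 2 * (A S ∩ Gd).card := by
    intro S hS
    have hSW : S ⊆ W := by
      obtain ⟨b, _, rfl⟩ := Finset.mem_image.1 hS; exact hW b
    have hsub : A S ⊆ (A S ∩ Gd) ∪ (A S ∩ Gd).image (flipOut S) := by
      intro e he
      have hex1 : ex S e := (Finset.mem_filter.1 he).2.1
      obtain ⟨a, ha⟩ := hex1
      have hsum : (∑ c ∈ W, bsg (e c) * v c a) + (∑ c ∈ W, bsg (flipOut S e c) * v c a)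
          = 2 * ∑ c ∈ S, bsg (e c) * v c a := by
        rw [← Finset.sum_add_distrib, ← Finset.sum_sdiff hSW, Finset.mul_sum]
        rw [Finset.sum_eq_zero, zero_add]
        · apply Finset.sum_congr rfl
          intro c hc; simp [flipOut, hc]; ring
        · intro c hc
          simp [flipOut, (Finset.mem_sdiff.1 hc).2, bsg]
          cases e c <;> simp
      have : l < |∑ c ∈ W, bsg (e c) * v c a| ∨ l < |∑ c ∈ W, bsg (flipOut S e c) * v c a| := by
        by_contra hcon
        push Not at hcon
        have h3 := abs_add_le (∑ c ∈ W, bsg (e c) * v c a) (∑ c ∈ W, bsg (flipOut S e c) * v c a)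
        rw [hsum, abs_mul, abs_two] at h3
        linarith [hcon.1, hcon.2]
      rcases this with h | h
      · apply Finset.mem_union_left
        exact Finset.mem_inter.2 ⟨he, Finset.mem_filter.2 ⟨Finset.mem_univ _, a, h⟩⟩
      · apply Finset.mem_union_right
        refine Finset.mem_image.2 ⟨flipOut S e, Finset.mem_inter.2 ⟨hAflip S e he,
          Finset.mem_filter.2 ⟨Finset.mem_univ _, a, h⟩⟩, flipOut_invol S e⟩
    calc (A S).card ≤ _ := Finset.card_le_card hsub
      _ ≤ _ := Finset.card_union_le _ _
      _ ≤ (A S ∩ Gd).card + (A S ∩ Gd).card := Nat.add_le_add_left Finset.card_image_le _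
      _ = _ := by ring
  have hdisj : ∀ S ∈ C, ∀ S' ∈ C, S ≠ S' → Disjoint (A S ∩ Gd) (A S' ∩ Gd) := by
    intro S hS S' hS' hne
    have hA' : Disjoint (A S) (A S') := by
      rw [Finset.disjoint_left]
      intro e he he'
      have h1 := (Finset.mem_filter.1 he).2
      have h2 := (Finset.mem_filter.1 he').2
      obtain ⟨b, _, rfl⟩ := Finset.mem_image.1 hS
      obtain ⟨b', _, rfl⟩ := Finset.mem_image.1 hS'
      rcases hU b b' with h | h
      · exact h2.2 _ hS (Finset.ssubset_iff_subset_ne.2 ⟨h, hne⟩) h1.1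
      · exact h1.2 _ hS' (Finset.ssubset_iff_subset_ne.2 ⟨h, hne.symm⟩) h2.1
    exact hA'.mono Finset.inter_subset_left Finset.inter_subset_left
  have hev : (Finset.univ.filter (fun e : κ → Bool => ∃ b, ex (U b) e)) ⊆ C.biUnion A := by
    intro e he
    obtain ⟨b, hb⟩ := (Finset.mem_filter.1 he).2
    set D := C.filter (fun S => ex S e) with hD
    have hDne : D.Nonempty := ⟨U b, by simp [hD, hC, hb]⟩
    obtain ⟨S, hSm, hSmin⟩ := Finset.exists_min_image D Finset.card hDne
    have hS1 := Finset.mem_filter.1 hSm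
    refine Finset.mem_biUnion.2 ⟨S, hS1.1, Finset.mem_filter.2 ⟨Finset.mem_univ _, hS1.2, ?_⟩⟩
    intro S' hS' hlt hcon
    have := hSmin S' (Finset.mem_filter.2 ⟨hS', hcon⟩)
    exact absurd (Finset.card_lt_card hlt) (not_lt.2 this)
  have hcount : (Finset.univ.filter (fun e : κ → Bool => ∃ b, ex (U b) e)).card ≤ 2 * Gd.card := by
    calc _ ≤ (C.biUnion A).card := Finset.card_le_card hev
      _ ≤ ∑ S ∈ C, (A S).card := Finset.card_biUnion_le
      _ ≤ ∑ S ∈ C, 2 * (A S ∩ Gd).card := Finset.sum_le_sum key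
      _ = 2 * ∑ S ∈ C, (A S ∩ Gd).card := by rw [Finset.mul_sum]
      _ = 2 * (C.biUnion (fun S => A S ∩ Gd)).card := by rw [Finset.card_biUnion hdisj]
      _ ≤ 2 * Gd.card := by
          gcongr
          intro e he
          obtain ⟨S, _, h⟩ := Finset.mem_biUnion.1 he
          exact (Finset.mem_inter.1 h).2
  have : ((Finset.univ.filter (fun e : κ → Bool => ∃ b, ex (U b) e)).card : ℝ) ≤ 2 * (Gd.card : ℝ) := by
    exact_mod_cast hcount
  rw [pr_eq, pr_eq, ← mul_div_assoc]
  exact div_le_div_of_nonneg_right this (by positivity)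

/-- maximal Hoeffding inequality -/
lemma levy_hoeffding {β : Type} [Fintype β] (U : β → Finset κ)
    (hU : ∀ b b', U b ⊆ U b' ∨ U b' ⊆ U b)
    (W : Finset κ) (hW : ∀ b, U b ⊆ W) (w : κ → ℝ) (V : ℝ) (hV0 : 0 < V)
    (hV : ∑ c ∈ W, w c ^ 2 ≤ V) (l : ℝ) (hl : 0 ≤ l) :
    pr (fun e : κ → Bool => ∃ b, l < |∑ c ∈ U b, bsg (e c) * w c|) ≤
      4 * Real.exp (-(l ^ 2 / (2 * V))) := by
  have h1 := levy (ι := Unit) U hU W hW (fun c _ => w c) l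
  have h2 := hoeffding (fun c => if c ∈ W then w c else 0) V hV0
    (by simpa [ite_pow, Finset.sum_ite_mem] using hV) l hl
  simp only [mul_ite, mul_zero, Finset.sum_ite_mem, Finset.univ_inter] at h2
  simp only [exists_const] at h1
  linarith

/-- two-parameter maximal Hoeffding inequality -/
lemma levy_two {β γ : Type} [Fintype β] [Fintype γ] (U : β → Finset κ)
    (hU : ∀ b b', U b ⊆ U b' ∨ U b' ⊆ U b)
    (X : γ → Finset κ) (hX : ∀ b b', X b ⊆ X b' ∨ X b' ⊆ X b)
    (W : Finset κ) (hW : ∀ b, X b ⊆ W) (V : ℝ) (hV0 : 0 < V)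
    (hV : (W.card : ℝ) ≤ V) (l : ℝ) (hl : 0 ≤ l) :
    pr (fun e : κ → Bool => ∃ b, ∃ a, l < |∑ c ∈ U b ∩ X a, bsg (e c)|) ≤
      8 * Real.exp (-(l ^ 2 / (2 * V))) := by
  have h1 := levy (ι := γ) U hU Finset.univ (fun b => Finset.subset_univ _)
    (fun c a => if c ∈ X a then 1 else 0) l
  have h2 := levy_hoeffding X hX W hW (fun _ => 1) V hV0 (by simpa using hV) l hl
  simp only [mul_ite, mul_one, mul_zero, Finset.sum_ite_mem, Finset.univ_inter] at h1 h2
  linarith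

lemma mgf_lower (w : κ → ℝ) (V r t : ℝ) (hV : ∑ c, w c ^ 2 = V) (hr : ∀ c, |w c| ≤ r) :
    2 ^ (Fintype.card κ) * Real.exp (t ^ 2 * V / 2 - t ^ 4 * r ^ 2 * V / 8) ≤
    ∑ e : κ → Bool, Real.exp (t * ∑ c, bsg (e c) * w c) := by
  have := mgf_bsg (fun c => t * w c)
  have h2 : ∀ e : κ → Bool, t * ∑ c, bsg (e c) * w c = ∑ c, bsg (e c) * (t * w c) := by
    intro e; rw [Finset.mul_sum]; congr 1; ext c; ring
  simp_rw [h2]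
  rw [this, Finset.prod_mul_distrib]
  simp only [Finset.prod_const, Finset.card_univ]
  gcongr
  have hz : ∀ z : ℝ, Real.exp (z ^ 2 / 2 - z ^ 4 / 8) ≤ Real.cosh z := by
    intro z
    have h1 : 1 + z ^ 2 / 2 ≤ Real.cosh z := one_add_sq_le_cosh z
    refine le_trans ?_ h1
    set u := z ^ 2 / 2 with hu
    have hu0 : 0 ≤ u := by positivity
    have h4 : z ^ 2 / 2 - z ^ 4 / 8 = u - u ^ 2 / 2 := by rw [hu]; ring
    rw [← hu] at h4
    rw [h4]
    have h5 : 1 + u ≤ Real.exp u := by linarith [Real.add_one_le_exp u]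
    -- exp(u - u^2/2) ≤ 1 + u
    have h6 : Real.log (1 + u) ≥ u - u ^ 2 / 2 := by
      have := Real.le_log_one_add_of_nonneg hu0
      refine le_trans ?_ this
      rw [le_div_iff₀ (by linarith)]
      nlinarith [pow_nonneg hu0 3]
    calc Real.exp (u - u ^ 2 / 2) ≤ Real.exp (Real.log (1 + u)) := by gcongr
      _ = 1 + u := Real.exp_log (by linarith)
  calc Real.exp (t ^ 2 * V / 2 - t ^ 4 * r ^ 2 * V / 8)
      ≤ Real.exp (∑ c, ((t * w c) ^ 2 / 2 - (t * w c) ^ 4 / 8)) := by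
        gcongr
        rw [Finset.sum_sub_distrib]
        have e1 : ∑ c, (t * w c) ^ 2 / 2 = t ^ 2 * V / 2 := by
          rw [← hV, Finset.mul_sum, Finset.sum_div]; congr 1; ext c; ring
        have e2 : ∑ c, (t * w c) ^ 4 / 8 ≤ t ^ 4 * r ^ 2 * V / 8 := by
          rw [← hV, Finset.mul_sum, Finset.sum_div]
          apply Finset.sum_le_sum
          intro c _
          have : w c ^ 2 ≤ r ^ 2 := by
            rw [← sq_abs]; exact pow_le_pow_left₀ (abs_nonneg _) (hr c) 2
          have h7 : t ^ 4 * (w c ^ 2 * w c ^ 2) ≤ t ^ 4 * (r ^ 2 * w c ^ 2) := by gcongr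
          have h8 : (t * w c) ^ 4 = t ^ 4 * (w c ^ 2 * w c ^ 2) := by ring
          rw [h8]; linarith
        rw [e1]; linarith
    _ = ∏ c, Real.exp ((t * w c) ^ 2 / 2 - (t * w c) ^ 4 / 8) := Real.exp_sum _ _
    _ ≤ ∏ c, Real.cosh (t * w c) :=
        Finset.prod_le_prod (fun c _ => (Real.exp_pos _).le) (fun c _ => hz _)

/-- lower exponential bound by tilting -/
lemma tilt (w : κ → ℝ) (V r t d : ℝ) (hV : ∑ c, w c ^ 2 = V) (hr : ∀ c, |w c| ≤ r)
    (ht : 0 ≤ t) (hd : 0 < d) (hd1 : d < 1) (h1 : t ^ 4 * r ^ 2 * V / 8 ≤ 1)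
    (h2 : 6 ≤ d ^ 2 * (t ^ 2 * V)) :
    Real.exp (-2) * Real.exp (- (1 / 2 + d) * (t ^ 2 * V)) ≤
      pr (fun e : κ → Bool => (1 - d) * (t * V) ≤ ∑ c, bsg (e c) * w c) := by
  classical
  set S : (κ → Bool) → ℝ := fun e => ∑ c, bsg (e c) * w c with hS
  set K : ℝ := 2 ^ (Fintype.card κ) with hK
  have hKpos : 0 < K := by positivity
  set Q := t ^ 2 * V with hQ
  have hV0 : 0 ≤ V := by rw [← hV]; positivity
  have hQ0 : 0 ≤ Q := by positivity
  have hlow := mgf_lower w V r t hV hr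
  have hup1 := mgf_upper w V hV.le (t * (1 - d))
  have hup2 := mgf_upper w V hV.le (t * (1 + d))
  -- pointwise
  have hpt : ∀ e, Real.exp (t * S e) ≤
      Real.exp (t * (1 - d) * S e) * Real.exp (d * (1 - d) * Q)
      + Real.exp (t * (1 + d) * S e) * Real.exp (- (d * (1 + d) * Q))
      + (if (1 - d) * (t * V) ≤ S e then Real.exp ((1 + d) * Q) else 0) := by
    intro e
    have n1 : 0 ≤ Real.exp (t * (1 - d) * S e) * Real.exp (d * (1 - d) * Q) := by positivity
    have n2 : 0 ≤ Real.exp (t * (1 + d) * S e) * Real.exp (- (d * (1 + d) * Q)) := by positivity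
    by_cases ha : (1 - d) * (t * V) ≤ S e
    · by_cases hb : S e ≤ (1 + d) * (t * V)
      · rw [if_pos ha]
        have : Real.exp (t * S e) ≤ Real.exp ((1 + d) * Q) := by
          apply Real.exp_le_exp.2
          calc t * S e ≤ t * ((1 + d) * (t * V)) := by gcongr
            _ = _ := by rw [hQ]; ring
        linarith
      · push Not at hb
        have n3 : 0 ≤ (if (1 - d) * (t * V) ≤ S e then Real.exp ((1 + d) * Q) else 0) := by
          split_ifs <;> positivity
        have : Real.exp (t * S e) ≤ Real.exp (t * (1 + d) * S e) * Real.exp (- (d * (1 + d) * Q)) := by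
          rw [← Real.exp_add]
          apply Real.exp_le_exp.2
          have : t * d * ((1 + d) * (t * V)) ≤ t * d * S e := by gcongr
          rw [hQ]; nlinarith
        linarith
    · rw [if_neg ha]
      push Not at ha
      have : Real.exp (t * S e) ≤ Real.exp (t * (1 - d) * S e) * Real.exp (d * (1 - d) * Q) := by
        rw [← Real.exp_add]
        apply Real.exp_le_exp.2
        have : t * d * S e ≤ t * d * ((1 - d) * (t * V)) := by gcongr
        rw [hQ]; nlinarith
      linarith
  have hsum := Finset.sum_le_sum (fun e (_ : e ∈ (Finset.univ : Finset (κ → Bool))) => hpt e)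
  rw [Finset.sum_add_distrib, Finset.sum_add_distrib, ← Finset.sum_mul, ← Finset.sum_mul] at hsum
  have hcard : ∑ e : κ → Bool, (if (1 - d) * (t * V) ≤ S e then Real.exp ((1 + d) * Q) else 0)
      = Real.exp ((1 + d) * Q) * (K * pr (fun e : κ → Bool => (1 - d) * (t * V) ≤ S e)) := by
    rw [← Finset.sum_filter, Finset.sum_const, nsmul_eq_mul]
    rw [pr_eq, mul_div_cancel₀ _ hKpos.ne', mul_comm]
  rw [hcard] at hsum
  set p := pr (fun e : κ → Bool => (1 - d) * (t * V) ≤ S e) with hp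
  have b1 : (∑ e : κ → Bool, Real.exp (t * (1 - d) * S e)) * Real.exp (d * (1 - d) * Q)
      ≤ K * (Real.exp (Q / 2) * Real.exp (-3)) := by
    calc _ ≤ (K * Real.exp ((t * (1 - d)) ^ 2 * V / 2)) * Real.exp (d * (1 - d) * Q) := by
          gcongr
      _ = K * Real.exp ((t * (1 - d)) ^ 2 * V / 2 + d * (1 - d) * Q) := by
          rw [mul_assoc, ← Real.exp_add]
      _ ≤ K * (Real.exp (Q / 2) * Real.exp (-3)) := by
          rw [← Real.exp_add]
          refine mul_le_mul_of_nonneg_left (Real.exp_le_exp.2 ?_) hKpos.le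
          have : (t * (1 - d)) ^ 2 * V / 2 + d * (1 - d) * Q = Q / 2 - d ^ 2 * Q / 2 := by
            rw [hQ]; ring
          rw [this]; linarith
  have b2 : (∑ e : κ → Bool, Real.exp (t * (1 + d) * S e)) * Real.exp (- (d * (1 + d) * Q))
      ≤ K * (Real.exp (Q / 2) * Real.exp (-3)) := by
    calc _ ≤ (K * Real.exp ((t * (1 + d)) ^ 2 * V / 2)) * Real.exp (- (d * (1 + d) * Q)) := by
          gcongr
      _ = K * Real.exp ((t * (1 + d)) ^ 2 * V / 2 + - (d * (1 + d) * Q)) := by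
          rw [mul_assoc, ← Real.exp_add]
      _ ≤ K * (Real.exp (Q / 2) * Real.exp (-3)) := by
          rw [← Real.exp_add]
          refine mul_le_mul_of_nonneg_left (Real.exp_le_exp.2 ?_) hKpos.le
          have : (t * (1 + d)) ^ 2 * V / 2 + - (d * (1 + d) * Q) = Q / 2 - d ^ 2 * Q / 2 := by
            rw [hQ]; ring
          rw [this]; linarith
  have b0 : K * (Real.exp (Q / 2) * Real.exp (-1)) ≤ ∑ e : κ → Bool, Real.exp (t * S e) := by
    refine le_trans ?_ hlow
    rw [← Real.exp_add]
    refine mul_le_mul_of_nonneg_left (Real.exp_le_exp.2 ?_) hKpos.le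
    linarith
  have hE : Real.exp (-1) - 2 * Real.exp (-3) ≥ Real.exp (-2) := by
    have e1 : Real.exp (-1) = Real.exp (-3) * (Real.exp 1 * Real.exp 1) := by
      rw [← Real.exp_add, ← Real.exp_add]; norm_num
    have e2 : Real.exp (-2) = Real.exp (-3) * Real.exp 1 := by
      rw [← Real.exp_add]; norm_num
    have e3 : 2 ≤ Real.exp 1 := by linarith [Real.add_one_le_exp 1]
    have e4 : 0 < Real.exp (-3) := Real.exp_pos _
    rw [e1, e2]
    have : Real.exp 1 * Real.exp 1 - 2 - Real.exp 1 ≥ 0 := by nlinarith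
    nlinarith
  have hfin : K * (Real.exp (Q / 2) * Real.exp (-2)) ≤ Real.exp ((1 + d) * Q) * (K * p) := by
    have h10 : K * Real.exp (Q / 2) * Real.exp (-2) ≤
        K * Real.exp (Q / 2) * (Real.exp (-1) - 2 * Real.exp (-3)) := by
      gcongr
    linarith
  have h11 : Real.exp (Q / 2) * Real.exp (-2) ≤ Real.exp ((1 + d) * Q) * p := by
    have : K * (Real.exp (Q / 2) * Real.exp (-2)) ≤ K * (Real.exp ((1 + d) * Q) * p) := by linarith
    exact le_of_mul_le_mul_left this hKpos
  have h12 : Real.exp (Q / 2) = Real.exp ((1 + d) * Q) * Real.exp (-(1 / 2 + d) * Q) := by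
    rw [← Real.exp_add]; congr 1; ring
  rw [h12, mul_assoc] at h11
  have := le_of_mul_le_mul_left h11 (Real.exp_pos _)
  linarith
end

/-! Part E: selection of the signs -/

lemma pr_uniform {κ : Type} [Fintype κ] [DecidableEq κ] (p : (κ → Bool) → Prop) :
    (PMF.uniformOfFintype (κ → Bool)).toMeasure {e | p e} = ENNReal.ofReal (pr p) := by
  classical
  rw [PMF.toMeasure_uniformOfFintype_apply _ (Set.toFinite _).measurableSet]
  rw [pr_eq, ENNReal.ofReal_div_of_pos (by positivity)]
  congr 1
  · rw [ENNReal.ofReal_natCast]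
    congr 1
    rw [Fintype.card_subtype]
    rfl
  · rw [Fintype.card_fun, Fintype.card_bool, ENNReal.ofReal_pow (by norm_num)]
    simp

lemma selection (m : ℕ → ℕ) (Bd Ht : ℕ → (i : ℕ) → (Fin (m i) → Bool) → Set ℝ)
    (hBm : ∀ p i e, MeasurableSet (Bd p i e)) (hHm : ∀ p i e, MeasurableSet (Ht p i e))
    (hB : ∀ᵐ x ∂(volume : Measure ℝ), ∀ p, Summable (fun i => pr (fun e => x ∈ Bd p i e)))
    (hH : ∀ᵐ x ∂(volume : Measure ℝ), ∀ p, ¬ Summable (fun i => pr (fun e => x ∈ Ht p i e))) :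
    ∃ ω : ∀ i, Fin (m i) → Bool, ∀ᵐ x ∂(volume : Measure ℝ), ∀ p,
      (∀ᶠ i in atTop, x ∉ Bd p i (ω i)) ∧ (∃ᶠ i in atTop, x ∈ Ht p i (ω i)) := by
  classical
  set P : (i : ℕ) → Measure (Fin (m i) → Bool) := fun i =>
    (PMF.uniformOfFintype (Fin (m i) → Bool)).toMeasure with hP
  have : ∀ i, IsProbabilityMeasure (P i) := fun i => by
    simp only [hP]; infer_instance
  set μ : Measure (∀ i, Fin (m i) → Bool) := Measure.infinitePi P with hμ
  have hpi : ∀ i, Measurable (fun w : (∀ i, Fin (m i) → Bool) => w i) :=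
    fun i => measurable_pi_apply i
  have hms : ∀ (F : (i : ℕ) → (Fin (m i) → Bool) → Set ℝ), (∀ i e, MeasurableSet (F i e)) →
      ∀ i, MeasurableSet {z : ℝ × (∀ i, Fin (m i) → Bool) | z.1 ∈ F i (z.2 i)} := by
    intro F hF i
    have : {z : ℝ × (∀ i, Fin (m i) → Bool) | z.1 ∈ F i (z.2 i)} =
        ⋃ e : Fin (m i) → Bool, (F i e) ×ˢ {w | w i = e} := by
      ext z; simp
    rw [this]
    refine MeasurableSet.iUnion (fun e => (hF i e).prod ?_)
    exact measurableSet_preimage (hpi i) (Set.toFinite {e}).measurableSet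
  have hmeas : MeasurableSet {z : ℝ × (∀ i, Fin (m i) → Bool) | ∀ p,
      (∀ᶠ i in atTop, z.1 ∉ Bd p i (z.2 i)) ∧ (∃ᶠ i in atTop, z.1 ∈ Ht p i (z.2 i))} := by
    have : {z : ℝ × (∀ i, Fin (m i) → Bool) | ∀ p,
      (∀ᶠ i in atTop, z.1 ∉ Bd p i (z.2 i)) ∧ (∃ᶠ i in atTop, z.1 ∈ Ht p i (z.2 i))} =
      ⋂ p, ((⋃ N, ⋂ i, ⋂ (_ : N ≤ i), {z | z.1 ∈ Bd p i (z.2 i)}ᶜ) ∩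
        (⋂ N, ⋃ i, ⋃ (_ : N ≤ i), {z | z.1 ∈ Ht p i (z.2 i)})) := by
      ext z
      simp [eventually_atTop, frequently_atTop]
    rw [this]
    refine MeasurableSet.iInter (fun p => MeasurableSet.inter ?_ ?_)
    · exact MeasurableSet.iUnion (fun N => MeasurableSet.iInter (fun i => MeasurableSet.iInter
        (fun _ => (hms _ (hBm p) i).compl)))
    · exact MeasurableSet.iInter (fun N => MeasurableSet.iUnion (fun i => MeasurableSet.iUnion
        (fun _ => (hms _ (hHm p) i))))
  have hev : ∀ i (q : (Fin (m i) → Bool) → Prop), μ {w | q (w i)} = ENNReal.ofReal (pr q) := by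
    intro i q
    rw [← pr_uniform q]
    have h1 : (Measure.infinitePi P).map (fun w => w i) = P i := Measure.infinitePi_map_eval P i
    change _ = P i {e | q e}
    rw [← h1, Measure.map_apply (measurable_pi_apply i) (Set.toFinite _).measurableSet]
    rfl
  have key : ∀ᵐ x ∂(volume : Measure ℝ), ∀ᵐ w ∂μ, ∀ p,
      (∀ᶠ i in atTop, x ∉ Bd p i (w i)) ∧ (∃ᶠ i in atTop, x ∈ Ht p i (w i)) := by
    filter_upwards [hB, hH] with x h1 h2
    rw [ae_all_iff]
    intro p
    have a1 : ∀ᵐ w ∂μ, ∀ᶠ i in atTop, w ∉ {w : ∀ i, Fin (m i) → Bool | x ∈ Bd p i (w i)} := by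
      apply ae_eventually_notMem
      have : ∀ i, μ {w | x ∈ Bd p i (w i)} = ENNReal.ofReal (pr (fun e => x ∈ Bd p i e)) :=
        fun i => hev i (fun e => x ∈ Bd p i e)
      simp_rw [this]
      rw [← ENNReal.ofReal_tsum_of_nonneg (fun i => pr_nonneg _) (h1 p)]
      exact ENNReal.ofReal_ne_top
    have a2 : ∀ᵐ w ∂μ, ∃ᶠ i in atTop, x ∈ Ht p i (w i) := by
      set s : ℕ → Set (∀ i, Fin (m i) → Bool) := fun i => {w | x ∈ Ht p i (w i)} with hs
      have hsm : ∀ i, MeasurableSet (s i) := fun i =>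
        measurableSet_preimage (hpi i) (Set.toFinite {e | x ∈ Ht p i e}).measurableSet
      have hind : ProbabilityTheory.iIndepSet s μ := by
        have := ProbabilityTheory.iIndepFun_infinitePi (P := P)
          (X := fun i (e : Fin (m i) → Bool) => e) (fun i => measurable_id)
        rw [ProbabilityTheory.iIndepSet_iff_meas_biInter hsm]
        intro S
        exact this.meas_biInter (fun i _ => ⟨{e | x ∈ Ht p i e},
          (Set.toFinite _).measurableSet, rfl⟩)
      have hsum : ∑' i, μ (s i) = ⊤ := by
        have h3 : ∀ i, μ (s i) = ENNReal.ofReal (pr (fun e => x ∈ Ht p i e)) :=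
          fun i => hev i (fun e => x ∈ Ht p i e)
        simp_rw [h3]
        by_contra hcon
        apply h2 p
        have := ENNReal.summable_toReal hcon
        simpa [ENNReal.toReal_ofReal, pr_nonneg] using this
      have := ProbabilityTheory.measure_limsup_eq_one hsm hind hsum
      have h4 : ∀ᵐ w ∂μ, w ∈ limsup s atTop :=
        (mem_ae_iff_prob_eq_one (MeasurableSet.measurableSet_limsup hsm)).2 this
      filter_upwards [h4] with w hw
      exact (mem_limsup_iff_frequently_mem (s := s)).1 hw
    filter_upwards [a1, a2] with w b1 b2
    exact ⟨b1, b2⟩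
  have := (Measure.ae_ae_comm (μ := (volume : Measure ℝ)) (ν := μ) hmeas).1 key
  exact this.exists

/-! Part B: discrepancy of Kronecker sequences -/

/-- centred indicator of `[0,a]` modulo one -/
noncomputable def fa (a y : ℝ) : ℝ := (if Int.fract y ≤ a then 1 else 0) - a

lemma fa_abs_le {a : ℝ} (h0 : 0 ≤ a) (h1 : a ≤ 1) (y : ℝ) : |fa a y| ≤ 1 := by
  unfold fa; split_ifs <;> rw [abs_le] <;> constructor <;> linarith

lemma block_bound (y z a : ℝ) (h0 : 0 ≤ a) (h1 : a ≤ 1) (q : ℕ) (hq : 0 < q) (p : ℤ)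
    (hpq : IsCoprime p (q : ℤ)) (hy : |y - p / q| ≤ 1 / (q : ℝ) ^ 2) :
    |∑ u ∈ range q, fa a (z + u * y)| ≤ 6 := by
  have hqR : (0 : ℝ) < q := by exact_mod_cast hq
  have hqZ : (0 : ℤ) < q := by exact_mod_cast hq
  set j0 : ℤ := ⌊(q : ℝ) * z⌋ with hj0
  set κ : ℕ → ℕ := fun u => ((j0 + u * p) % (q : ℤ)).toNat with hκ
  have hκZ : ∀ u, ((κ u : ℕ) : ℤ) = (j0 + u * p) % (q : ℤ) := fun u =>
    Int.toNat_of_nonneg (Int.emod_nonneg _ hqZ.ne')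
  have hmaps : ∀ u ∈ range q, κ u ∈ range q := by
    intro u _
    rw [mem_range]
    have h3 := hκZ u
    have h4 := Int.emod_lt_of_pos (j0 + u * p) hqZ
    omega
  have hinj : Set.InjOn κ (range q) := by
    intro u hu v hv huv
    have h3 : (j0 + u * p) % (q : ℤ) = (j0 + v * p) % (q : ℤ) := by
      rw [← hκZ, ← hκZ, huv]
    have h4 : (q : ℤ) ∣ (j0 + u * p) - (j0 + v * p) := Int.ModEq.dvd (Int.ModEq.symm h3)
    have h5 : (q : ℤ) ∣ p * ((u : ℤ) - v) := by convert h4 using 1; ring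
    have h6 := (IsCoprime.symm hpq).dvd_of_dvd_mul_left h5
    have hu' : u < q := by simpa using hu
    have hv' : v < q := by simpa using hv
    have h7 : (u : ℤ) - v = 0 := by
      apply Int.eq_zero_of_abs_lt_dvd h6
      rw [abs_lt]; constructor <;> omega
    omega
  have hsurj : Set.SurjOn κ (range q) (range q) :=
    Finset.surjOn_of_injOn_of_card_le κ hmaps hinj le_rfl
  have hreidx : ∀ g : ℕ → ℝ, ∑ u ∈ range q, g (κ u) = ∑ k ∈ range q, g k := fun g =>
    Finset.sum_nbij κ hmaps hinj hsurj (fun _ _ => rfl)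
  -- position of the points
  have hpos : ∀ u ∈ range q, 1 ≤ κ u → κ u + 2 ≤ q →
      ((κ u : ℝ) - 1 < q * Int.fract (z + u * y) ∧ q * Int.fract (z + u * y) < κ u + 2) := by
    intro u hu hk1 hk2
    have hu' : (u : ℝ) + 1 ≤ q := by
      have := mem_range.1 hu
      exact_mod_cast this
    have hu0 : (0 : ℝ) ≤ u := Nat.cast_nonneg u
    obtain ⟨w, hw⟩ : ∃ w : ℤ, (j0 + u * p) = κ u + q * w :=
      ⟨(j0 + u * p) / q, by rw [hκZ]; exact (Int.emod_add_mul_ediv _ _).symm⟩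
    have hwR : ((j0 : ℝ) + u * p) = κ u + q * w := by exact_mod_cast hw
    have hd : |(q : ℝ) * u * (y - p / q)| < 1 := by
      rw [abs_mul, abs_of_nonneg (by positivity : (0 : ℝ) ≤ q * u)]
      calc (q : ℝ) * u * |y - p / q| ≤ q * u * (1 / (q : ℝ) ^ 2) := by gcongr
        _ = u / q := by field_simp
        _ < 1 := by rw [div_lt_one hqR]; linarith
    have he : (q : ℝ) * u * (y - p / q) = q * u * y - u * p := by field_simp
    rw [he, abs_lt] at hd
    have hf1 : (j0 : ℝ) ≤ q * z := Int.floor_le _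
    have hf2 : (q : ℝ) * z < j0 + 1 := Int.lt_floor_add_one _
    have hA : (κ u : ℝ) - 1 < q * (z + u * y - w) := by nlinarith
    have hB : (q : ℝ) * (z + u * y - w) < κ u + 2 := by nlinarith
    have hk1R : (1 : ℝ) ≤ κ u := by exact_mod_cast hk1
    have hk2R : (κ u : ℝ) + 2 ≤ q := by exact_mod_cast hk2
    have hfr : Int.fract (z + u * y) = z + u * y - w := by
      rw [Int.fract_eq_iff]
      refine ⟨?_, ?_, w, by ring⟩
      · by_contra hcon
        push Not at hcon
        nlinarith
      · by_contra hcon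
        push Not at hcon
        nlinarith
    rw [hfr]
    exact ⟨hA, hB⟩
  have hsum : ∑ u ∈ range q, fa a (z + u * y) =
      ∑ u ∈ range q, (if Int.fract (z + u * y) ≤ a then (1 : ℝ) else 0) - q * a := by
    simp only [fa, Finset.sum_sub_distrib, Finset.sum_const, card_range, nsmul_eq_mul]
  have hqa : 0 ≤ (q : ℝ) * a := by positivity
  have hup : ∑ u ∈ range q, (if Int.fract (z + u * y) ≤ a then (1 : ℝ) else 0) ≤ q * a + 5 := by
    calc _ ≤ ∑ u ∈ range q, (if κ u ≤ ⌊(q : ℝ) * a⌋₊ + 1 ∨ κ u = q - 1 then (1 : ℝ) else 0) := by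
          apply Finset.sum_le_sum
          intro u hu
          by_cases hc : κ u ≤ ⌊(q : ℝ) * a⌋₊ + 1 ∨ κ u = q - 1
          · rw [if_pos hc]; split_ifs <;> norm_num
          · rw [if_neg hc]
            push Not at hc
            have h3 := mem_range.1 (hmaps u hu)
            have h4 := (hpos u hu (by omega) (by omega)).1
            have h5 : ⌊(q : ℝ) * a⌋₊ + 1 + 1 ≤ κ u := hc.1
            have h6 : ((⌊(q : ℝ) * a⌋₊ : ℝ) + 1 + 1) ≤ κ u := by exact_mod_cast h5
            have h7 := Nat.lt_floor_add_one ((q : ℝ) * a)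
            rw [if_neg]
            intro hle
            nlinarith
      _ = ∑ k ∈ range q, (if k ≤ ⌊(q : ℝ) * a⌋₊ + 1 ∨ k = q - 1 then (1 : ℝ) else 0) :=
          hreidx (fun k => if k ≤ ⌊(q : ℝ) * a⌋₊ + 1 ∨ k = q - 1 then (1 : ℝ) else 0)
      _ = ((range q).filter (fun k => k ≤ ⌊(q : ℝ) * a⌋₊ + 1 ∨ k = q - 1)).card := by
          rw [Finset.sum_boole]
      _ ≤ ((insert (q - 1) (range (⌊(q : ℝ) * a⌋₊ + 2))).card : ℝ) := by
          norm_cast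
          apply Finset.card_le_card
          intro k hk
          simp only [mem_filter, mem_range, mem_insert] at hk ⊢
          omega
      _ ≤ ((⌊(q : ℝ) * a⌋₊ + 2 + 1 : ℕ) : ℝ) := by
          norm_cast
          refine (Finset.card_insert_le _ _).trans ?_
          simp
      _ ≤ q * a + 5 := by
          push_cast
          linarith [Nat.floor_le hqa]
  have hlo : q * a - 4 ≤ ∑ u ∈ range q, (if Int.fract (z + u * y) ≤ a then (1 : ℝ) else 0) := by
    calc q * a - 4 ≤ ((⌊(q : ℝ) * a⌋₊ - 2 : ℕ) : ℝ) := by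
          have h7 := Nat.lt_floor_add_one ((q : ℝ) * a)
          have h8 : ⌊(q : ℝ) * a⌋₊ ≤ (⌊(q : ℝ) * a⌋₊ - 2) + 2 := by omega
          have h9 : (⌊(q : ℝ) * a⌋₊ : ℝ) ≤ ((⌊(q : ℝ) * a⌋₊ - 2 : ℕ) : ℝ) + 2 := by exact_mod_cast h8
          linarith
      _ ≤ (((range q).filter (fun k => 1 ≤ k ∧ k + 2 ≤ ⌊(q : ℝ) * a⌋₊)).card : ℝ) := by
          norm_cast
          have : Finset.Icc 1 (⌊(q : ℝ) * a⌋₊ - 2) ⊆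
              (range q).filter (fun k => 1 ≤ k ∧ k + 2 ≤ ⌊(q : ℝ) * a⌋₊) := by
            intro k hk
            have hfl : ⌊(q : ℝ) * a⌋₊ ≤ q := by
              apply Nat.floor_le_of_le
              nlinarith
            simp only [mem_filter, mem_range, Finset.mem_Icc] at hk ⊢
            omega
          have := Finset.card_le_card this
          simpa using this
      _ = ∑ k ∈ range q, (if 1 ≤ k ∧ k + 2 ≤ ⌊(q : ℝ) * a⌋₊ then (1 : ℝ) else 0) := by
          rw [Finset.sum_boole]
      _ = ∑ u ∈ range q, (if 1 ≤ κ u ∧ κ u + 2 ≤ ⌊(q : ℝ) * a⌋₊ then (1 : ℝ) else 0) :=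
          (hreidx (fun k => if 1 ≤ k ∧ k + 2 ≤ ⌊(q : ℝ) * a⌋₊ then (1 : ℝ) else 0)).symm
      _ ≤ _ := by
          apply Finset.sum_le_sum
          intro u hu
          by_cases hc : 1 ≤ κ u ∧ κ u + 2 ≤ ⌊(q : ℝ) * a⌋₊
          · have hfl : ⌊(q : ℝ) * a⌋₊ ≤ q := by
              apply Nat.floor_le_of_le
              nlinarith
            have h4 := (hpos u hu hc.1 (by omega)).2
            have h6 : ((κ u : ℝ) + 2) ≤ ⌊(q : ℝ) * a⌋₊ := by exact_mod_cast hc.2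
            have h7 := Nat.floor_le hqa
            rw [if_pos hc, if_pos]
            by_contra hle
            push Not at hle
            nlinarith
          · rw [if_neg hc]; split_ifs <;> norm_num
  rw [hsum, abs_le]
  constructor <;> linarith

lemma blocks_bound (y a : ℝ) (q : ℕ) (hq : 0 < q) (E F : ℝ)
    (hE : ∀ z, |∑ u ∈ range q, fa a (z + u * y)| ≤ E)
    (hF : ∀ s < q, ∀ z, |∑ u ∈ range s, fa a (z + u * y)| ≤ F) (n : ℕ) (z : ℝ) :
    |∑ u ∈ range n, fa a (z + u * y)| ≤ (n / q : ℕ) * E + F := by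
  have h1 : ∀ k z, |∑ u ∈ range (k * q), fa a (z + u * y)| ≤ k * E := by
    intro k
    induction k with
    | zero => intro z; simp
    | succ k ih =>
      intro z
      rw [Nat.succ_mul, Finset.sum_range_add]
      have h2 := hE (z + (k * q : ℕ) * y)
      have h3 : ∑ u ∈ range q, fa a (z + (k * q : ℕ) * y + u * y) =
          ∑ u ∈ range q, fa a (z + ((k * q + u : ℕ) : ℝ) * y) := by
        apply Finset.sum_congr rfl; intro u _; congr 1; push_cast; ring
      rw [h3] at h2
      refine (abs_add_le _ _).trans ?_
      push_cast at *
      linarith [ih z]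
  have h4 : n = (n / q) * q + n % q := by rw [mul_comm]; exact (Nat.div_add_mod n q).symm
  conv_lhs => rw [h4, Finset.sum_range_add]
  have h2 := hF (n % q) (Nat.mod_lt _ hq) (z + ((n / q) * q : ℕ) * y)
  have h3 : ∑ u ∈ range (n % q), fa a (z + ((n / q) * q : ℕ) * y + u * y) =
      ∑ u ∈ range (n % q), fa a (z + (((n / q) * q + u : ℕ) : ℝ) * y) := by
    apply Finset.sum_congr rfl; intro u _; congr 1; push_cast; ring
  rw [h3] at h2
  exact (abs_add_le _ _).trans (add_le_add (h1 _ _) h2)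

lemma dioph_const (y : ℝ) (hy : Irrational y) (hL : ¬ LiouvilleWith (9 / 4) y) :
    ∃ c : ℝ, 0 < c ∧ ∀ q : ℕ, 0 < q → ∀ p : ℤ, c / (q : ℝ) ^ (9 / 4 : ℝ) ≤ |y - p / q| := by
  have hev : ∀ᶠ n : ℕ in atTop, ∀ m : ℤ, 1 / (n : ℝ) ^ (9 / 4 : ℝ) ≤ |y - m / n| := by
    by_contra hcon
    apply hL
    refine ⟨1, ?_⟩
    rw [Filter.not_eventually] at hcon
    refine hcon.mono ?_
    intro n hn
    push Not at hn
    obtain ⟨m, hm⟩ := hn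
    refine ⟨m, ?_, hm⟩
    intro h
    apply hy
    exact ⟨(m : ℚ) / n, by rw [h]; push_cast; rfl⟩
  obtain ⟨n0, hn0⟩ := eventually_atTop.1 hev
  have hfin : ∀ k : ℕ, ∃ c : ℝ, 0 < c ∧ c ≤ 1 ∧
      ∀ q : ℕ, 0 < q → q < k → ∀ p : ℤ, c / (q : ℝ) ^ (9 / 4 : ℝ) ≤ |y - p / q| := by
    intro k
    induction k with
    | zero => exact ⟨1, one_pos, le_rfl, by intro q _ h; omega⟩
    | succ k ih =>
      obtain ⟨c, hc, hc1, hcq⟩ := ih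
      rcases Nat.eq_zero_or_pos k with hk0 | hk
      · refine ⟨c, hc, hc1, ?_⟩
        intro q h1 h2; omega
      have hkR : (0 : ℝ) < k := by exact_mod_cast hk
      set d := |(k : ℝ) * y - round ((k : ℝ) * y)| with hd
      have hd0 : 0 < d := by
        rw [hd, abs_pos, sub_ne_zero]
        have : Irrational ((k : ℝ) * y) := by
          exact_mod_cast hy.natCast_mul hk.ne'
        intro h
        exact this ⟨(round ((k : ℝ) * y) : ℚ), by rw [h]; push_cast; simp⟩
      have hkp : (0 : ℝ) < (k : ℝ) ^ (9 / 4 : ℝ) := by positivity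
      refine ⟨min c (d / k * (k : ℝ) ^ (9 / 4 : ℝ)), by positivity, (min_le_left _ _).trans hc1, ?_⟩
      intro q hq0 hq p
      rcases Nat.lt_succ_iff_lt_or_eq.1 hq with h | h
      · refine le_trans ?_ (hcq q hq0 h p)
        gcongr
        exact min_le_left _ _
      · subst h
        calc _ ≤ (d / q * (q : ℝ) ^ (9 / 4 : ℝ)) / (q : ℝ) ^ (9 / 4 : ℝ) := by
              gcongr; exact min_le_right _ _
          _ = d / q := by field_simp
          _ ≤ |(q : ℝ) * y - p| / q := by
              gcongr
              exact round_le _ _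
          _ = |y - p / q| := by
              rw [← abs_of_pos hkR, ← abs_div, abs_of_pos hkR]
              congr 1; field_simp
  obtain ⟨c, hc, hc1, hcq⟩ := hfin n0
  refine ⟨c, hc, fun q hq p => ?_⟩
  by_cases h : q < n0
  · exact hcq q hq h p
  · refine le_trans ?_ (hn0 q (not_lt.1 h) p)
    gcongr

/-- Kronecker discrepancy bound -/
def KB (y : ℝ) : Prop := ∃ C : ℝ, 0 < C ∧ ∀ n : ℕ, ∀ z a : ℝ, 0 ≤ a → a ≤ 1 →
  |∑ u ∈ range n, fa a (z + u * y)| ≤ C * (n : ℝ) ^ (0.45 : ℝ)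

lemma dirichlet_q (y c : ℝ) (hc : 0 < c)
    (h : ∀ q : ℕ, 0 < q → ∀ p : ℤ, c / (q : ℝ) ^ (9 / 4 : ℝ) ≤ |y - p / q|)
    (T : ℝ) (hT : 1 ≤ T) : ∃ q : ℕ, 0 < q ∧ (q : ℝ) ≤ T ∧ (c * T) ^ (4 / 5 : ℝ) ≤ q ∧
      ∀ z a, 0 ≤ a → a ≤ 1 → |∑ u ∈ range q, fa a (z + u * y)| ≤ 6 := by
  have hn : 0 < ⌊T⌋₊ := Nat.floor_pos.2 hT
  obtain ⟨ξ, h1, h2⟩ := Real.exists_rat_abs_sub_le_and_den_le y hn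
  have hden : 0 < ξ.den := ξ.den_pos
  have hdR : (0 : ℝ) < ξ.den := by exact_mod_cast hden
  have hξ : ((ξ : ℚ) : ℝ) = (ξ.num : ℝ) / (ξ.den : ℝ) := by
    exact Rat.cast_def ξ
  rw [hξ] at h1
  have hfl := Nat.lt_floor_add_one T
  have h2R : (ξ.den : ℝ) ≤ ⌊T⌋₊ := by exact_mod_cast h2
  refine ⟨ξ.den, hden, h2R.trans (Nat.floor_le (by linarith)), ?_, ?_⟩
  · have h3 := (h ξ.den hden ξ.num).trans h1
    have hsplit : (ξ.den : ℝ) ^ (9 / 4 : ℝ) = (ξ.den : ℝ) ^ (5 / 4 : ℝ) * ξ.den := by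
      rw [← Real.rpow_add_one hdR.ne']; norm_num
    rw [hsplit, div_le_div_iff₀ (by positivity) (by positivity)] at h3
    have h4 : c * T ≤ (ξ.den : ℝ) ^ (5 / 4 : ℝ) := by
      have h5 : c * ((⌊T⌋₊ : ℝ) + 1) ≤ (ξ.den : ℝ) ^ (5 / 4 : ℝ) := by
        have : c * ((⌊T⌋₊ : ℝ) + 1) * ξ.den ≤ (ξ.den : ℝ) ^ (5 / 4 : ℝ) * ξ.den := by
          linarith
        exact le_of_mul_le_mul_right this hdR
      nlinarith
    calc (c * T) ^ (4 / 5 : ℝ) ≤ ((ξ.den : ℝ) ^ (5 / 4 : ℝ)) ^ (4 / 5 : ℝ) := by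
          gcongr
      _ = ξ.den := by rw [← Real.rpow_mul hdR.le]; norm_num
  · intro z a h0 ha1
    apply block_bound y z a h0 ha1 ξ.den hden ξ.num
    · exact Int.isCoprime_iff_nat_coprime.2 (by simpa using ξ.reduced)
    · refine h1.trans ?_
      rw [sq]
      gcongr
      linarith

lemma kb_of (y : ℝ) (hy : Irrational y) (hL : ¬ LiouvilleWith (9 / 4) y) : KB y := by
  obtain ⟨c, hc, hcq⟩ := dioph_const y hy hL
  set D : ℝ := c ^ (4 / 5 : ℝ) with hD
  have hDpos : 0 < D := by positivity
  refine ⟨12 / D + 1, by positivity, ?_⟩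
  intro n z a h0 h1
  rcases Nat.eq_zero_or_pos n with rfl | hn
  · simp; norm_num
  have hnR : (1 : ℝ) ≤ n := by exact_mod_cast hn
  have hn0 : (0 : ℝ) < n := by linarith
  obtain ⟨q1, hq1, hq1T, hq1l, hb1⟩ := dirichlet_q y c hc hcq ((n : ℝ) ^ (0.7 : ℝ))
    (Real.one_le_rpow hnR (by norm_num))
  obtain ⟨q2, hq2, hq2T, hq2l, hb2⟩ := dirichlet_q y c hc hcq ((n : ℝ) ^ (0.4 : ℝ))
    (Real.one_le_rpow hnR (by norm_num))
  rw [Real.mul_rpow hc.le (by positivity), ← Real.rpow_mul hn0.le, ← hD] at hq1l hq2l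
  have hq1R : (0 : ℝ) < q1 := by exact_mod_cast hq1
  have hq2R : (0 : ℝ) < q2 := by exact_mod_cast hq2
  have htriv : ∀ s : ℕ, ∀ z, |∑ u ∈ range s, fa a (z + u * y)| ≤ s := by
    intro s z
    refine (Finset.abs_sum_le_sum_abs _ _).trans ?_
    calc _ ≤ ∑ u ∈ range s, (1 : ℝ) := Finset.sum_le_sum (fun u _ => fa_abs_le h0 h1 _)
      _ = s := by simp
  have hdiv : ∀ (s q : ℕ) (A B : ℝ), (s : ℝ) ≤ (n : ℝ) ^ A → D * (n : ℝ) ^ B ≤ q → 0 < q →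
      A - B ≤ 0.45 → ((s / q : ℕ) : ℝ) * 6 ≤ 6 / D * (n : ℝ) ^ (0.45 : ℝ) := by
    intro s q A B hs hq hq0 hAB
    have hq0R : (0 : ℝ) < q := by exact_mod_cast hq0
    calc ((s / q : ℕ) : ℝ) * 6 ≤ ((s : ℝ) / q) * 6 := by gcongr; exact Nat.cast_div_le
      _ ≤ ((n : ℝ) ^ A / (D * (n : ℝ) ^ B)) * 6 := by gcongr
      _ = 6 / D * (n : ℝ) ^ (A - B) := by rw [Real.rpow_sub hn0]; field_simp
      _ ≤ _ := by
        gcongr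
  have hF : ∀ s < q1, ∀ z, |∑ u ∈ range s, fa a (z + u * y)| ≤
      6 / D * (n : ℝ) ^ (0.45 : ℝ) + (n : ℝ) ^ (0.45 : ℝ) := by
    intro s hs z
    refine (blocks_bound y a q2 hq2 6 ((n : ℝ) ^ (0.45 : ℝ)) (fun z => hb2 z a h0 h1) ?_ s z).trans ?_
    · intro s' hs' z
      refine (htriv s' z).trans ?_
      have : (s' : ℝ) ≤ q2 := by exact_mod_cast hs'.le
      refine this.trans (hq2T.trans ?_)
      exact Real.rpow_le_rpow_of_exponent_le hnR (by norm_num)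
    · refine add_le_add ?_ le_rfl
      refine hdiv s q2 0.7 _ ?_ hq2l hq2 (by norm_num)
      have : (s : ℝ) ≤ q1 := by exact_mod_cast hs.le
      exact this.trans hq1T
  refine (blocks_bound y a q1 hq1 6 _ (fun z => hb1 z a h0 h1) hF n z).trans ?_
  have := hdiv n q1 1 _ (by simp) hq1l hq1 (by norm_num)
  calc _ ≤ 6 / D * (n : ℝ) ^ (0.45 : ℝ) + (6 / D * (n : ℝ) ^ (0.45 : ℝ) + (n : ℝ) ^ (0.45 : ℝ)) :=
        add_le_add this le_rfl
    _ = _ := by ring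

lemma ae_kb : ∀ᵐ x ∂(volume : Measure ℝ), Irrational x ∧ KB (2 * x) := by
  have h1 := ae_not_liouvilleWith
  have h2 : ∀ᵐ x ∂(volume : Measure ℝ), Irrational x := by
    have : (Set.range ((↑) : ℚ → ℝ)).Countable := Set.countable_range _
    exact this.ae_notMem _
  filter_upwards [h1, h2] with x hx1 hx2
  refine ⟨hx2, kb_of _ ?_ ?_⟩
  · exact_mod_cast hx2.natCast_mul (m := 2) (by norm_num)
  · have := hx1 (9 / 4) (by norm_num)
    intro hcon
    apply this
    have h3 := (LiouvilleWith.nat_mul_iff (p := 9 / 4) (x := x) (n := 2) (by norm_num)).1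
    exact h3 (by exact_mod_cast hcon)

/-! Part C: clusters -/

lemma sum_range_mul' (k q : ℕ) (g : ℕ → ℝ) :
    ∑ u ∈ range (k * q), g u = ∑ l ∈ range k, ∑ j ∈ range q, g (l * q + j) := by
  induction k with
  | zero => simp
  | succ k ih => rw [Nat.succ_mul, Finset.sum_range_add, Finset.sum_range_succ, ih]

/-- index of the `l`-th point of cluster `c` -/
def idx (q r c l : ℕ) : ℕ := (c / q) * (r * q) + l * q + c % q

lemma sum_cluster (q r b : ℕ) (hq : 0 < q) (g : ℕ → ℝ) :
    ∑ u ∈ range (b * q * r), g u = ∑ c ∈ range (b * q), ∑ l ∈ range r, g (idx q r c l) := by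
  have h1 : b * q * r = b * (r * q) := by ring
  rw [h1, sum_range_mul', sum_range_mul' b q]
  apply Finset.sum_congr rfl
  intro k _
  rw [sum_range_mul' r q, Finset.sum_comm]
  apply Finset.sum_congr rfl
  intro j hj
  apply Finset.sum_congr rfl
  intro l _
  have hj' := mem_range.1 hj
  congr 1
  unfold idx
  have e1 : (k * q + j) / q = k := by
    rw [mul_comm, Nat.mul_add_div hq, Nat.div_eq_of_lt hj', add_zero]
  have e2 : (k * q + j) % q = j := by
    rw [mul_comm, Nat.mul_add_mod, Nat.mod_eq_of_lt hj']
  rw [e1, e2]; ring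

/-- cluster sum -/
noncomputable def Ph (q r : ℕ) (z y : ℝ) (c : ℕ) (a : ℝ) : ℝ :=
  ∑ l ∈ range r, fa a (z + (idx q r c l : ℕ) * y)

lemma Ph_abs (q r : ℕ) (z y : ℝ) (c : ℕ) (a : ℝ) (h0 : 0 ≤ a) (h1 : a ≤ 1) :
    |Ph q r z y c a| ≤ r := by
  unfold Ph
  refine (Finset.abs_sum_le_sum_abs _ _).trans ?_
  calc _ ≤ ∑ u ∈ range r, (1 : ℝ) := Finset.sum_le_sum (fun u _ => fa_abs_le h0 h1 _)
    _ = r := by simp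

lemma fa_sq (a y : ℝ) : fa a y ^ 2 ≤ (1 - 2 * a) * fa a y + 1 / 4 := by
  unfold fa; split_ifs <;> nlinarith [sq_nonneg (a - 1 / 2)]

lemma Ph_sq_sum (q r b : ℕ) (hq : 0 < q) (z y a C : ℝ) (h0 : 0 ≤ a) (h1 : a ≤ 1)
    (hC : ∀ n : ℕ, ∀ z a : ℝ, 0 ≤ a → a ≤ 1 →
      |∑ u ∈ range n, fa a (z + u * y)| ≤ C * (n : ℝ) ^ (0.45 : ℝ)) :
    ∑ c ∈ range (b * q), Ph q r z y c a ^ 2 ≤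
      r * (((b * q * r : ℕ) : ℝ) / 4 + C * ((b * q * r : ℕ) : ℝ) ^ (0.45 : ℝ)) := by
  have h2 : ∀ c, Ph q r z y c a ^ 2 ≤ r * ∑ l ∈ range r, fa a (z + (idx q r c l : ℕ) * y) ^ 2 := by
    intro c
    have := sq_sum_le_card_mul_sum_sq (s := range r) (f := fun l => fa a (z + (idx q r c l : ℕ) * y))
    simpa [Ph] using this
  calc _ ≤ ∑ c ∈ range (b * q), r * ∑ l ∈ range r, fa a (z + (idx q r c l : ℕ) * y) ^ 2 :=
        Finset.sum_le_sum (fun c _ => h2 c)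
    _ = r * ∑ u ∈ range (b * q * r), fa a (z + u * y) ^ 2 := by
        rw [← Finset.mul_sum, sum_cluster q r b hq]
    _ ≤ r * ∑ u ∈ range (b * q * r), ((1 - 2 * a) * fa a (z + u * y) + 1 / 4) := by
        gcongr; exact fa_sq _ _
    _ = r * (((b * q * r : ℕ) : ℝ) / 4 + (1 - 2 * a) * ∑ u ∈ range (b * q * r), fa a (z + u * y)) := by
        congr 1
        rw [Finset.sum_add_distrib, ← Finset.mul_sum, Finset.sum_const, card_range, nsmul_eq_mul]
        ring
    _ ≤ _ := by
        refine mul_le_mul_of_nonneg_left (add_le_add le_rfl ?_) (Nat.cast_nonneg r)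
        have h3 := hC (b * q * r) z a h0 h1
        calc (1 - 2 * a) * ∑ u ∈ range (b * q * r), fa a (z + u * y)
            ≤ |(1 - 2 * a) * ∑ u ∈ range (b * q * r), fa a (z + u * y)| := le_abs_self _
          _ = |1 - 2 * a| * |∑ u ∈ range (b * q * r), fa a (z + u * y)| := abs_mul _ _
          _ ≤ 1 * (C * ((b * q * r : ℕ) : ℝ) ^ (0.45 : ℝ)) := by
              apply mul_le_mul _ h3 (abs_nonneg _) zero_le_one
              rw [abs_le]; constructor <;> linarith
          _ = _ := one_mul _

/-- number of cluster members with given `l` in a cell -/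
lemma cell_count (q r b l : ℕ) (hq : 0 < q) (hl : l < r) (z y C a1 a2 : ℝ) (h0 : 0 ≤ a1)
    (h12 : a1 ≤ a2) (h1 : a2 ≤ 1)
    (hC : ∀ n : ℕ, ∀ z a : ℝ, 0 ≤ a → a ≤ 1 →
      |∑ u ∈ range n, fa a (z + u * y)| ≤ C * (n : ℝ) ^ (0.45 : ℝ)) :
    ∑ c ∈ range (b * q), (if a1 < Int.fract (z + (idx q r c l : ℕ) * y) ∧
        Int.fract (z + (idx q r c l : ℕ) * y) ≤ a2 then (1 : ℝ) else 0) ≤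
      ((b * q * r : ℕ) : ℝ) * (a2 - a1) + 2 * C * ((b * q * r : ℕ) : ℝ) ^ (0.45 : ℝ) := by
  set g : ℕ → ℝ := fun u => if a1 < Int.fract (z + u * y) ∧ Int.fract (z + u * y) ≤ a2 then 1 else 0
    with hg
  have hg0 : ∀ u, 0 ≤ g u := by intro u; simp only [hg]; split_ifs <;> norm_num
  have hge : ∀ u, g u = fa a2 (z + u * y) - fa a1 (z + u * y) + (a2 - a1) := by
    intro u; simp only [hg, fa]
    by_cases c1 : a1 < Int.fract (z + u * y)
    · by_cases c2 : Int.fract (z + u * y) ≤ a2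
      · rw [if_pos ⟨c1, c2⟩, if_pos c2, if_neg (not_le.2 c1)]; ring
      · rw [if_neg (fun h => c2 h.2), if_neg c2, if_neg (not_le.2 c1)]; ring
    · have c3 := not_lt.1 c1
      rw [if_neg (fun h => c1 h.1), if_pos c3, if_pos (c3.trans h12)]; ring
  calc _ = ∑ c ∈ range (b * q), g (idx q r c l) := rfl
    _ ≤ ∑ c ∈ range (b * q), ∑ l ∈ range r, g (idx q r c l) :=
        Finset.sum_le_sum (fun c _ => Finset.single_le_sum
          (f := fun l => g (idx q r c l)) (fun l _ => hg0 _) (mem_range.2 hl))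
    _ = ∑ u ∈ range (b * q * r), g u := (sum_cluster q r b hq g).symm
    _ = ∑ u ∈ range (b * q * r), fa a2 (z + u * y) - ∑ u ∈ range (b * q * r), fa a1 (z + u * y)
        + ((b * q * r : ℕ) : ℝ) * (a2 - a1) := by
        rw [Finset.sum_congr rfl (fun u _ => hge u), Finset.sum_add_distrib, Finset.sum_sub_distrib,
          Finset.sum_const, card_range, nsmul_eq_mul]
    _ ≤ _ := by
        have e1 := abs_le.1 (hC (b * q * r) z a2 (h0.trans h12) h1)
        have e2 := abs_le.1 (hC (b * q * r) z a1 h0 (h12.trans h1))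
        linarith [e1.1, e1.2, e2.1, e2.2]

/-- lower variance bound when `q y` is close to an integer -/
lemma Ph_var_lower (q r b : ℕ) (hq : 0 < q) (hr : 0 < r) (z y C K : ℝ) (hK : 4 ≤ K) (P : ℤ)
    (hP : |q * y - P| ≤ 1 / (r * K))
    (hC : ∀ n : ℕ, ∀ z a : ℝ, 0 ≤ a → a ≤ 1 →
      |∑ u ∈ range n, fa a (z + u * y)| ≤ C * (n : ℝ) ^ (0.45 : ℝ)) :
    (r : ℝ) ^ 2 / 4 * (((b * q : ℕ) : ℝ) - (5 * ((b * q * r : ℕ) : ℝ) / K +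
      4 * C * ((b * q * r : ℕ) : ℝ) ^ (0.45 : ℝ))) ≤
    ∑ c ∈ range (b * q), Ph q r z y c (1 / 2) ^ 2 := by
  have hrR : (0 : ℝ) < r := by exact_mod_cast hr
  have hK0 : 0 < K := by linarith
  have hKi : 1 / K ≤ 1 / 4 := by gcongr
  have hKi0 : 0 < 1 / K := by positivity
  set k := 1 / K with hk
  set g : ℕ → ℝ := fun u => fa k (z + u * y) + (fa (1 / 2 + k) (z + u * y) - fa (1 / 2 - k) (z + u * y))
    - fa (1 - 2 * k) (z + u * y) + 5 * k with hg
  have hgform : ∀ u : ℕ, g u = (if Int.fract (z + u * y) ≤ k then 1 else 0) +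
      ((if Int.fract (z + u * y) ≤ 1 / 2 + k then 1 else 0) -
        (if Int.fract (z + u * y) ≤ 1 / 2 - k then 1 else 0)) +
      (1 - (if Int.fract (z + u * y) ≤ 1 - 2 * k then 1 else 0)) := by
    intro u; simp only [hg, fa]; ring
  have hmono : ∀ (s s' t : ℝ), s ≤ s' →
      (if t ≤ s then (1 : ℝ) else 0) ≤ (if t ≤ s' then 1 else 0) := by
    intro s s' t h
    by_cases c1 : t ≤ s
    · rw [if_pos c1, if_pos (c1.trans h)]
    · rw [if_neg c1]; split_ifs <;> norm_num
  have hz1 : ∀ (s t : ℝ), 0 ≤ (if t ≤ s then (1 : ℝ) else 0) ∧ (if t ≤ s then (1 : ℝ) else 0) ≤ 1 := by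
    intro s t; split_ifs <;> norm_num
  have hg0 : ∀ u, 0 ≤ g u := by
    intro u
    rw [hgform]
    have a1 := hmono (1 / 2 - k) (1 / 2 + k) (Int.fract (z + u * y)) (by linarith)
    have a2 := (hz1 k (Int.fract (z + u * y))).1
    have a3 := (hz1 (1 - 2 * k) (Int.fract (z + u * y))).2
    linarith
  have hpt : ∀ c ∈ range (b * q), (r : ℝ) ^ 2 / 4 * (1 - g (idx q r c 0)) ≤
      Ph q r z y c (1 / 2) ^ 2 := by
    intro c _
    set w := Int.fract (z + (idx q r c 0 : ℕ) * y) with hw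
    have hw0 : 0 ≤ w := Int.fract_nonneg _
    have hw1 : w < 1 := Int.fract_lt_one _
    by_cases hbad : 1 ≤ g (idx q r c 0)
    · have : (r : ℝ) ^ 2 / 4 * (1 - g (idx q r c 0)) ≤ 0 :=
        mul_nonpos_of_nonneg_of_nonpos (by positivity) (by linarith)
      exact this.trans (sq_nonneg _)
    · rw [hgform] at hbad
      rw [← hw] at hbad
      push Not at hbad
      have b1 : k < w := by
        by_contra hcon
        push Not at hcon
        rw [if_pos hcon] at hbad
        have a1 := hmono (1 / 2 - k) (1 / 2 + k) w (by linarith)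
        have a3 := (hz1 (1 - 2 * k) w).2
        linarith
      have b2 : w ≤ 1 - 2 * k := by
        by_contra hcon
        rw [if_neg hcon] at hbad
        have a1 := hmono (1 / 2 - k) (1 / 2 + k) w (by linarith)
        have a3 := (hz1 k w).1
        linarith
      have b3 : w ≤ 1 / 2 - k ∨ 1 / 2 + k < w := by
        by_contra hcon
        push Not at hcon
        rw [if_pos hcon.2, if_neg (not_le.2 hcon.1)] at hbad
        have a2 := (hz1 k w).1
        have a3 := (hz1 (1 - 2 * k) w).2
        linarith
      have hfr : ∀ l ∈ range r, |Int.fract (z + (idx q r c l : ℕ) * y) - w| < k := by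
        intro l hl
        have hl' : (l : ℝ) < r := by exact_mod_cast mem_range.1 hl
        set e : ℝ := l * (q * y - P) with he
        have hek : |e| < k := by
          rw [he, abs_mul, abs_of_nonneg (Nat.cast_nonneg l)]
          calc (l : ℝ) * |q * y - P| ≤ l * (1 / (r * K)) := by gcongr
            _ = l / r * k := by rw [hk]; field_simp
            _ < 1 * k := by
                gcongr
                rwa [div_lt_one hrR]
            _ = k := one_mul _
        have hidx : ((idx q r c l : ℕ) : ℝ) = (idx q r c 0 : ℕ) + l * q := by
          unfold idx; push_cast; ring
        have h5 : Int.fract (z + (idx q r c l : ℕ) * y) = w + e := by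
          rw [Int.fract_eq_iff]
          have := abs_lt.1 hek
          refine ⟨by linarith, by linarith, ⌊z + (idx q r c 0 : ℕ) * y⌋ + l * P, ?_⟩
          rw [hidx, hw, he, Int.fract]
          push_cast
          ring
        rw [h5]; simpa using hek
      have hval : Ph q r z y c (1 / 2) = r / 2 ∨ Ph q r z y c (1 / 2) = -(r / 2) := by
        rcases b3 with h | h
        · left
          have : ∀ l ∈ range r, fa (1 / 2) (z + (idx q r c l : ℕ) * y) = 1 / 2 := by
            intro l hl
            have := abs_lt.1 (hfr l hl)
            unfold fa
            rw [if_pos (by linarith)]; norm_num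
          unfold Ph
          rw [Finset.sum_congr rfl this]; simp; ring
        · right
          have : ∀ l ∈ range r, fa (1 / 2) (z + (idx q r c l : ℕ) * y) = - (1 / 2) := by
            intro l hl
            have := abs_lt.1 (hfr l hl)
            unfold fa
            rw [if_neg (by linarith)]; norm_num
          unfold Ph
          rw [Finset.sum_congr rfl this]; simp; ring
      have hsq : Ph q r z y c (1 / 2) ^ 2 = (r : ℝ) ^ 2 / 4 := by
        rcases hval with h | h <;> rw [h] <;> ring
      rw [hsq]
      have := hg0 (idx q r c 0)
      have h9 : 0 ≤ (r : ℝ) ^ 2 / 4 * g (idx q r c 0) := by positivity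
      linarith
  refine le_trans ?_ (Finset.sum_le_sum hpt)
  rw [← Finset.mul_sum]
  refine mul_le_mul_of_nonneg_left ?_ (by positivity)
  rw [Finset.sum_sub_distrib]
  have hcnt : ∑ c ∈ range (b * q), g (idx q r c 0) ≤
      5 * ((b * q * r : ℕ) : ℝ) / K + 4 * C * ((b * q * r : ℕ) : ℝ) ^ (0.45 : ℝ) := by
    calc ∑ c ∈ range (b * q), g (idx q r c 0)
        ≤ ∑ c ∈ range (b * q), ∑ l ∈ range r, g (idx q r c l) :=
          Finset.sum_le_sum (fun c _ => Finset.single_le_sum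
            (f := fun l => g (idx q r c l)) (fun l _ => hg0 _) (mem_range.2 hr))
      _ = ∑ u ∈ range (b * q * r), g u := (sum_cluster q r b hq g).symm
      _ = ∑ u ∈ range (b * q * r), fa k (z + u * y) + (∑ u ∈ range (b * q * r), fa (1 / 2 + k) (z + u * y)
          - ∑ u ∈ range (b * q * r), fa (1 / 2 - k) (z + u * y))
          - ∑ u ∈ range (b * q * r), fa (1 - 2 * k) (z + u * y) + ((b * q * r : ℕ) : ℝ) * (5 * k) := by
          simp only [hg, Finset.sum_add_distrib, Finset.sum_sub_distrib, Finset.sum_const, card_range,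
            nsmul_eq_mul]
      _ ≤ _ := by
          have e1 := abs_le.1 (hC (b * q * r) z k (by linarith) (by linarith))
          have e2 := abs_le.1 (hC (b * q * r) z (1 / 2 + k) (by linarith) (by linarith))
          have e3 := abs_le.1 (hC (b * q * r) z (1 / 2 - k) (by linarith) (by linarith))
          have e4 := abs_le.1 (hC (b * q * r) z (1 - 2 * k) (by linarith) (by linarith))
          have e5 : ((b * q * r : ℕ) : ℝ) * (5 * k) = 5 * ((b * q * r : ℕ) : ℝ) / K := by
            rw [hk]; ring
          rw [e5]
          linarith [e1.1, e1.2, e2.1, e2.2, e3.1, e3.2, e4.1, e4.2]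
  simp only [Finset.sum_const, card_range, nsmul_eq_mul, mul_one]
  linarith

/-! Part D: probabilistic estimates in a window -/

lemma sqrt_add_le' {a b : ℝ} (ha : 0 ≤ a) (hb : 0 ≤ b) : √(a + b) ≤ √a + √b := by
  rw [Real.sqrt_le_left (by positivity)]
  nlinarith [Real.sq_sqrt ha, Real.sq_sqrt hb, mul_nonneg (Real.sqrt_nonneg a) (Real.sqrt_nonneg b)]

/-- clusters with index below `k` -/
def Uf (m k : ℕ) : Finset (Fin m) := Finset.univ.filter (fun c => c.1 < k)

lemma Uf_mono (m : ℕ) {k k' : ℕ} (h : k ≤ k') : Uf m k ⊆ Uf m k' := by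
  intro c hc
  simp only [Uf, mem_filter, mem_univ, true_and] at hc ⊢
  omega

lemma Uf_chain (m : ℕ) (k k' : ℕ) : Uf m k ⊆ Uf m k' ∨ Uf m k' ⊆ Uf m k := by
  rcases le_total k k' with h | h
  · exact Or.inl (Uf_mono m h)
  · exact Or.inr (Uf_mono m h)

lemma sum_Uf (m k : ℕ) (hk : k ≤ m) (F : ℕ → ℝ) :
    ∑ c ∈ Uf m k, F c.1 = ∑ c ∈ range k, F c := by
  unfold Uf
  rw [Finset.sum_filter, Fin.sum_univ_eq_sum_range (fun c => if c < k then F c else 0) m,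
    ← Finset.sum_filter]
  congr 1
  ext c; simp; omega

/-- fractional part of the `l`-th point of cluster `c` -/
noncomputable def yp (q r : ℕ) (z y : ℝ) (l c : ℕ) : ℝ := Int.fract (z + (idx q r c l : ℕ) * y)

def badA (q r B G Gt : ℕ) (d M L z y : ℝ) (e : Fin (B * q) → Bool) : Prop :=
  ∃ k ∈ range (Gt + 1), ∃ k' ∈ range (G + 1), ∃ b : Fin (k * B / Gt + 1),
    √L * (√(r * (k * ((B * q * r : ℕ) : ℝ) / Gt) / 2) + d * √M) <
      |∑ c ∈ Uf (B * q) (b.1 * q), bsg (e c) * Ph q r z y c.1 ((k' : ℝ) / G)|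

def badB (q r B G : ℕ) (d2 M L z y : ℝ) (e : Fin (B * q) → Bool) : Prop :=
  ∃ k' ∈ range G, ∃ l ∈ range r, ∃ b : Fin (B + 1), ∃ c0 : Fin (B * q),
    d2 * √(M * L) < |∑ c ∈ Uf (B * q) (b.1 * q),
      if ((k' : ℝ) / G < yp q r z y l c.1 ∧ yp q r z y l c.1 ≤ ((k' : ℝ) + 1) / G) ∧
        yp q r z y l c.1 ≤ yp q r z y l c0.1 then bsg (e c) else 0|

def badC (q B : ℕ) (M L : ℝ) (e : Fin (B * q) → Bool) : Prop :=
  ∃ b : Fin (B + 1), 2 * √(M * L) < |∑ c ∈ Uf (B * q) (b.1 * q), bsg (e c)|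

lemma badA_pr (q r B G Gt : ℕ) (hq : 0 < q) (hr : 0 < r) (hG : 0 < G) (hGt : 0 < Gt)
    (d M L z y C : ℝ) (hd : 0 < d)
    (hM : 0 < M) (hL : 0 ≤ L) (hC0 : 0 < C)
    (hC : ∀ n : ℕ, ∀ z a : ℝ, 0 ≤ a → a ≤ 1 →
      |∑ u ∈ range n, fa a (z + u * y)| ≤ C * (n : ℝ) ^ (0.45 : ℝ))
    (hn : ((B * q * r : ℕ) : ℝ) ≤ M)
    (hlarge : 2 * r * C * ((B * q * r : ℕ) : ℝ) ^ (0.45 : ℝ) ≤ d ^ 2 * M / 2) :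
    pr (fun e => badA q r B G Gt d M L z y e) ≤
      (Gt + 1) * (G + 1) * (4 * Real.exp (-(L * (1 + (d ^ 2 / 2) / (r + d ^ 2 / 2))))) := by
  have hGR : (0 : ℝ) < G := by exact_mod_cast hG
  have hGtR : (0 : ℝ) < Gt := by exact_mod_cast hGt
  have hrR : (0 : ℝ) < r := by exact_mod_cast hr
  have hone : ∀ k ∈ range (Gt + 1), ∀ k' ∈ range (G + 1),
      pr (fun e : Fin (B * q) → Bool => ∃ b : Fin (k * B / Gt + 1),
    √L * (√(r * (k * ((B * q * r : ℕ) : ℝ) / Gt) / 2) + d * √M) <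
      |∑ c ∈ Uf (B * q) (b.1 * q), bsg (e c) * Ph q r z y c.1 ((k' : ℝ) / G)|) ≤
      4 * Real.exp (-(L * (1 + (d ^ 2 / 2) / (r + d ^ 2 / 2)))) := by
    intro k hk k' hk'
    have hk2 : k ≤ Gt := by have := mem_range.1 hk; omega
    have hk2' : k' ≤ G := by have := mem_range.1 hk'; omega
    set A : ℝ := r * (k * ((B * q * r : ℕ) : ℝ) / Gt) / 2 with hA
    have hA0 : 0 ≤ A := by positivity
    have hkG : (k : ℝ) / Gt ≤ 1 := by rw [div_le_one hGtR]; exact_mod_cast hk2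
    have hAM : A ≤ r * M := by
      have : A = r / 2 * (((k : ℝ) / Gt) * ((B * q * r : ℕ) : ℝ)) := by rw [hA]; ring
      rw [this]
      have h4 : ((k : ℝ) / Gt) * ((B * q * r : ℕ) : ℝ) ≤ 1 * M := by gcongr
      nlinarith
    set D : ℝ := d ^ 2 * M with hD
    have hD0 : 0 < D := by positivity
    have hkB : k * B / Gt ≤ B := by
      apply Nat.div_le_of_le_mul
      exact Nat.mul_le_mul_right B hk2
    have ha0 : 0 ≤ (k' : ℝ) / G := by positivity
    have ha1 : (k' : ℝ) / G ≤ 1 := by rw [div_le_one hGR]; exact_mod_cast hk2'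
    have hVb := Ph_sq_sum q r (k * B / Gt) hq z y ((k' : ℝ) / G) C ha0 ha1 hC
    have hV : ∑ c ∈ Uf (B * q) ((k * B / Gt) * q), Ph q r z y c.1 ((k' : ℝ) / G) ^ 2 ≤ A / 2 + D / 4 := by
      rw [sum_Uf (B * q) _ (Nat.mul_le_mul_right q hkB)
        (fun c => Ph q r z y c ((k' : ℝ) / G) ^ 2)]
      refine hVb.trans ?_
      have hn1 : (((k * B / Gt) * q * r : ℕ) : ℝ) ≤ ((B * q * r : ℕ) : ℝ) := by
        norm_cast
        gcongr
      have hn2 : (((k * B / Gt) * q * r : ℕ) : ℝ) ≤ k * ((B * q * r : ℕ) : ℝ) / Gt := by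
        have : ((k * B / Gt : ℕ) : ℝ) ≤ ((k * B : ℕ) : ℝ) / Gt := Nat.cast_div_le
        push_cast at this ⊢
        calc ((k * B / Gt : ℕ) : ℝ) * q * r ≤ ((k : ℝ) * B / Gt) * q * r := by gcongr
          _ = _ := by ring
      have hn3 : (((k * B / Gt) * q * r : ℕ) : ℝ) ^ (0.45 : ℝ) ≤ ((B * q * r : ℕ) : ℝ) ^ (0.45 : ℝ) := by
        gcongr
      calc (r : ℝ) * ((((k * B / Gt) * q * r : ℕ) : ℝ) / 4 + C * (((k * B / Gt) * q * r : ℕ) : ℝ) ^ (0.45 : ℝ))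
          ≤ r * ((k * ((B * q * r : ℕ) : ℝ) / Gt) / 4 + C * ((B * q * r : ℕ) : ℝ) ^ (0.45 : ℝ)) := by
            refine mul_le_mul_of_nonneg_left ?_ hrR.le
            exact add_le_add (by linarith) (mul_le_mul_of_nonneg_left hn3 hC0.le)
        _ ≤ A / 2 + D / 4 := by rw [hA]; linarith
    have := levy_hoeffding (β := Fin (k * B / Gt + 1)) (fun b => Uf (B * q) (b.1 * q))
      (fun b b' => Uf_chain _ _ _) (Uf (B * q) ((k * B / Gt) * q))
      (fun b => Uf_mono _ (Nat.mul_le_mul_right q (by omega)))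
      (fun c => Ph q r z y c.1 ((k' : ℝ) / G)) (A / 2 + D / 4) (by positivity) hV
      (√L * (√A + d * √M)) (by positivity)
    refine this.trans ?_
    refine mul_le_mul_of_nonneg_left (Real.exp_le_exp.2 (neg_le_neg ?_)) (by norm_num)
    rw [le_div_iff₀ (by positivity)]
    have hsq : L * (A + D) ≤ (√L * (√A + d * √M)) ^ 2 := by
      rw [mul_pow, Real.sq_sqrt hL]
      refine mul_le_mul_of_nonneg_left ?_ hL
      have e1 := Real.sq_sqrt hA0
      have e2 := Real.sq_sqrt hM.le
      have e3 : 0 ≤ √A * (d * √M) := by positivity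
      calc A + D = √A ^ 2 + d ^ 2 * √M ^ 2 := by rw [e1, e2]
        _ ≤ (√A + d * √M) ^ 2 := by nlinarith
    refine le_trans ?_ hsq
    rw [mul_assoc]
    refine mul_le_mul_of_nonneg_left ?_ hL
    have hpos : 0 < (r : ℝ) + d ^ 2 / 2 := by positivity
    have h7 : d ^ 2 / 2 / (r + d ^ 2 / 2) * (A + D / 2) ≤ D / 2 := by
      rw [div_mul_eq_mul_div, div_le_iff₀ hpos]
      rw [hD]
      have : d ^ 2 * A ≤ d ^ 2 * (r * M) := by gcongr
      nlinarith
    nlinarith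
  unfold badA
  refine (pr_exists (range (Gt + 1)) _).trans ?_
  calc _ ≤ ∑ k ∈ range (Gt + 1), ∑ k' ∈ range (G + 1),
        4 * Real.exp (-(L * (1 + (d ^ 2 / 2) / (r + d ^ 2 / 2)))) := by
        refine Finset.sum_le_sum (fun k hk => ?_)
        refine (pr_exists (range (G + 1)) _).trans ?_
        exact Finset.sum_le_sum (fun k' hk' => hone k hk k' hk')
    _ = _ := by simp; ring

lemma badB_pr (q r B G : ℕ) (hq : 0 < q) (hG : 0 < G)
    (d2 M L z y C : ℝ) (hd : 0 < d2) (hdG : 8 ≤ d2 ^ 2 * G)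
    (hM : 0 < M) (hL : 0 ≤ L)
    (hC : ∀ n : ℕ, ∀ z a : ℝ, 0 ≤ a → a ≤ 1 →
      |∑ u ∈ range n, fa a (z + u * y)| ≤ C * (n : ℝ) ^ (0.45 : ℝ))
    (hn : ((B * q * r : ℕ) : ℝ) ≤ M)
    (hlarge : 2 * C * ((B * q * r : ℕ) : ℝ) ^ (0.45 : ℝ) ≤ M / G) :
    pr (fun e => badB q r B G d2 M L z y e) ≤ G * r * (8 * Real.exp (-(2 * L))) := by
  have hGR : (0 : ℝ) < G := by exact_mod_cast hG
  have hone : ∀ k' ∈ range G, ∀ l ∈ range r,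
      pr (fun e : Fin (B * q) → Bool => ∃ b : Fin (B + 1), ∃ c0 : Fin (B * q),
    d2 * √(M * L) < |∑ c ∈ Uf (B * q) (b.1 * q),
      if ((k' : ℝ) / G < yp q r z y l c.1 ∧ yp q r z y l c.1 ≤ ((k' : ℝ) + 1) / G) ∧
        yp q r z y l c.1 ≤ yp q r z y l c0.1 then bsg (e c) else 0|) ≤
      8 * Real.exp (-(2 * L)) := by
    intro k' hk' l hl
    have hk2 : (k' : ℝ) + 1 ≤ G := by exact_mod_cast mem_range.1 hk'
    set W : Finset (Fin (B * q)) := Finset.univ.filter (fun c =>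
      (k' : ℝ) / G < yp q r z y l c.1 ∧ yp q r z y l c.1 ≤ ((k' : ℝ) + 1) / G) with hW
    set X : Fin (B * q) → Finset (Fin (B * q)) := fun c0 => W.filter (fun c =>
      yp q r z y l c.1 ≤ yp q r z y l c0.1) with hX
    have hcard : (W.card : ℝ) ≤ 2 * M / G := by
      have h1 := cell_count q r B l hq (mem_range.1 hl) z y C ((k' : ℝ) / G) (((k' : ℝ) + 1) / G)
        (by positivity) (by gcongr; linarith) (by rw [div_le_one hGR]; exact hk2) hC
      have h2 : (W.card : ℝ) = ∑ c ∈ range (B * q), (if (k' : ℝ) / G < Int.fract (z + (idx q r c l : ℕ) * y) ∧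
        Int.fract (z + (idx q r c l : ℕ) * y) ≤ ((k' : ℝ) + 1) / G then (1 : ℝ) else 0) := by
        rw [← Fin.sum_univ_eq_sum_range (fun c => if (k' : ℝ) / G < Int.fract (z + (idx q r c l : ℕ) * y) ∧
          Int.fract (z + (idx q r c l : ℕ) * y) ≤ ((k' : ℝ) + 1) / G then (1 : ℝ) else 0),
          Finset.sum_boole]
        rfl
      rw [h2]
      refine h1.trans ?_
      have h3 : ((k' : ℝ) + 1) / G - k' / G = 1 / G := by ring
      rw [h3]
      have h4 : ((B * q * r : ℕ) : ℝ) * (1 / G) ≤ M * (1 / G) := by gcongr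
      have h5 : 2 * M / G = M * (1 / G) + M / G := by ring
      linarith
    have := levy_two (β := Fin (B + 1)) (γ := Fin (B * q)) (fun b => Uf (B * q) (b.1 * q))
      (fun b b' => Uf_chain _ _ _) X (by
        intro c c'
        rcases le_total (yp q r z y l c.1) (yp q r z y l c'.1) with h | h
        · left; intro c'' hc''
          simp only [hX, mem_filter] at hc'' ⊢
          exact ⟨hc''.1, hc''.2.trans h⟩
        · right; intro c'' hc''
          simp only [hX, mem_filter] at hc'' ⊢
          exact ⟨hc''.1, hc''.2.trans h⟩) W (fun b => Finset.filter_subset _ _)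
      (2 * M / G) (by positivity) hcard (d2 * √(M * L)) (by positivity)
    refine le_trans (pr_mono ?_) (this.trans ?_)
    · rintro e ⟨b, c0, h⟩
      refine ⟨b, c0, ?_⟩
      rw [← Finset.sum_filter] at h
      convert h using 3
      ext c
      simp only [hX, hW, mem_inter, mem_filter, mem_univ, true_and]
    · refine mul_le_mul_of_nonneg_left (Real.exp_le_exp.2 (neg_le_neg ?_)) (by norm_num)
      rw [le_div_iff₀ (by positivity), mul_pow, Real.sq_sqrt (by positivity)]
      have h6 : 2 * L * (2 * (2 * M / G)) = 8 * (M * L) / G := by ring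
      rw [h6, div_le_iff₀ hGR]
      have : 0 ≤ M * L := by positivity
      nlinarith
  unfold badB
  refine (pr_exists (range G) _).trans ?_
  calc _ ≤ ∑ k ∈ range G, ∑ k' ∈ range r, 8 * Real.exp (-(2 * L)) := by
        refine Finset.sum_le_sum (fun k hk => ?_)
        refine (pr_exists (range r) _).trans ?_
        exact Finset.sum_le_sum (fun k' hk' => hone k hk k' hk')
    _ = _ := by simp; ring

lemma badC_pr (q B : ℕ) (M L : ℝ) (hM : 0 < M) (hL : 0 ≤ L) (hn : ((B * q : ℕ) : ℝ) ≤ M) :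
    pr (fun e => badC q B M L e) ≤ 4 * Real.exp (-(2 * L)) := by
  have := levy_hoeffding (β := Fin (B + 1)) (fun b => Uf (B * q) (b.1 * q))
      (fun b b' => Uf_chain _ _ _) Finset.univ (fun b => Finset.subset_univ _)
      (fun _ => 1) M hM (by simpa using hn) (2 * √(M * L)) (by positivity)
  unfold badC
  simp only [mul_one] at this
  refine this.trans ?_
  refine mul_le_mul_of_nonneg_left (Real.exp_le_exp.2 (neg_le_neg ?_)) (by norm_num)
  rw [le_div_iff₀ (by positivity), mul_pow, Real.sq_sqrt (by positivity)]
  linarith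

lemma window_det (q r B G Gt : ℕ) (hq : 0 < q) (hr : 0 < r) (hG : 0 < G) (hGt : 0 < Gt)
    (d d2 M L z y : ℝ) (hd2 : 0 < d2)
    (hM : 0 < M) (hL : 0 ≤ L)
    (hn : ((B * q * r : ℕ) : ℝ) ≤ M) (e : Fin (B * q) → Bool)
    (hA : ¬ badA q r B G Gt d M L z y e) (hB : ¬ badB q r B G d2 M L z y e)
    (hCc : ¬ badC q B M L e) (b : ℕ) (hb : b ≤ B) (a : ℝ) (ha0 : 0 ≤ a) (ha1 : a ≤ 1) :
    |∑ c ∈ Uf (B * q) (b * q), bsg (e c) * Ph q r z y c.1 a| ≤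
      √L * (√(r * ((b * q * r : ℕ) : ℝ) / 2) +
        (√(r / (2 * Gt)) + d + r * d2 + 2 * r / G) * √M) := by
  have hGR : (0 : ℝ) < G := by exact_mod_cast hG
  have hGtR : (0 : ℝ) < Gt := by exact_mod_cast hGt
  have hrR : (0 : ℝ) < r := by exact_mod_cast hr
  have hML : √(M * L) = √L * √M := by rw [mul_comm, Real.sqrt_mul hL]
  -- grid point
  obtain ⟨k', hk'G, hk1, hk2⟩ : ∃ k' : ℕ, k' < G ∧ (k' : ℝ) / G ≤ a ∧ a ≤ ((k' : ℝ) + 1) / G := by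
    by_cases h : a = 1
    · refine ⟨G - 1, by omega, ?_, ?_⟩
      · rw [h, div_le_one hGR]; exact_mod_cast Nat.sub_le _ _
      · rw [h, le_div_iff₀ hGR]
        have : G ≤ (G - 1) + 1 := by omega
        have : (G : ℝ) ≤ ((G - 1 : ℕ) : ℝ) + 1 := by exact_mod_cast this
        linarith
    · have ha1' : a < 1 := lt_of_le_of_ne ha1 h
      have h0 : 0 ≤ a * G := by positivity
      refine ⟨⌊a * G⌋₊, ?_, ?_, ?_⟩
      · rw [Nat.floor_lt h0]; nlinarith
      · rw [div_le_iff₀ hGR]; exact Nat.floor_le h0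
      · rw [le_div_iff₀ hGR]; exact (Nat.lt_floor_add_one _).le
  -- time grid
  obtain ⟨k, hkGt, hkb, hkB⟩ : ∃ k : ℕ, k ≤ Gt ∧ b ≤ k * B / Gt ∧ k * B ≤ b * Gt + B := by
    rcases Nat.eq_zero_or_pos B with h | h
    · subst h; exact ⟨0, by omega, by simpa using hb, by omega⟩
    · refine ⟨(b * Gt + B - 1) / B, ?_, ?_, ?_⟩
      · have : b * Gt ≤ B * Gt := Nat.mul_le_mul_right _ hb
        rw [← Nat.lt_succ_iff, Nat.div_lt_iff_lt_mul h]
        have e3 : (Gt.succ) * B = B * Gt + B := by rw [Nat.succ_mul, mul_comm]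
        rw [e3]; omega
      · rw [Nat.le_div_iff_mul_le hGt]
        have e4 := Nat.div_add_mod (b * Gt + B - 1) B
        have e5 := Nat.mod_lt (b * Gt + B - 1) h
        rw [mul_comm] at e4
        omega
      · have e4 := Nat.div_mul_le_self (b * Gt + B - 1) B
        omega
  unfold badA at hA
  push Not at hA
  have h1 := hA k (mem_range.2 (by omega)) k' (mem_range.2 (by omega)) ⟨b, by omega⟩
  simp only at h1
  unfold badC at hCc
  push Not at hCc
  have h3 := hCc ⟨b, by omega⟩
  simp only at h3
  -- increments
  have h2 : ∀ l ∈ range r, |∑ c ∈ Uf (B * q) (b * q),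
      bsg (e c) * (if (k' : ℝ) / G < yp q r z y l c.1 ∧ yp q r z y l c.1 ≤ a then 1 else 0)| ≤
        d2 * √(M * L) := by
    intro l hl
    simp only [mul_ite, mul_one, mul_zero]
    set S := (Finset.univ : Finset (Fin (B * q))).filter (fun c => (k' : ℝ) / G < yp q r z y l c.1 ∧
      yp q r z y l c.1 ≤ a) with hS
    by_cases hne : S.Nonempty
    · obtain ⟨c0, hc0, hmax⟩ := Finset.exists_max_image S (fun c => yp q r z y l c.1) hne
      unfold badB at hB
      push Not at hB
      have h4 := hB k' (mem_range.2 hk'G) l hl ⟨b, by omega⟩ c0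
      simp only at h4
      refine le_trans (le_of_eq ?_) h4
      congr 1
      apply Finset.sum_congr rfl
      intro c _
      have hc0' := (Finset.mem_filter.1 hc0).2
      refine if_congr ⟨?_, ?_⟩ rfl rfl
      · rintro ⟨u1, u2⟩
        exact ⟨⟨u1, u2.trans hk2⟩, hmax c (Finset.mem_filter.2 ⟨mem_univ _, u1, u2⟩)⟩
      · rintro ⟨⟨u1, _⟩, u3⟩
        exact ⟨u1, u3.trans hc0'.2⟩
    · rw [Finset.sum_eq_zero]
      · simp; positivity
      · intro c _
        rw [if_neg]
        intro hcon
        exact hne ⟨c, Finset.mem_filter.2 ⟨mem_univ _, hcon⟩⟩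
  have hdec : ∑ c ∈ Uf (B * q) (b * q), bsg (e c) * Ph q r z y c.1 a =
      ∑ c ∈ Uf (B * q) (b * q), bsg (e c) * Ph q r z y c.1 ((k' : ℝ) / G) +
      (∑ l ∈ range r, ∑ c ∈ Uf (B * q) (b * q),
      bsg (e c) * (if (k' : ℝ) / G < yp q r z y l c.1 ∧ yp q r z y l c.1 ≤ a then 1 else 0)
      - r * (a - (k' : ℝ) / G) * ∑ c ∈ Uf (B * q) (b * q), bsg (e c)) := by
    rw [Finset.sum_comm, Finset.mul_sum, ← Finset.sum_sub_distrib, ← Finset.sum_add_distrib]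
    apply Finset.sum_congr rfl
    intro c _
    have hfa : ∀ l, fa a (z + (idx q r c.1 l : ℕ) * y) = fa ((k' : ℝ) / G) (z + (idx q r c.1 l : ℕ) * y) +
        (if (k' : ℝ) / G < yp q r z y l c.1 ∧ yp q r z y l c.1 ≤ a then 1 else 0) - (a - (k' : ℝ) / G) := by
      intro l
      unfold fa
      change (if yp q r z y l c.1 ≤ a then 1 else 0) - a = (if yp q r z y l c.1 ≤ (k' : ℝ) / G then 1 else 0)
        - (k' : ℝ) / G + _ - _
      by_cases c1 : (k' : ℝ) / G < yp q r z y l c.1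
      · rw [if_neg (not_le.2 c1)]
        by_cases c2 : yp q r z y l c.1 ≤ a
        · rw [if_pos c2, if_pos ⟨c1, c2⟩]; ring
        · rw [if_neg c2, if_neg (fun h => c2 h.2)]; ring
      · have c3 := not_lt.1 c1
        rw [if_pos c3, if_pos (c3.trans hk1), if_neg (fun h => c1 h.1)]; ring
    rw [← Finset.mul_sum]
    unfold Ph
    rw [Finset.sum_congr rfl (fun l _ => hfa l), Finset.sum_sub_distrib, Finset.sum_add_distrib]
    simp only [Finset.sum_const, card_range, nsmul_eq_mul]
    ring
  rw [hdec]
  have hX : |∑ l ∈ range r, ∑ c ∈ Uf (B * q) (b * q),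
      bsg (e c) * (if (k' : ℝ) / G < yp q r z y l c.1 ∧ yp q r z y l c.1 ≤ a then 1 else 0)| ≤
      r * (d2 * √(M * L)) := by
    refine (Finset.abs_sum_le_sum_abs _ _).trans ((Finset.sum_le_sum h2).trans ?_)
    simp
  have hY : |r * (a - (k' : ℝ) / G) * ∑ c ∈ Uf (B * q) (b * q), bsg (e c)| ≤
      r * (1 / G) * (2 * √(M * L)) := by
    rw [abs_mul]
    have h5 : a - (k' : ℝ) / G ≤ 1 / G := by
      have : ((k' : ℝ) + 1) / G = k' / G + 1 / G := by ring
      linarith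
    have h6 : |(r : ℝ) * (a - (k' : ℝ) / G)| ≤ r * (1 / G) := by
      rw [abs_of_nonneg (mul_nonneg hrR.le (by linarith))]
      gcongr
    gcongr
  have hZ : √(r * (k * ((B * q * r : ℕ) : ℝ) / Gt) / 2) ≤
      √(r * ((b * q * r : ℕ) : ℝ) / 2) + √(r / (2 * Gt)) * √M := by
    rw [← Real.sqrt_mul (by positivity)]
    refine le_trans (Real.sqrt_le_sqrt ?_) (sqrt_add_le' (by positivity) (by positivity))
    have h7 : (k : ℝ) * B ≤ b * Gt + B := by exact_mod_cast hkB
    have h8 : (k : ℝ) * ((B * q * r : ℕ) : ℝ) / Gt ≤ ((b * q * r : ℕ) : ℝ) + M / Gt := by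
      rw [div_le_iff₀ hGtR, add_mul, div_mul_cancel₀ _ hGtR.ne']
      calc (k : ℝ) * ((B * q * r : ℕ) : ℝ) = (k * B) * (q * r) := by push_cast; ring
        _ ≤ (b * Gt + B) * (q * r) := by gcongr
        _ = ((b * q * r : ℕ) : ℝ) * Gt + ((B * q * r : ℕ) : ℝ) := by push_cast; ring
        _ ≤ _ := by linarith
    have h9 : (r : ℝ) / (2 * Gt) * M = r * (M / Gt) / 2 := by field_simp
    rw [h9]
    nlinarith
  have hsL := Real.sqrt_nonneg L
  have hZ' := mul_le_mul_of_nonneg_left hZ hsL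
  refine (abs_add_le _ _).trans ?_
  have := abs_sub (∑ l ∈ range r, ∑ c ∈ Uf (B * q) (b * q),
      bsg (e c) * (if (k' : ℝ) / G < yp q r z y l c.1 ∧ yp q r z y l c.1 ≤ a then 1 else 0))
      (r * (a - (k' : ℝ) / G) * ∑ c ∈ Uf (B * q) (b * q), bsg (e c))
  rw [hML] at hX hY
  have h10 : (r : ℝ) * (1 / G) * (2 * (√L * √M)) = √L * (2 * r / G * √M) := by ring
  rw [h10] at hY
  nlinarith [h1, hX, hY, hZ', this]

/-! Part D2: asymptotics of the window estimates -/

def MM (i : ℕ) : ℕ := 2 ^ (i ^ 2)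
def qq (i : ℕ) : ℕ := padicValNat 2 i + 1
noncomputable def BB (r : ℕ) (ρ : ℝ) (i : ℕ) : ℕ := ⌊ρ * MM i / (qq i * r)⌋₊

lemma MM_pos (i : ℕ) : (0 : ℝ) < MM i := by unfold MM; positivity
lemma qq_pos (i : ℕ) : 0 < qq i := Nat.succ_pos _

lemma nn_le (r : ℕ) (hr : 0 < r) (ρ : ℝ) (hρ : 0 < ρ) (i : ℕ) :
    ((BB r ρ i * qq i * r : ℕ) : ℝ) ≤ ρ * MM i := by
  have hq : (0 : ℝ) < qq i := by exact_mod_cast qq_pos i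
  have hrR : (0 : ℝ) < r := by exact_mod_cast hr
  have hM := MM_pos i
  have := Nat.floor_le (show 0 ≤ ρ * MM i / (qq i * r) by positivity)
  rw [le_div_iff₀ (by positivity)] at this
  push_cast
  unfold BB
  linarith

lemma nn_ge (r : ℕ) (hr : 0 < r) (ρ : ℝ) (i : ℕ) :
    ρ * MM i - qq i * r ≤ ((BB r ρ i * qq i * r : ℕ) : ℝ) := by
  have hq : (0 : ℝ) < qq i := by exact_mod_cast qq_pos i
  have hrR : (0 : ℝ) < r := by exact_mod_cast hr
  have := (Nat.lt_floor_add_one (ρ * MM i / (qq i * r))).le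
  rw [div_le_iff₀ (by positivity)] at this
  push_cast
  unfold BB
  linarith

lemma qq_le (i : ℕ) (hi : 1 ≤ i) : qq i ≤ i := by
  unfold qq
  have h1 : padicValNat 2 i ≤ Nat.log 2 i := padicValNat_le_nat_log i
  have h2 : Nat.log 2 i < i := Nat.log_lt_self 2 (by omega)
  omega

/-- `M_i^{0.05}` beats `i^2` -/
lemma MM_asymp (κ : ℝ) (hκ : 0 < κ) :
    ∀ᶠ i : ℕ in atTop, (i : ℝ) ^ 2 * (MM i : ℝ) ^ (0.45 : ℝ) ≤ κ * √(MM i) := by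
  set c : ℝ := 0.05 * Real.log 2 with hc
  have hc0 : 0 < c := by have := Real.log_pos (show (1 : ℝ) < 2 by norm_num); positivity
  have h1 : ∀ᶠ i : ℕ in atTop, 2 / (κ * c ^ 2) ≤ (i : ℝ) :=
    tendsto_natCast_atTop_atTop.eventually_ge_atTop _
  filter_upwards [h1, eventually_ge_atTop 1] with i hi hi1
  have hi1R : (1 : ℝ) ≤ i := by exact_mod_cast hi1
  have hM := MM_pos i
  have h2 : √(MM i : ℝ) = (MM i : ℝ) ^ (0.45 : ℝ) * (MM i : ℝ) ^ (0.05 : ℝ) := by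
    rw [← Real.rpow_add hM, Real.sqrt_eq_rpow]; norm_num
  have h3 : (MM i : ℝ) ^ (0.05 : ℝ) = Real.exp (c * (i : ℝ) ^ 2) := by
    rw [Real.rpow_def_of_pos hM]
    unfold MM
    push_cast
    rw [Real.log_pow]
    push_cast
    congr 1
    rw [hc]; ring
  have h4 : (c * (i : ℝ) ^ 2) ^ 2 / 2 ≤ Real.exp (c * (i : ℝ) ^ 2) := by
    have h0 : 0 ≤ c * (i : ℝ) ^ 2 := by positivity
    have := Real.quadratic_le_exp_of_nonneg h0
    linarith
  rw [h2, h3]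
  have h5 : (i : ℝ) ^ 2 ≤ κ * Real.exp (c * (i : ℝ) ^ 2) := by
    have h6 : (i : ℝ) ^ 2 ≤ κ * ((c * (i : ℝ) ^ 2) ^ 2 / 2) := by
      rw [div_le_iff₀ (by positivity)] at hi
      have : (i : ℝ) ≤ (i : ℝ) ^ 2 := by nlinarith
      have h7 : 2 ≤ (i : ℝ) ^ 2 * (κ * c ^ 2) := by
        have : (i : ℝ) * (κ * c ^ 2) ≤ (i : ℝ) ^ 2 * (κ * c ^ 2) := by gcongr
        linarith
      nlinarith [sq_nonneg (i : ℝ)]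
    exact h6.trans (mul_le_mul_of_nonneg_left h4 hκ.le)
  calc (i : ℝ) ^ 2 * (MM i : ℝ) ^ (0.45 : ℝ) ≤ (κ * Real.exp (c * (i : ℝ) ^ 2)) * (MM i : ℝ) ^ (0.45 : ℝ) := by
        gcongr
    _ = _ := by ring

lemma MM_one_le (i : ℕ) : (1 : ℝ) ≤ MM i := by
  unfold MM; push_cast; exact one_le_pow₀ (by norm_num)

lemma MM_sqrt_le (i : ℕ) : √(MM i : ℝ) ≤ MM i := by
  have := MM_one_le i
  rw [Real.sqrt_le_left (by linarith)]
  nlinarith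

lemma MM_asymp2 (κ C : ℝ) (hκ : 0 < κ) (hC : 0 < C) :
    ∀ᶠ i : ℕ in atTop, ∀ n : ℝ, 0 ≤ n → n ≤ MM i → C * n ^ (0.45 : ℝ) ≤ κ * MM i := by
  filter_upwards [MM_asymp (κ / C) (by positivity), eventually_ge_atTop 1] with i hi hi1 n hn0 hn
  have hi1R : (1 : ℝ) ≤ i := by exact_mod_cast hi1
  have h1 : n ^ (0.45 : ℝ) ≤ (MM i : ℝ) ^ (0.45 : ℝ) := by gcongr
  have h2 : (MM i : ℝ) ^ (0.45 : ℝ) ≤ (i : ℝ) ^ 2 * (MM i : ℝ) ^ (0.45 : ℝ) := by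
    have : (0 : ℝ) ≤ (MM i : ℝ) ^ (0.45 : ℝ) := by positivity
    exact le_mul_of_one_le_left this (one_le_pow₀ hi1R)
  have h3 := MM_sqrt_le i
  calc C * n ^ (0.45 : ℝ) ≤ C * (κ / C * √(MM i)) := by gcongr; linarith
    _ = κ * √(MM i) := by field_simp
    _ ≤ κ * MM i := by gcongr

lemma meas_fa (a : ℝ) (z y : ℝ → ℝ) (hz : Measurable z) (hy : Measurable y) (u : ℝ) :
    Measurable (fun x => fa a (z x + u * y x)) := by
  unfold fa
  refine Measurable.sub (Measurable.ite (measurableSet_le ?_ measurable_const) measurable_const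
    measurable_const) measurable_const
  exact measurable_fract.comp (hz.add (hy.const_mul u))

lemma meas_Ph (q r c : ℕ) (a : ℝ) (z y : ℝ → ℝ) (hz : Measurable z) (hy : Measurable y) :
    Measurable (fun x => Ph q r (z x) (y x) c a) := by
  unfold Ph
  exact Finset.measurable_sum _ (fun l _ => meas_fa a z y hz hy _)

lemma meas_yp (q r l c : ℕ) (z y : ℝ → ℝ) (hz : Measurable z) (hy : Measurable y) :
    Measurable (fun x => yp q r (z x) (y x) l c) := by
  unfold yp
  exact measurable_fract.comp (hz.add (hy.const_mul _))

lemma meas_badA (q r B G Gt : ℕ) (d M L : ℝ) (z y : ℝ → ℝ) (hz : Measurable z) (hy : Measurable y)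
    (e : Fin (B * q) → Bool) : Measurable (fun x => badA q r B G Gt d M L (z x) (y x) e) := by
  unfold badA
  refine Measurable.exists (fun k => measurable_const.and (Measurable.exists (fun k' =>
    measurable_const.and (Measurable.exists (fun b => ?_)))))
  refine measurableSet_setOfPred.1 (measurableSet_lt measurable_const ?_)
  refine (Finset.measurable_sum _ (fun c _ => ?_)).abs
  exact (meas_Ph q r c.1 _ z y hz hy).const_mul _

lemma meas_badB (q r B G : ℕ) (d2 M L : ℝ) (z y : ℝ → ℝ) (hz : Measurable z) (hy : Measurable y)
    (e : Fin (B * q) → Bool) : Measurable (fun x => badB q r B G d2 M L (z x) (y x) e) := by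
  unfold badB
  refine Measurable.exists (fun k => measurable_const.and (Measurable.exists (fun k' =>
    measurable_const.and (Measurable.exists (fun b => Measurable.exists (fun c0 => ?_))))))
  refine measurableSet_setOfPred.1 (measurableSet_lt measurable_const ?_)
  refine (Finset.measurable_sum _ (fun c _ => ?_)).abs
  have h1 := meas_yp q r k' c.1 z y hz hy
  have h2 := meas_yp q r k' c0.1 z y hz hy
  exact Measurable.ite (((measurableSet_lt measurable_const h1).inter
    (measurableSet_le h1 measurable_const)).inter (measurableSet_le h1 h2))
    measurable_const measurable_const

/-- the random part of the discrepancy in window `i` -/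
noncomputable def Rw (r : ℕ) (ρ : ℝ) (i : ℕ) (e : Fin (BB r ρ i * qq i) → Bool) (b : ℕ) (a x : ℝ) : ℝ :=
  ∑ c ∈ Uf (BB r ρ i * qq i) (b * qq i), bsg (e c) * Ph (qq i) r ((MM i + 1) * x) (2 * x) c.1 a

lemma exp_log_rpow (i : ℕ) (hi : 1 ≤ i) (s : ℝ) :
    Real.exp (-(Real.log i * s)) = (i : ℝ) ^ (-s) := by
  have : (0 : ℝ) < i := by exact_mod_cast hi
  rw [Real.rpow_def_of_pos this]; congr 1; ring

lemma D_upper (r : ℕ) (hr : 0 < r) (ρ : ℝ) (hρ : 0 < ρ) (hρ1 : ρ ≤ 1) (δ : ℝ) (hδ : 0 < δ) :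
    ∃ Bd : (i : ℕ) → (Fin (BB r ρ i * qq i) → Bool) → Set ℝ,
      (∀ i e, MeasurableSet (Bd i e)) ∧
      (∀ x, KB (2 * x) → Summable (fun i => pr (fun e => x ∈ Bd i e))) ∧
      (∀ i, 1 ≤ i → ∀ e x, x ∉ Bd i e → ∀ b ≤ BB r ρ i,
        (∀ a, 0 ≤ a → a ≤ 1 → |Rw r ρ i e b a x| ≤
          √(Real.log i) * (√(r * ((b * qq i * r : ℕ) : ℝ) / 2) + δ * √(MM i))) ∧
        |∑ c ∈ Uf (BB r ρ i * qq i) (b * qq i), bsg (e c)| ≤ 2 * √(MM i * Real.log i)) := by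
  have hrR : (0 : ℝ) < r := by exact_mod_cast hr
  set d2 : ℝ := δ / (4 * r) with hd2
  have hd20 : 0 < d2 := by positivity
  set d : ℝ := δ / 4 with hd
  have hd0 : 0 < d := by positivity
  obtain ⟨G, hG⟩ := exists_nat_gt (max (8 / d2 ^ 2) (8 * r / δ))
  obtain ⟨Gt, hGt⟩ := exists_nat_gt (8 * r / δ ^ 2)
  have hG1 : 8 / d2 ^ 2 < G := lt_of_le_of_lt (le_max_left _ _) hG
  have hG2 : 8 * r / δ < G := lt_of_le_of_lt (le_max_right _ _) hG
  have hGR : (0 : ℝ) < G := lt_trans (by positivity) hG2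
  have hGtR : (0 : ℝ) < Gt := lt_trans (by positivity) hGt
  have hG0 : 0 < G := by exact_mod_cast hGR
  have hGt0 : 0 < Gt := by exact_mod_cast hGtR
  refine ⟨fun i e => {x | badA (qq i) r (BB r ρ i) G Gt d (MM i) (Real.log i) ((MM i + 1) * x) (2 * x) e ∨
    (badB (qq i) r (BB r ρ i) G d2 (MM i) (Real.log i) ((MM i + 1) * x) (2 * x) e ∨
    badC (qq i) (BB r ρ i) (MM i) (Real.log i) e)}, ?_, ?_, ?_⟩
  · intro i e
    have hz : Measurable (fun x : ℝ => ((MM i : ℝ) + 1) * x) := measurable_id.const_mul _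
    have hy : Measurable (fun x : ℝ => 2 * x) := measurable_id.const_mul _
    exact measurableSet_setOfPred.2 ((meas_badA _ _ _ _ _ _ _ _ _ _ hz hy e).or
      ((meas_badB _ _ _ _ _ _ _ _ _ hz hy e).or measurable_const))
  · rintro x ⟨C, hC0, hC⟩
    set η : ℝ := (d ^ 2 / 2) / (r + d ^ 2 / 2) with hη
    have hη0 : 0 < η := by positivity
    have hs1 : Summable (fun i : ℕ => ((Gt : ℝ) + 1) * (G + 1) * (4 * (i : ℝ) ^ (-(1 + η)))) :=
      ((Real.summable_nat_rpow.2 (by linarith)).mul_left 4).mul_left _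
    have hs2 : Summable (fun i : ℕ => (G : ℝ) * r * (8 * (i : ℝ) ^ (-(2 : ℝ)))) :=
      ((Real.summable_nat_rpow.2 (by norm_num)).mul_left 8).mul_left _
    have hs3 : Summable (fun i : ℕ => (4 * (i : ℝ) ^ (-(2 : ℝ)))) :=
      ((Real.summable_nat_rpow.2 (by norm_num)).mul_left 4)
    refine Summable.of_norm_bounded_eventually_nat (hs1.add (hs2.add hs3)) ?_
    filter_upwards [MM_asymp2 (d ^ 2 / 2) (2 * r * C) (by positivity) (by positivity),
      MM_asymp2 (1 / G) (2 * C) (by positivity) (by positivity), eventually_ge_atTop 1] with i h1 h2 hi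
    rw [Real.norm_of_nonneg (pr_nonneg _)]
    have hL : 0 ≤ Real.log i := Real.log_natCast_nonneg i
    have hn : ((BB r ρ i * qq i * r : ℕ) : ℝ) ≤ MM i := by
      refine (nn_le r hr ρ hρ i).trans ?_
      have := MM_pos i
      nlinarith
    have e1 := badA_pr (qq i) r (BB r ρ i) G Gt (qq_pos i) hr hG0 hGt0 d (MM i) (Real.log i)
      ((MM i + 1) * x) (2 * x) C hd0 (MM_pos i) hL hC0 hC hn
      (by have := h1 _ (Nat.cast_nonneg _) hn; linarith)
    have e2 := badB_pr (qq i) r (BB r ρ i) G (qq_pos i) hG0 d2 (MM i) (Real.log i)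
      ((MM i + 1) * x) (2 * x) C hd20 (by rw [div_lt_iff₀ (by positivity)] at hG1; linarith)
      (MM_pos i) hL hC hn
      (by have := h2 _ (Nat.cast_nonneg _) hn; rw [div_mul_eq_mul_div, one_mul] at this; linarith)
    have hn' : ((BB r ρ i * qq i : ℕ) : ℝ) ≤ MM i := by
      refine le_trans ?_ hn
      exact_mod_cast Nat.le_mul_of_pos_right _ hr
    have e3 := badC_pr (qq i) (BB r ρ i) (MM i) (Real.log i) (MM_pos i) hL hn'
    rw [exp_log_rpow i hi] at e1
    rw [mul_comm 2 (Real.log i), exp_log_rpow i hi] at e2 e3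
    exact (pr_or _ _).trans (add_le_add e1 ((pr_or _ _).trans (add_le_add e2 e3)))
  · intro i hi e x hx b hb
    simp only [Set.mem_ofPred_eq, not_or] at hx
    obtain ⟨hA, hB, hCc⟩ := hx
    have hL : 0 ≤ Real.log i := Real.log_natCast_nonneg i
    have hn : ((BB r ρ i * qq i * r : ℕ) : ℝ) ≤ MM i := by
      refine (nn_le r hr ρ hρ i).trans ?_
      have := MM_pos i
      nlinarith
    constructor
    · intro a ha0 ha1
      refine (window_det (qq i) r (BB r ρ i) G Gt (qq_pos i) hr hG0 hGt0 d d2 (MM i) (Real.log i)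
        ((MM i + 1) * x) (2 * x) hd20 (MM_pos i) hL hn e hA hB hCc b hb a ha0 ha1).trans ?_
      refine mul_le_mul_of_nonneg_left (add_le_add le_rfl (mul_le_mul_of_nonneg_right ?_
        (Real.sqrt_nonneg _))) (Real.sqrt_nonneg _)
      have f1 : √((r : ℝ) / (2 * Gt)) ≤ δ / 4 := by
        rw [Real.sqrt_le_left (by positivity), div_le_iff₀ (by positivity)]
        rw [div_lt_iff₀ (by positivity)] at hGt
        nlinarith
      have f2 : (r : ℝ) * d2 = δ / 4 := by rw [hd2]; field_simp
      have f3 : 2 * (r : ℝ) / G ≤ δ / 4 := by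
        rw [div_le_iff₀ hGR]
        rw [div_lt_iff₀ hδ] at hG2
        linarith
      linarith
    · unfold badC at hCc
      push Not at hCc
      exact hCc ⟨b, by omega⟩

lemma MM_poly (κ : ℝ) (hκ : 0 < κ) : ∀ᶠ i : ℕ in atTop, (i : ℝ) ^ 2 ≤ κ * √(MM i) := by
  filter_upwards [MM_asymp κ hκ] with i hi
  have h1 : (1 : ℝ) ≤ (MM i : ℝ) ^ (0.45 : ℝ) := Real.one_le_rpow (MM_one_le i) (by norm_num)
  have : (i : ℝ) ^ 2 ≤ (i : ℝ) ^ 2 * (MM i : ℝ) ^ (0.45 : ℝ) := le_mul_of_one_le_right (by positivity) h1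
  linarith

lemma MM_poly' (κ : ℝ) (hκ : 0 < κ) : ∀ᶠ i : ℕ in atTop, (i : ℝ) ^ 2 ≤ κ * (MM i) := by
  filter_upwards [MM_poly κ hκ] with i hi
  exact hi.trans (mul_le_mul_of_nonneg_left (MM_sqrt_le i) hκ.le)

lemma nn_half (r : ℕ) (hr : 0 < r) (ρ : ℝ) (hρ : 0 < ρ) :
    ∀ᶠ i : ℕ in atTop, ρ / 2 * MM i ≤ ((BB r ρ i * qq i * r : ℕ) : ℝ) := by
  have hrR : (0 : ℝ) < r := by exact_mod_cast hr
  filter_upwards [MM_poly' (ρ / (2 * r)) (by positivity), eventually_ge_atTop 1] with i hi hi1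
  have h1 := nn_ge r hr ρ i
  have h2 : (qq i : ℝ) ≤ i := by exact_mod_cast qq_le i hi1
  have h3 : (1 : ℝ) ≤ i := by exact_mod_cast hi1
  have h4 : (qq i : ℝ) * r ≤ (i : ℝ) ^ 2 * r := by
    apply mul_le_mul_of_nonneg_right _ hrR.le; nlinarith
  have h5 : (i : ℝ) ^ 2 * r ≤ (ρ / (2 * r) * MM i) * r := by gcongr
  have h6 : (ρ / (2 * r) * MM i) * r = ρ / 2 * MM i := by field_simp
  linarith

def Hs (r : ℕ) (ρ δ : ℝ) (i : ℕ) (e : Fin (BB r ρ i * qq i) → Bool) : Set ℝ :=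
  {x | (1 - δ) * (√(Real.log i) * √(r * ((BB r ρ i * qq i * r : ℕ) : ℝ) / 2)) ≤
    Rw r ρ i e (BB r ρ i) (1 / 2) x}

lemma Hs_meas (r : ℕ) (ρ δ : ℝ) (i : ℕ) (e : Fin (BB r ρ i * qq i) → Bool) :
    MeasurableSet (Hs r ρ δ i e) := by
  unfold Hs Rw
  refine measurableSet_le measurable_const (Finset.measurable_sum _ (fun c _ => ?_))
  have hz : Measurable (fun x : ℝ => ((MM i : ℝ) + 1) * x) := measurable_id.const_mul _
  have hy : Measurable (fun x : ℝ => 2 * x) := measurable_id.const_mul _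
  exact (meas_Ph _ r c.1 _ _ _ hz hy).const_mul _

lemma Uf_top (m : ℕ) : Uf m m = Finset.univ := by
  unfold Uf; ext c; simp

set_option maxHeartbeats 1000000 in
lemma Hs_pr (r : ℕ) (hr : 0 < r) (ρ : ℝ) (hρ : 0 < ρ) (hρ1 : ρ ≤ 1) (δ : ℝ) (hδ : 0 < δ)
    (hδ1 : δ < 1) (x : ℝ) (hx : KB (2 * x)) :
    ∃ q : ℕ, 0 < q ∧ ∀ᶠ i : ℕ in atTop, qq i = q → 1 / (i : ℝ) ≤ pr (fun e => x ∈ Hs r ρ δ i e) := by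
  obtain ⟨C, hC0, hC⟩ := hx
  have hrR : (1 : ℝ) ≤ r := by exact_mod_cast hr
  set d : ℝ := δ / 10 with hd
  have hd0 : 0 < d := by positivity
  have hd1 : d < 1 / 10 := by rw [hd]; linarith
  set K : ℝ := 10 * r / d with hK
  have hK4 : 4 ≤ K := by rw [hK, le_div_iff₀ hd0]; nlinarith
  obtain ⟨k, hk⟩ := exists_nat_gt (r * K)
  have hk0 : 0 < k := by
    have : (0 : ℝ) < k := lt_trans (by positivity) hk
    exact_mod_cast this
  obtain ⟨P, q', hq0, -, hP⟩ := Real.exists_int_int_abs_mul_sub_le (2 * x) hk0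
  obtain ⟨q, rfl⟩ := Int.eq_ofNat_of_zero_le hq0.le
  have hq : 0 < q := by simpa using hq0
  have hP' : |(q : ℝ) * (2 * x) - P| ≤ 1 / (r * K) := by
    have : (1 : ℝ) / (k + 1) ≤ 1 / (r * K) := by
      apply one_div_le_one_div_of_le (by positivity); linarith
    exact le_trans (by simpa using hP) this
  refine ⟨q, hq, ?_⟩
  have hlog : Tendsto (fun i : ℕ => Real.log i) atTop atTop :=
    Real.tendsto_log_atTop.comp tendsto_natCast_atTop_atTop
  filter_upwards [nn_half r hr ρ hρ, MM_asymp2 (d * ρ / (4 * r)) (4 * C) (by positivity) (by positivity),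
    MM_poly' (ρ / (16 * r)) (by positivity), eventually_ge_atTop 1,
    hlog.eventually_ge_atTop (6 / d ^ 2), hlog.eventually_ge_atTop (2 / d)] with i h1 h2 h3 hi h4 h5 hqi
  have hi1 : (1 : ℝ) ≤ i := by exact_mod_cast hi
  have hM := MM_pos i
  set B := BB r ρ i with hB
  set n : ℝ := ((B * qq i * r : ℕ) : ℝ) with hn
  set m : ℝ := ((B * qq i : ℕ) : ℝ) with hm
  have hnm : n = m * r := by rw [hn, hm]; push_cast; ring
  have hnM : n ≤ MM i := by
    refine (nn_le r hr ρ hρ i).trans ?_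
    nlinarith
  have hn0 : 0 < n := lt_of_lt_of_le (by positivity) h1
  set L := Real.log i with hL
  have hL0 : 0 < L := lt_of_lt_of_le (by positivity) h5
  set z : ℝ := ((MM i : ℝ) + 1) * x with hz
  set w : Fin (B * qq i) → ℝ := fun c => Ph (qq i) r z (2 * x) c.1 (1 / 2) with hw
  set V : ℝ := ∑ c, w c ^ 2 with hV
  have hVlow : (1 - d) * (r * n / 4) ≤ V := by
    have e1 := Ph_var_lower (qq i) r B (qq_pos i) hr z (2 * x) C K hK4 P (by rw [hqi]; exact hP') hC
    have e2 : V = ∑ c ∈ range (B * qq i), Ph (qq i) r z (2 * x) c (1 / 2) ^ 2 := by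
      rw [hV, ← Fin.sum_univ_eq_sum_range (fun c => Ph (qq i) r z (2 * x) c (1 / 2) ^ 2)]
    rw [← e2] at e1
    refine le_trans ?_ e1
    have e3 : 5 * n / K = d * m / 2 := by rw [hnm, hK]; field_simp; ring
    have e4 : 4 * C * n ^ (0.45 : ℝ) ≤ d * m / 2 := by
      refine (h2 n hn0.le hnM).trans ?_
      have : ρ / 2 * MM i / r ≤ m := by rw [div_le_iff₀ (by positivity), ← hnm]; exact h1
      calc d * ρ / (4 * r) * MM i = d / 2 * (ρ / 2 * MM i / r) := by field_simp; norm_num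
        _ ≤ d / 2 * m := by gcongr
        _ = _ := by ring
    have e5 : (1 - d) * (r * n / 4) = (r : ℝ) ^ 2 / 4 * (m - (d * m / 2 + d * m / 2)) := by
      rw [hnm]; ring
    rw [e5]
    change _ ≤ (r : ℝ) ^ 2 / 4 * (m - (5 * n / K + 4 * C * n ^ (0.45 : ℝ)))
    rw [e3]
    gcongr
  have hV0 : 0 < V := lt_of_lt_of_le (mul_pos (by linarith) (by positivity)) hVlow
  set Q : ℝ := 2 * (1 - 3 * d) * L with hQ
  have hQ0 : 0 < Q := by rw [hQ]; apply mul_pos _ hL0; linarith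
  have hQL : L ≤ Q := by rw [hQ]; nlinarith
  have hQL2 : Q ≤ 2 * L := by rw [hQ]; nlinarith
  set t : ℝ := √(Q / V) with ht
  have ht2 : t ^ 2 = Q / V := Real.sq_sqrt (by positivity)
  have htV : t ^ 2 * V = Q := by rw [ht2]; field_simp
  have hLi : L ≤ i := (Real.log_le_sub_one_of_pos (by linarith)).trans (by linarith)
  have hT := tilt w V r t d rfl (fun c => Ph_abs _ _ _ _ _ _ (by norm_num) (by norm_num))
    (Real.sqrt_nonneg _) hd0 (by linarith) (by
      have : t ^ 4 * (r : ℝ) ^ 2 * V = Q ^ 2 * r ^ 2 / V := by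
        rw [show t ^ 4 = (t ^ 2) ^ 2 by ring, ht2]; field_simp
      rw [this, div_div, div_le_one (by positivity)]
      have a1 : Q ^ 2 ≤ 4 * (i : ℝ) ^ 2 := by
        have : Q ≤ 2 * i := by linarith
        calc Q ^ 2 ≤ (2 * (i : ℝ)) ^ 2 := pow_le_pow_left₀ hQ0.le this 2
          _ = _ := by ring
      have a2 : (i : ℝ) ^ 2 * (16 * r) ≤ ρ * MM i := by
        rw [div_mul_eq_mul_div, le_div_iff₀ (by positivity)] at h3
        exact h3
      have a3 : r * n / 8 ≤ V := by
        have : r * n / 8 ≤ (1 - d) * (r * n / 4) := by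
          have : 0 < r * n := by positivity
          nlinarith
        linarith
      have a4 : r * (ρ / 2 * MM i) ≤ r * n := by gcongr
      have a5 : r * ((i : ℝ) ^ 2 * (16 * r)) ≤ r * (ρ * MM i) := by gcongr
      have a6 : Q ^ 2 * (r : ℝ) ^ 2 ≤ 4 * (i : ℝ) ^ 2 * (r : ℝ) ^ 2 := by gcongr
      linarith) (by
      rw [htV]
      rw [div_le_iff₀ (by positivity)] at h4
      nlinarith [sq_nonneg d])
  have hlow : 1 / (i : ℝ) ≤ Real.exp (-2) * Real.exp (-(1 / 2 + d) * (t ^ 2 * V)) := by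
    rw [htV, ← Real.exp_add, one_div]
    have : (i : ℝ)⁻¹ = Real.exp (- L) := by
      rw [Real.exp_neg, hL, Real.exp_log (by linarith)]
    rw [this]
    apply Real.exp_le_exp.2
    rw [div_le_iff₀ hd0] at h5
    rw [hQ]
    have : 0 < d * d * L := by positivity
    nlinarith
  refine hlow.trans (hT.trans (pr_mono (fun e he => ?_)))
  unfold Hs
  rw [Set.mem_ofPred_eq]
  unfold Rw
  rw [Uf_top]
  refine le_trans ?_ he
  -- threshold comparison
  have htV2 : t * V = √(Q * V) := by
    rw [ht, ← Real.sqrt_sq hV0.le, ← Real.sqrt_mul (by positivity), Real.sqrt_sq hV0.le]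
    congr 1; field_simp
  rw [htV2]
  change (1 - δ) * (√L * √(r * n / 2)) ≤ _
  rw [← Real.sqrt_mul hL0.le]
  have b1 : (1 - 3 * d) * √(L * (r * n / 2)) ≤ √(Q * V) := by
    apply Real.le_sqrt_of_sq_le
    rw [mul_pow, Real.sq_sqrt (by positivity)]
    have : Q * ((1 - d) * (r * n / 4)) ≤ Q * V := by gcongr
    refine le_trans ?_ this
    rw [hQ]
    have c0 : 0 ≤ (1 - 3 * d) * (L * (r * n / 2)) := by
      apply mul_nonneg (by linarith); positivity
    nlinarith
  have b2 : (1 - δ) ≤ (1 - d) * (1 - 3 * d) := by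
    rw [show δ = 10 * d by rw [hd]; ring]
    nlinarith
  have b3 : 0 ≤ √(L * (r * n / 2)) := Real.sqrt_nonneg _
  calc (1 - δ) * √(L * (r * n / 2)) ≤ ((1 - d) * (1 - 3 * d)) * √(L * (r * n / 2)) := by gcongr
    _ = (1 - d) * ((1 - 3 * d) * √(L * (r * n / 2))) := by ring
    _ ≤ _ := mul_le_mul_of_nonneg_left b1 (by linarith)

lemma qq_odd (q k : ℕ) (hq : 0 < q) : qq (2 ^ (q - 1) * (2 * k + 1)) = q := by
  unfold qq
  have : Fact (Nat.Prime 2) := ⟨Nat.prime_two⟩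
  rw [padicValNat.mul (by positivity) (by omega), padicValNat.prime_pow,
    padicValNat.eq_zero_of_not_dvd (by omega)]
  omega

lemma Hs_div (r : ℕ) (hr : 0 < r) (ρ : ℝ) (hρ : 0 < ρ) (hρ1 : ρ ≤ 1) (δ : ℝ) (hδ : 0 < δ)
    (hδ1 : δ < 1) (x : ℝ) (hx : KB (2 * x)) :
    ¬ Summable (fun i => pr (fun e => x ∈ Hs r ρ δ i e)) := by
  intro hs
  obtain ⟨q, hq, hev⟩ := Hs_pr r hr ρ hρ hρ1 δ hδ hδ1 x hx
  set φ : ℕ → ℕ := fun k => 2 ^ (q - 1) * (2 * k + 1) with hφ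
  have hmono : StrictMono φ := by
    intro a b hab
    simp only [hφ]
    apply Nat.mul_lt_mul_of_pos_left (by omega) (by positivity)
  have hs2 := hs.comp_injective hmono.injective
  have hev2 := hmono.tendsto_atTop.eventually hev
  have hs3 : Summable (fun k : ℕ => 1 / ((φ k : ℕ) : ℝ)) := by
    refine Summable.of_norm_bounded_eventually_nat hs2 ?_
    filter_upwards [hev2] with k hk
    rw [Real.norm_of_nonneg (by positivity)]
    exact hk (qq_odd q k hq)
  have hs4 : Summable (fun k : ℕ => 1 / ((k + 1 : ℕ) : ℝ)) := by
    have := hs3.mul_left ((2 : ℝ) ^ (q - 1) * 2)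
    refine Summable.of_nonneg_of_le (fun _ => by positivity) (fun k => ?_) this
    simp only [hφ]
    push_cast
    rw [mul_one_div, div_le_div_iff₀ (by positivity) (by positivity)]
    have : (0 : ℝ) < 2 ^ (q - 1) := by positivity
    nlinarith
  rw [summable_nat_add_iff 1 (f := fun k : ℕ => 1 / ((k : ℕ) : ℝ))] at hs4
  exact Real.not_summable_one_div_natCast hs4

/-! Part F: the deterministic construction -/

def cl (q r u : ℕ) : ℕ := (u / (r * q)) * q + u % q

lemma cl_idx (q r c l : ℕ) (hl : l < r) (hq : 0 < q) : cl q r (idx q r c l) = c := by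
  unfold cl idx
  have h1 : l * q + c % q < r * q := by
    have : c % q < q := Nat.mod_lt _ hq
    calc l * q + c % q < l * q + q := by omega
      _ = (l + 1) * q := by ring
      _ ≤ r * q := Nat.mul_le_mul_right _ hl
  have hrq : 0 < r * q := by omega
  have h2 : (c / q * (r * q) + l * q + c % q) / (r * q) = c / q := by
    rw [add_assoc, mul_comm (c / q), Nat.mul_add_div hrq, Nat.div_eq_of_lt h1, add_zero]
  have h3 : (c / q * (r * q) + l * q + c % q) % q = c % q := by
    rw [show c / q * (r * q) + l * q + c % q = c % q + (c / q * r + l) * q by ring,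
      Nat.add_mul_mod_self_right, Nat.mod_mod]
  rw [h2, h3]
  exact Nat.div_add_mod' c q

noncomputable def nn (r : ℕ) (ρ : ℝ) (i : ℕ) : ℕ := BB r ρ i * qq i * r

abbrev Om (r : ℕ) (ρ : ℝ) : Type := (i : ℕ) → Fin (BB r ρ i * qq i) → Bool

noncomputable def we {r : ℕ} {ρ : ℝ} (ω : Om r ρ) (i c : ℕ) : Bool :=
  if h : c < BB r ρ i * qq i then ω i ⟨c, h⟩ else false

def del {r : ℕ} {ρ : ℝ} (ω : Om r ρ) (s : ℕ) : Prop :=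
  ∃ i u, 1 ≤ i ∧ u < nn r ρ i ∧ s = MM i + 1 + 2 * u ∧ we ω i (cl (qq i) r u) = true

open Classical in
noncomputable def DD {r : ℕ} {ρ : ℝ} (ω : Om r ρ) (s : ℕ) : ℝ := if del ω s then 1 else 0

noncomputable def kk (r : ℕ) (ρ : ℝ) (i T : ℕ) : ℕ := min (nn r ρ i) ((T - MM i + 1) / 2)
noncomputable def bb (r : ℕ) (ρ : ℝ) (i T : ℕ) : ℕ := kk r ρ i T / (qq i * r)

lemma MM_mono : Monotone MM := by
  intro a b h
  unfold MM
  exact Nat.pow_le_pow_right (by norm_num) (Nat.pow_le_pow_left h 2)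

lemma MM_double (i : ℕ) : 2 * MM i ≤ MM (i + 1) := by
  unfold MM
  rw [← pow_succ']
  apply Nat.pow_le_pow_right (by norm_num)
  have : (i + 1) ^ 2 = i ^ 2 + 2 * i + 1 := by ring
  omega

lemma MM_even (i : ℕ) (hi : 1 ≤ i) : 2 ∣ MM i := by
  unfold MM
  exact dvd_pow_self 2 (by positivity)

lemma nn_two (r : ℕ) (hr : 0 < r) (ρ : ℝ) (hρ : 0 < ρ) (hρ1 : ρ ≤ 1 / 2) (i : ℕ) :
    2 * nn r ρ i ≤ MM i := by
  have h := nn_le r hr ρ hρ i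
  have hM := MM_pos i
  have : (2 * (nn r ρ i : ℕ) : ℝ) ≤ MM i := by
    unfold nn
    nlinarith
  exact_mod_cast this

lemma win_unique {i j s : ℕ} (h1 : MM i < s) (h2 : s ≤ MM (i + 1)) (h3 : MM j < s)
    (h4 : s ≤ MM (j + 1)) : i = j := by
  rcases lt_trichotomy i j with h | h | h
  · have := MM_mono (show i + 1 ≤ j from h); omega
  · exact h
  · have := MM_mono (show j + 1 ≤ i from h); omega

lemma del_win {r : ℕ} (hr : 0 < r) {ρ : ℝ} (hρ : 0 < ρ) (hρ1 : ρ ≤ 1 / 2) (ω : Om r ρ) {i s : ℕ}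
    (h1 : MM i < s) (h2 : s ≤ MM (i + 1)) (hd : del ω s) :
    ∃ u, u < nn r ρ i ∧ s = MM i + 1 + 2 * u ∧ we ω i (cl (qq i) r u) = true := by
  obtain ⟨j, u, hj, hu, hs, hw⟩ := hd
  have h3 := nn_two r hr ρ hρ hρ1 j
  have h4 := MM_double j
  have : i = j := win_unique h1 h2 (by omega) (by omega)
  subst this
  exact ⟨u, hu, hs, hw⟩

lemma DD_window {r : ℕ} (hr : 0 < r) {ρ : ℝ} (hρ : 0 < ρ) (hρ1 : ρ ≤ 1 / 2) (ω : Om r ρ) (i T : ℕ)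
    (hi : 1 ≤ i) (hT : MM i ≤ T) (hT2 : T ≤ MM (i + 1)) (f : ℕ → ℝ) :
    ∑ s ∈ Ioc (MM i) T, DD ω s * f s = ∑ u ∈ range (kk r ρ i T),
      (if we ω i (cl (qq i) r u) = true then (1 : ℝ) else 0) * f (MM i + 1 + 2 * u) := by
  symm
  apply Finset.sum_of_injOn (fun u => MM i + 1 + 2 * u)
  · intro a _ b _ h
    simp only at h; omega
  · intro u hu
    simp only [coe_range, Set.mem_Iio] at hu
    simp only [coe_Ioc, Set.mem_Ioc]
    unfold kk at hu
    omega
  · intro s hs hns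
    rw [mem_Ioc] at hs
    unfold DD
    rw [if_neg, zero_mul]
    intro hd
    obtain ⟨u, hu, hsu, hw⟩ := del_win hr hρ hρ1 ω hs.1 (by omega) hd
    apply hns
    refine ⟨u, ?_, hsu.symm⟩
    simp only [coe_range, Set.mem_Iio]
    unfold kk
    omega
  · intro u hu
    rw [mem_range] at hu
    unfold DD
    congr 1
    have hu' : MM i + 1 + 2 * u ≤ T := by unfold kk at hu; omega
    have hu2 : u < nn r ρ i := by unfold kk at hu; omega
    classical
    refine if_congr ?_ rfl rfl
    constructor
    · intro h
      exact ⟨i, u, hi, hu2, rfl, h⟩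
    · intro h
      obtain ⟨v, hv, hsv, hw⟩ := del_win hr hρ hρ1 ω (i := i) (by omega) (by omega) h
      have : u = v := by omega
      rw [this]; exact hw

lemma bb_le (r : ℕ) (ρ : ℝ) (i T : ℕ) : bb r ρ i T ≤ BB r ρ i := by
  unfold bb kk nn
  have hq := qq_pos i
  apply Nat.div_le_of_le_mul
  calc _ ≤ BB r ρ i * qq i * r := min_le_left _ _
    _ = _ := by ring

lemma bb_kk (r : ℕ) (ρ : ℝ) (i T : ℕ) : bb r ρ i T * qq i * r ≤ kk r ρ i T := by
  unfold bb
  rw [mul_assoc]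
  exact Nat.div_mul_le_self _ _

lemma bsg_ite (b : Bool) : (if b = true then (1 : ℝ) else 0) = 1 / 2 + 1 / 2 * bsg b := by
  cases b <;> simp [bsg]; norm_num

lemma window_split {r : ℕ} (hr : 0 < r) {ρ : ℝ} (ω : Om r ρ) (i T : ℕ)
    (hi : 1 ≤ i) (g : ℕ → ℝ) (hg : ∀ u, |g u| ≤ 1) :
    |∑ u ∈ range (kk r ρ i T), (if we ω i (cl (qq i) r u) = true then (1 : ℝ) else 0) * g u
      - (1 / 2 * ∑ u ∈ range (kk r ρ i T), g u +
        1 / 2 * ∑ c ∈ Uf (BB r ρ i * qq i) (bb r ρ i T * qq i), bsg (ω i c) *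
          ∑ l ∈ range r, g (idx (qq i) r c.1 l))| ≤ i * r := by
  set k := kk r ρ i T with hk
  set b := bb r ρ i T with hb
  have hq := qq_pos i
  have hbk : b * qq i * r ≤ k := bb_kk r ρ i T
  have hbk2 : k ≤ b * qq i * r + qq i * r := by
    have : k < (k / (qq i * r) + 1) * (qq i * r) := by
      have := Nat.lt_div_mul_add (a := k) (b := qq i * r) (by positivity)
      rw [add_mul, one_mul]; exact this
    rw [hb, bb, ← hk]
    nlinarith
  have h1 : ∑ u ∈ range k, (if we ω i (cl (qq i) r u) = true then (1 : ℝ) else 0) * g u =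
      1 / 2 * ∑ u ∈ range k, g u + 1 / 2 * ∑ u ∈ range k, bsg (we ω i (cl (qq i) r u)) * g u := by
    rw [mul_sum, mul_sum, ← sum_add_distrib]
    apply sum_congr rfl
    intro u _
    rw [bsg_ite]; ring
  have h2 : ∑ u ∈ range k, bsg (we ω i (cl (qq i) r u)) * g u =
      ∑ u ∈ range (b * qq i * r), bsg (we ω i (cl (qq i) r u)) * g u +
      ∑ u ∈ Ico (b * qq i * r) k, bsg (we ω i (cl (qq i) r u)) * g u := by
    rw [Finset.sum_range_add_sum_Ico _ hbk]
  have h3 : ∑ u ∈ range (b * qq i * r), bsg (we ω i (cl (qq i) r u)) * g u =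
      ∑ c ∈ Uf (BB r ρ i * qq i) (b * qq i), bsg (ω i c) *
          ∑ l ∈ range r, g (idx (qq i) r c.1 l) := by
    rw [sum_cluster _ _ _ hq]
    have : ∀ c ∈ range (b * qq i), ∑ l ∈ range r, bsg (we ω i (cl (qq i) r (idx (qq i) r c l))) *
        g (idx (qq i) r c l) = bsg (we ω i c) * ∑ l ∈ range r, g (idx (qq i) r c l) := by
      intro c _
      rw [mul_sum]
      apply sum_congr rfl
      intro l hl
      rw [cl_idx _ _ _ _ (mem_range.1 hl) hq]
    rw [sum_congr rfl this, ← sum_Uf (BB r ρ i * qq i) (b * qq i)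
      (Nat.mul_le_mul_right _ (bb_le r ρ i T)) (fun c => bsg (we ω i c) * ∑ l ∈ range r, g (idx (qq i) r c l))]
    apply sum_congr rfl
    intro c _
    unfold we
    rw [dif_pos c.2]
  have h4 : |∑ u ∈ Ico (b * qq i * r) k, bsg (we ω i (cl (qq i) r u)) * g u| ≤ i * r := by
    refine (abs_sum_le_sum_abs _ _).trans ?_
    calc _ ≤ ∑ u ∈ Ico (b * qq i * r) k, (1 : ℝ) := by
          apply sum_le_sum
          intro u _
          rw [abs_mul]
          have : |bsg (we ω i (cl (qq i) r u))| = 1 := by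
            cases we ω i (cl (qq i) r u) <;> simp [bsg]
          rw [this, one_mul]; exact hg u
      _ = ((k - b * qq i * r : ℕ) : ℝ) := by simp
      _ ≤ ((i * r : ℕ) : ℝ) := by
          have := Nat.mul_le_mul_right r (qq_le i hi)
          exact_mod_cast (by omega)
      _ = _ := by push_cast; ring
  rw [h1, h2, h3]
  have h5 : (0 : ℝ) ≤ i * r := by positivity
  have := abs_le.1 h4
  rw [abs_le]
  constructor <;> linarith [this.1, this.2]

lemma sum_nth (p : ℕ → Prop) [DecidablePred p] (hp : (Set.ofPred p).Infinite) (g : ℕ → ℝ) (N : ℕ) :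
    ∑ j ∈ range N, g (Nat.nth p j) = ∑ s ∈ range (Nat.nth p N), if p s then g s else 0 := by
  rw [← Finset.sum_filter]
  induction N with
  | zero =>
    rw [Finset.range_zero, Finset.sum_empty, Finset.filter_eq_empty_iff.2, Finset.sum_empty]
    intro s hs hps
    have h1 := Nat.nth_count hps
    have h2 := (Nat.nth_strictMono hp).monotone (Nat.zero_le (Nat.count p s))
    rw [mem_range] at hs
    omega
  | succ N ih =>
    rw [Nat.filter_range_nth_eq_insert_of_infinite hp, Finset.sum_insert (by simp),
      Finset.sum_range_succ, ih, add_comm]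

lemma sum_nth' (p : ℕ → Prop) [DecidablePred p] (hp : (Set.ofPred p).Infinite) (h0 : ¬ p 0)
    (g : ℕ → ℝ) (N : ℕ) (hN : 1 ≤ N) :
    ∑ k ∈ Icc 1 N, g (Nat.nth p (k - 1)) =
      ∑ s ∈ Ioc 0 (Nat.nth p (N - 1)), if p s then g s else 0 := by
  obtain ⟨m, rfl⟩ : ∃ m, N = m + 1 := ⟨N - 1, by omega⟩
  have h1 : ∑ k ∈ Icc 1 (m + 1), g (Nat.nth p (k - 1)) = ∑ j ∈ range (m + 1), g (Nat.nth p j) := by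
    rw [Finset.range_eq_Ico, Finset.sum_Ico_eq_sum_range, ← Finset.Ico_add_one_right_eq_Icc,
      Finset.sum_Ico_eq_sum_range]
    apply Finset.sum_congr (by simp)
    intro k _
    congr 2; omega
  rw [h1, Finset.sum_range_succ, sum_nth p hp]
  simp only [Nat.add_sub_cancel]
  have h2 : ∑ s ∈ range (Nat.nth p m + 1), (if p s then g s else 0) =
      ∑ s ∈ Ioc 0 (Nat.nth p m), if p s then g s else 0 := by
    rw [Finset.sum_range_succ', if_neg h0, add_zero, ← Finset.Icc_add_one_left_eq_Ioc,
      ← Finset.Ico_add_one_right_eq_Icc, Finset.sum_Ico_eq_sum_range]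
    simp [add_comm]
  rw [← h2, Finset.sum_range_succ, if_pos (Nat.nth_mem_of_infinite hp m)]

lemma sum_parity (f : ℕ → ℝ) (n : ℕ) : ∑ s ∈ range n, f s =
    ∑ u ∈ range ((n + 1) / 2), f (2 * u) + ∑ u ∈ range (n / 2), f (2 * u + 1) := by
  induction n with
  | zero => simp
  | succ n ih =>
    rw [Finset.sum_range_succ, ih]
    rcases Nat.even_or_odd' n with ⟨m, rfl | rfl⟩
    · rw [show (2 * m + 1) / 2 = m by omega, show (2 * m + 1 + 1) / 2 = m + 1 by omega,
        show (2 * m) / 2 = m by omega, Finset.sum_range_succ]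
      ring
    · rw [show (2 * m + 1 + 1) / 2 = m + 1 by omega, show (2 * m + 1 + 1 + 1) / 2 = m + 1 by omega,
        show (2 * m + 1) / 2 = m by omega, Finset.sum_range_succ (fun u => f (2 * u + 1))]
      ring

lemma full_sum (x C : ℝ) (hC0 : 0 < C)
    (hC : ∀ n : ℕ, ∀ z a : ℝ, 0 ≤ a → a ≤ 1 →
      |∑ u ∈ range n, fa a (z + u * (2 * x))| ≤ C * (n : ℝ) ^ (0.45 : ℝ))
    (a : ℝ) (h0 : 0 ≤ a) (h1 : a ≤ 1) (T : ℕ) (hT : 2 ≤ T) :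
    |∑ s ∈ Ioc 0 T, fa a (s * x)| ≤ 1 + 2 * C * (T : ℝ) ^ (0.45 : ℝ) := by
  have e1 : ∑ s ∈ range (T + 1), fa a (s * x) = ∑ s ∈ Ioc 0 T, fa a (s * x) + fa a ((0 : ℕ) * x) := by
    rw [Finset.sum_range_succ', ← Finset.Icc_add_one_left_eq_Ioc,
      ← Finset.Ico_add_one_right_eq_Icc, Finset.sum_Ico_eq_sum_range]
    simp [add_comm]
  have e2 := sum_parity (fun s => fa a (s * x)) (T + 1)
  have key : ∀ n : ℕ, n ≤ T → C * (n : ℝ) ^ (0.45 : ℝ) ≤ C * (T : ℝ) ^ (0.45 : ℝ) := by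
    intro n hn; gcongr
  have e3 : |∑ u ∈ range ((T + 1 + 1) / 2), fa a ((2 * u : ℕ) * x)| ≤ C * (T : ℝ) ^ (0.45 : ℝ) := by
    refine le_trans (le_of_eq ?_) ((hC ((T + 1 + 1) / 2) 0 a h0 h1).trans (key _ (by omega)))
    congr 1
    apply sum_congr rfl; intro u _
    congr 1; push_cast; ring
  have e4 : |∑ u ∈ range ((T + 1) / 2), fa a ((2 * u + 1 : ℕ) * x)| ≤ C * (T : ℝ) ^ (0.45 : ℝ) := by
    refine le_trans (le_of_eq ?_) ((hC ((T + 1) / 2) x a h0 h1).trans (key _ (by omega)))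
    congr 1
    apply sum_congr rfl; intro u _
    congr 1; push_cast; ring
  have e5 := fa_abs_le h0 h1 ((0 : ℕ) * x)
  rw [abs_le] at *
  constructor <;> linarith [e3.1, e3.2, e4.1, e4.2, e5.1, e5.2]

/-- sum over deleted points -/
noncomputable def Del {r : ℕ} {ρ : ℝ} (ω : Om r ρ) (f : ℕ → ℝ) (T : ℕ) : ℝ :=
  ∑ s ∈ Ioc 0 T, DD ω s * f s

lemma DD_abs {r : ℕ} {ρ : ℝ} (ω : Om r ρ) (s : ℕ) : 0 ≤ DD ω s ∧ DD ω s ≤ 1 := by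
  unfold DD; split_ifs <;> norm_num

lemma Del_triv {r : ℕ} {ρ : ℝ} (ω : Om r ρ) (f : ℕ → ℝ) (hf : ∀ s, |f s| ≤ 1) (T : ℕ) :
    |Del ω f T| ≤ T := by
  unfold Del
  refine (abs_sum_le_sum_abs _ _).trans ?_
  calc _ ≤ ∑ s ∈ Ioc 0 T, (1 : ℝ) := by
        apply sum_le_sum; intro s _
        rw [abs_mul, abs_of_nonneg (DD_abs ω s).1]
        have := DD_abs ω s
        nlinarith [hf s, abs_nonneg (f s)]
    _ = T := by simp

lemma Del_split {r : ℕ} {ρ : ℝ} (ω : Om r ρ) (f : ℕ → ℝ) (i T : ℕ) (hT : MM i ≤ T) :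
    Del ω f T = Del ω f (MM i) + ∑ s ∈ Ioc (MM i) T, DD ω s * f s := by
  unfold Del
  rw [Finset.sum_Ioc_consecutive _ (Nat.zero_le _) hT]

/-- main formula for the deleted sum of `fa` -/
lemma Del_fa {r : ℕ} (hr : 0 < r) {ρ : ℝ} (hρ : 0 < ρ) (hρ1 : ρ ≤ 1 / 2) (ω : Om r ρ) (x C : ℝ)
    (hC0 : 0 < C) (hC : ∀ n : ℕ, ∀ z a : ℝ, 0 ≤ a → a ≤ 1 →
      |∑ u ∈ range n, fa a (z + u * (2 * x))| ≤ C * (n : ℝ) ^ (0.45 : ℝ))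
    (a : ℝ) (h0 : 0 ≤ a) (h1 : a ≤ 1) (i T : ℕ) (hi : 1 ≤ i) (hT : MM i ≤ T) (hT2 : T ≤ MM (i + 1)) :
    |Del ω (fun s => fa a (s * x)) T - Del ω (fun s => fa a (s * x)) (MM i)
      - 1 / 2 * Rw r ρ i (ω i) (bb r ρ i T) a x| ≤ C * (MM i : ℝ) ^ (0.45 : ℝ) + i * r := by
  rw [Del_split ω _ i T hT, DD_window hr hρ hρ1 ω i T hi hT hT2]
  have e1 := window_split hr ω i T hi (fun u => fa a ((MM i + 1 + 2 * u : ℕ) * x))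
    (fun u => fa_abs_le h0 h1 _)
  have e2 : |∑ u ∈ range (kk r ρ i T), fa a ((MM i + 1 + 2 * u : ℕ) * x)| ≤
      C * (MM i : ℝ) ^ (0.45 : ℝ) := by
    have hk : ((kk r ρ i T : ℕ) : ℝ) ≤ MM i := by
      have := nn_two r hr ρ hρ hρ1 i
      have h3 : kk r ρ i T ≤ nn r ρ i := min_le_left _ _
      exact_mod_cast (by omega)
    refine le_trans (le_of_eq ?_) ((hC (kk r ρ i T) ((MM i + 1) * x) a h0 h1).trans
      (by gcongr))
    congr 1
    apply sum_congr rfl; intro u _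
    congr 1; push_cast; ring
  have e3 : ∑ c ∈ Uf (BB r ρ i * qq i) (bb r ρ i T * qq i), bsg (ω i c) *
          ∑ l ∈ range r, fa a ((MM i + 1 + 2 * idx (qq i) r c.1 l : ℕ) * x) =
      Rw r ρ i (ω i) (bb r ρ i T) a x := by
    unfold Rw Ph
    apply sum_congr rfl; intro c _
    congr 1
    apply sum_congr rfl; intro l _
    congr 1; push_cast; ring
  rw [e3] at e1
  have e4 : (0 : ℝ) ≤ C * (MM i : ℝ) ^ (0.45 : ℝ) := by positivity
  rw [abs_le] at *
  constructor <;> linarith [e1.1, e1.2, e2.1, e2.2]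

/-- main formula for the number of deleted points -/
lemma Del_one {r : ℕ} (hr : 0 < r) {ρ : ℝ} (hρ : 0 < ρ) (hρ1 : ρ ≤ 1 / 2) (ω : Om r ρ)
    (i T : ℕ) (hi : 1 ≤ i) (hT : MM i ≤ T) (hT2 : T ≤ MM (i + 1)) :
    |Del ω (fun _ => 1) T - Del ω (fun _ => 1) (MM i) - 1 / 2 * (kk r ρ i T : ℝ)| ≤
      r * |∑ c ∈ Uf (BB r ρ i * qq i) (bb r ρ i T * qq i), bsg (ω i c)| + i * r := by
  rw [Del_split ω _ i T hT, DD_window hr hρ hρ1 ω i T hi hT hT2]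
  have e1 := window_split hr ω i T hi (fun u => 1) (fun u => by simp)
  simp only [sum_const, card_range, nsmul_eq_mul, mul_one] at e1 ⊢
  rw [← Finset.sum_mul] at e1
  set S := ∑ c ∈ Uf (BB r ρ i * qq i) (bb r ρ i T * qq i), bsg (ω i c)
  have e2 := neg_abs_le S
  have e3 := le_abs_self S
  have hrR : (0 : ℝ) < r := by exact_mod_cast hr
  have e4 : S * r ≤ |S| * r := by gcongr
  have e5 : -|S| * r ≤ S * r := by gcongr
  have e6 : 0 ≤ |S| * r := by positivity
  rw [abs_le] at *
  constructor <;> linarith [e1.1, e1.2]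

lemma Del_one_small {r : ℕ} (hr : 0 < r) {ρ : ℝ} (hρ : 0 < ρ) (hρ1 : ρ ≤ 1 / 2) (ω : Om r ρ)
    (i : ℕ) (hi : 1 ≤ i) : |Del ω (fun _ => 1) (MM (i + 1))| ≤ 2 * MM i := by
  have hd := MM_double i
  rw [Del_split ω _ i _ (by omega), DD_window hr hρ hρ1 ω i _ hi (by omega) le_rfl]
  have h1 := Del_triv ω (fun _ => 1) (fun _ => by simp) (MM i)
  have h2 : |∑ u ∈ range (kk r ρ i (MM (i + 1))),
      (if we ω i (cl (qq i) r u) = true then (1 : ℝ) else 0) * 1| ≤ MM i := by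
    refine (abs_sum_le_sum_abs _ _).trans ?_
    calc _ ≤ ∑ u ∈ range (kk r ρ i (MM (i + 1))), (1 : ℝ) := by
          apply sum_le_sum; intro u _; split_ifs <;> simp
      _ = (kk r ρ i (MM (i + 1)) : ℝ) := by simp
      _ ≤ MM i := by
        have := nn_two r hr ρ hρ hρ1 i
        have h3 : kk r ρ i (MM (i + 1)) ≤ nn r ρ i := min_le_left _ _
        exact_mod_cast (by omega)
  refine (abs_add_le _ _).trans ?_
  linarith

/-- upper estimates hold eventually -/
def HU {r : ℕ} {ρ : ℝ} (ω : Om r ρ) (x : ℝ) : Prop :=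
  ∀ δ : ℝ, 0 < δ → ∀ᶠ i : ℕ in atTop, ∀ b ≤ BB r ρ i,
    (∀ a, 0 ≤ a → a ≤ 1 → |Rw r ρ i (ω i) b a x| ≤
      √(Real.log i) * (√(r * ((b * qq i * r : ℕ) : ℝ) / 2) + δ * √(MM i))) ∧
    |∑ c ∈ Uf (BB r ρ i * qq i) (b * qq i), bsg (ω i c)| ≤ 2 * √(MM i * Real.log i)

lemma ev_succ {p : ℕ → Prop} (h : ∀ᶠ i in atTop, p (i + 1)) : ∀ᶠ i in atTop, p i := by
  obtain ⟨a, ha⟩ := eventually_atTop.1 h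
  refine eventually_atTop.2 ⟨a + 1, fun b hb => ?_⟩
  have := ha (b - 1) (by omega)
  rwa [Nat.sub_add_cancel (by omega)] at this

lemma bqr_le (r : ℕ) (hr : 0 < r) (ρ : ℝ) (hρ : 0 < ρ) (hρ1 : ρ ≤ 1 / 2) (i b : ℕ)
    (hb : b ≤ BB r ρ i) : ((b * qq i * r : ℕ) : ℝ) ≤ MM i := by
  have h1 := nn_two r hr ρ hρ hρ1 i
  have h2 : b * qq i * r ≤ nn r ρ i :=
    Nat.mul_le_mul_right _ (Nat.mul_le_mul_right _ hb)
  exact_mod_cast (by omega)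

lemma pow45_le (M : ℝ) (hM : 1 ≤ M) : M ^ (0.45 : ℝ) ≤ √M := by
  rw [Real.sqrt_eq_rpow]
  exact Real.rpow_le_rpow_of_exponent_le hM (by norm_num)

lemma sqrt_log_le (i : ℕ) (hi : 1 ≤ i) : √(Real.log i) ≤ i := by
  have h1 : (1 : ℝ) ≤ i := by exact_mod_cast hi
  rw [Real.sqrt_le_left (by linarith)]
  have := Real.log_le_sub_one_of_pos (show (0 : ℝ) < i by linarith)
  nlinarith

lemma MM_succ (i : ℕ) : (MM (i + 1) : ℝ) = MM i * (2 ^ i) ^ 2 * 2 := by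
  unfold MM
  push_cast
  rw [← pow_mul, ← pow_add, ← pow_succ]
  congr 1; ring

lemma MM_sqrt_succ (i : ℕ) : 2 ^ i * √(MM i) ≤ √(MM (i + 1)) := by
  apply Real.le_sqrt_of_sq_le
  rw [mul_pow, Real.sq_sqrt (MM_pos i).le, MM_succ]
  have : 0 < (MM i : ℝ) * (2 ^ i) ^ 2 := mul_pos (MM_pos i) (by positivity)
  nlinarith

lemma Del_fa_small {r : ℕ} (hr : 0 < r) {ρ : ℝ} (hρ : 0 < ρ) (hρ1 : ρ ≤ 1 / 2) (ω : Om r ρ) (x : ℝ)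
    (hx : KB (2 * x)) (hU : HU ω x) (κ : ℝ) (hκ : 0 < κ) :
    ∀ᶠ i : ℕ in atTop, ∀ a, 0 ≤ a → a ≤ 1 →
      |Del ω (fun s => fa a (s * x)) (MM i)| ≤ κ * √(MM i) := by
  obtain ⟨C, hC0, hC⟩ := hx
  have hrR : (1 : ℝ) ≤ r := by exact_mod_cast hr
  obtain ⟨i0, hi0⟩ := eventually_atTop.1 (hU 1 one_pos)
  set A0 : ℝ := C + 2 * r + 1 with hA0
  have hstep : ∀ i, i0 ≤ i → 1 ≤ i → ∀ a, 0 ≤ a → a ≤ 1 →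
      |Del ω (fun s => fa a (s * x)) (MM (i + 1))| ≤
        |Del ω (fun s => fa a (s * x)) (MM i)| + A0 * (i * √(MM i)) := by
    intro i hi hi1 a h0 h1
    have e1 := Del_fa hr hρ hρ1 ω x C hC0 hC a h0 h1 i (MM (i + 1)) hi1
      (by have := MM_double i; omega) le_rfl
    have hb := bb_le r ρ i (MM (i + 1))
    have e2 := (hi0 i hi _ hb).1 a h0 h1
    have hbq := bqr_le r hr ρ hρ hρ1 i _ hb
    have hi1R : (1 : ℝ) ≤ i := by exact_mod_cast hi1
    set s := √(MM i : ℝ) with hs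
    have hs1 : 1 ≤ s := Real.one_le_sqrt.2 (MM_one_le i)
    have e3 : √(r * ((bb r ρ i (MM (i + 1)) * qq i * r : ℕ) : ℝ) / 2) ≤ r * s := by
      rw [Real.sqrt_le_left (by positivity), mul_pow, hs, Real.sq_sqrt (MM_pos i).le]
      have : (r : ℝ) * ((bb r ρ i (MM (i + 1)) * qq i * r : ℕ) : ℝ) ≤ r * MM i := by gcongr
      have h2 : (r : ℝ) * MM i ≤ r ^ 2 * MM i := by
        apply mul_le_mul_of_nonneg_right _ (MM_pos i).le; nlinarith
      have : 0 < (r : ℝ) * MM i := mul_pos (by linarith) (MM_pos i)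
      linarith
    have e4 : |Rw r ρ i (ω i) (bb r ρ i (MM (i + 1))) a x| ≤ i * (r * s + 1 * s) := by
      refine e2.trans ?_
      apply mul_le_mul (sqrt_log_le i hi1) (by linarith) (by positivity) (by positivity)
    have e5 : C * (MM i : ℝ) ^ (0.45 : ℝ) ≤ C * (i * s) := by
      have h3 := pow45_le _ (MM_one_le i)
      apply mul_le_mul_of_nonneg_left _ hC0.le
      calc _ ≤ s := h3
        _ ≤ _ := le_mul_of_one_le_left (by linarith) hi1R
    have e6 : (i : ℝ) * r ≤ r * (i * s) := by
      have : (i : ℝ) * r * 1 ≤ i * r * s := by gcongr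
      linarith
    have e7 : A0 * (i * s) = C * (i * s) + r * (i * s) + i * (r * s + 1 * s) := by rw [hA0]; ring
    rw [e7]
    have e8 := abs_le.1 e4
    have e9 := abs_le.1 e1
    have e10 := neg_abs_le (Del ω (fun s => fa a (s * x)) (MM i))
    have e11 := le_abs_self (Del ω (fun s => fa a (s * x)) (MM i))
    have e12 : 0 ≤ (i : ℝ) * (r * s + 1 * s) := by positivity
    rw [abs_le]
    constructor <;> linarith [e8.1, e8.2, e9.1, e9.2]
  have hA00 : 0 < A0 := by positivity
  set i1 := max i0 1 with hi1
  set A : ℝ := 4 * A0 + MM (i1 + 1) with hA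
  have hA1 : 0 < A := by have := MM_pos (i1 + 1); positivity
  have hind : ∀ i, i1 ≤ i → ∀ a, 0 ≤ a → a ≤ 1 →
      |Del ω (fun s => fa a (s * x)) (MM (i + 1))| ≤ A * (i * √(MM i)) := by
    intro i hi
    induction i, hi using Nat.le_induction with
    | base =>
      intro a h0 h1
      refine (Del_triv ω _ (fun s => fa_abs_le h0 h1 _) _).trans ?_
      have g1 : (1 : ℝ) ≤ i1 := by exact_mod_cast le_max_right i0 1
      have g2 : 1 ≤ √(MM i1 : ℝ) := Real.one_le_sqrt.2 (MM_one_le i1)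
      have g3 : (1 : ℝ) ≤ i1 * √(MM i1 : ℝ) := one_le_mul_of_one_le_of_one_le g1 g2
      have g4 : (MM (i1 + 1) : ℝ) ≤ A := by rw [hA]; linarith
      nlinarith
    | succ i hi ih =>
      intro a h0 h1
      have hi0' : i0 ≤ i := le_trans (le_max_left _ _) hi
      have hi1' : 1 ≤ i := le_trans (le_max_right _ _) hi
      refine (hstep (i + 1) (by omega) (by omega) a h0 h1).trans ?_
      have g1 := ih a h0 h1
      have g2 := MM_sqrt_succ i
      have g3 : (2 : ℝ) ≤ 2 ^ i := by
        calc (2 : ℝ) = 2 ^ 1 := by norm_num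
          _ ≤ 2 ^ i := pow_le_pow_right₀ (by norm_num) hi1'
      have g0 := Real.sqrt_nonneg (MM i : ℝ)
      have g4 : 2 * √(MM i : ℝ) ≤ √(MM (i + 1) : ℝ) := le_trans (by gcongr) g2
      have g5 : (i : ℝ) * √(MM i : ℝ) ≤ ((i + 1 : ℕ) : ℝ) * √(MM (i + 1) : ℝ) / 2 := by
        push_cast
        have : (0 : ℝ) ≤ i := by positivity
        nlinarith
      have g6 : A * (i * √(MM i : ℝ)) ≤ A * (((i + 1 : ℕ) : ℝ) * √(MM (i + 1) : ℝ) / 2) := by gcongr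
      have g7 : A0 ≤ A / 2 := by rw [hA]; have := MM_pos (i1 + 1); linarith
      have g8 : A0 * (((i + 1 : ℕ) : ℝ) * √(MM (i + 1) : ℝ)) ≤
        A / 2 * (((i + 1 : ℕ) : ℝ) * √(MM (i + 1) : ℝ)) := by gcongr
      linarith
  have hexp : ∀ᶠ i : ℕ in atTop, A * (i : ℝ) ≤ κ * 2 ^ i := by
    have := tendsto_pow_const_div_const_pow_of_one_lt 1 (show (1 : ℝ) < 2 by norm_num)
    filter_upwards [this.eventually_le_const (show (0 : ℝ) < κ / A by positivity)] with i hi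
    rw [div_le_div_iff₀ (by positivity) hA1, pow_one] at hi
    linarith
  apply ev_succ
  filter_upwards [hexp, eventually_ge_atTop i1] with i hi hii a h0 h1
  refine (hind i hii a h0 h1).trans ?_
  calc A * (i * √(MM i : ℝ)) = (A * i) * √(MM i : ℝ) := by ring
    _ ≤ (κ * 2 ^ i) * √(MM i : ℝ) := by gcongr
    _ = κ * (2 ^ i * √(MM i : ℝ)) := by ring
    _ ≤ _ := by gcongr; exact MM_sqrt_succ i

lemma count_asymp {r : ℕ} (hr : 0 < r) {ρ : ℝ} (hρ : 0 < ρ) (hρ1 : ρ ≤ 1 / 2) (ω : Om r ρ) (x : ℝ)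
    (hU : HU ω x) (κ : ℝ) (hκ : 0 < κ) :
    ∀ᶠ i : ℕ in atTop, ∀ T, MM i ≤ T → T ≤ MM (i + 1) →
      |Del ω (fun _ => 1) T - 1 / 2 * (kk r ρ i T : ℝ)| ≤ κ * MM i := by
  have hrR : (0 : ℝ) < r := by exact_mod_cast hr
  have hsm : ∀ᶠ i : ℕ in atTop, |Del ω (fun _ => 1) (MM i)| ≤ κ / 3 * MM i := by
    apply ev_succ
    have h2 : Tendsto (fun i : ℕ => (2 : ℝ) ^ i) atTop atTop :=
      tendsto_pow_atTop_atTop_of_one_lt (by norm_num)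
    filter_upwards [h2.eventually_ge_atTop (3 / κ), eventually_ge_atTop 1] with i hi hi1
    refine (Del_one_small hr hρ hρ1 ω i hi1).trans ?_
    rw [MM_succ]
    have hM := MM_pos i
    rw [div_le_iff₀ hκ] at hi
    have h3 : (1 : ℝ) ≤ 2 ^ i := one_le_pow₀ (by norm_num)
    have h4 : 3 ≤ (2 ^ i) ^ 2 * κ := by nlinarith
    nlinarith
  filter_upwards [hsm, hU 1 one_pos, MM_poly' (κ / (3 * r)) (by positivity),
    MM_poly (κ / (6 * r)) (by positivity), eventually_ge_atTop 1] with i h1 h2 h3 h4 hi T hT hT2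
  have hi1R : (1 : ℝ) ≤ i := by exact_mod_cast hi
  have e1 := Del_one hr hρ hρ1 ω i T hi hT hT2
  have e2 := (h2 _ (bb_le r ρ i T)).2
  set S := ∑ c ∈ Uf (BB r ρ i * qq i) (bb r ρ i T * qq i), bsg (ω i c)
  have e3 : r * |S| ≤ κ / 3 * MM i := by
    rw [Real.sqrt_mul (MM_pos i).le] at e2
    have : √(Real.log i) ≤ κ / (6 * r) * √(MM i) := by
      refine (sqrt_log_le i hi).trans (le_trans ?_ h4); nlinarith
    calc r * |S| ≤ r * (2 * (√(MM i) * (κ / (6 * r) * √(MM i)))) := by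
          refine mul_le_mul_of_nonneg_left (e2.trans ?_) hrR.le
          gcongr
      _ = κ / 3 * (√(MM i) * √(MM i)) := by field_simp; ring
      _ = _ := by rw [Real.mul_self_sqrt (MM_pos i).le]
  have e4 : (i : ℝ) * r ≤ κ / 3 * MM i := by
    calc (i : ℝ) * r ≤ (i : ℝ) ^ 2 * r := by gcongr; nlinarith
      _ ≤ κ / (3 * r) * MM i * r := by gcongr
      _ = _ := by field_simp
  rw [abs_le] at *
  constructor <;> linarith [e1.1, e1.2, h1.1, h1.2]

noncomputable def Er {r : ℕ} {ρ : ℝ} (ω : Om r ρ) (x a : ℝ) (T : ℕ) : ℝ :=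
  ∑ s ∈ Ioc 0 T, (1 - DD ω s) * fa a (s * x)

noncomputable def Nr {r : ℕ} {ρ : ℝ} (ω : Om r ρ) (T : ℕ) : ℝ := T - Del ω (fun _ => 1) T

lemma Er_asymp {r : ℕ} (hr : 0 < r) {ρ : ℝ} (hρ : 0 < ρ) (hρ1 : ρ ≤ 1 / 2) (ω : Om r ρ) (x : ℝ)
    (hx : KB (2 * x)) (hU : HU ω x) (κ : ℝ) (hκ : 0 < κ) :
    ∀ᶠ i : ℕ in atTop, ∀ T, MM i ≤ T → T ≤ MM (i + 1) → ∀ a, 0 ≤ a → a ≤ 1 →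
      |Er ω x a T + 1 / 2 * Rw r ρ i (ω i) (bb r ρ i T) a x| ≤ κ * √T := by
  have hsm := Del_fa_small hr hρ hρ1 ω x hx hU (κ / 5) (by positivity)
  obtain ⟨C, hC0, hC⟩ := hx
  have hrR : (0 : ℝ) < r := by exact_mod_cast hr
  filter_upwards [hsm, MM_asymp (κ / (10 * C)) (by positivity), MM_poly (κ / (5 * r)) (by positivity),
    MM_poly (κ / 5) (by positivity), eventually_ge_atTop 1] with i h1 h2 h3 h4 hi T hT hT2 a a0 a1
  have hi1R : (1 : ℝ) ≤ i := by exact_mod_cast hi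
  have hi2 : (1 : ℝ) ≤ (i : ℝ) ^ 2 := one_le_pow₀ hi1R
  have hM := MM_pos i
  have hTR : (MM i : ℝ) ≤ T := by exact_mod_cast hT
  have hT0 : (0 : ℝ) < T := by linarith
  have hs : √(MM i : ℝ) ≤ √T := Real.sqrt_le_sqrt hTR
  have h2M : (2 : ℕ) ≤ MM i := by
    have := MM_double 0
    have := MM_mono hi
    simp [MM] at *; omega
  have e1 := full_sum x C hC0 hC a a0 a1 T (by omega)
  have e2 := Del_fa hr hρ hρ1 ω x C hC0 hC a a0 a1 i T hi hT hT2
  have e3 := h1 a a0 a1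
  have e4 : Er ω x a T = ∑ s ∈ Ioc 0 T, fa a (s * x) - Del ω (fun s => fa a (s * x)) T := by
    unfold Er Del
    rw [← Finset.sum_sub_distrib]
    apply sum_congr rfl; intro s _; ring
  have e5 : (T : ℝ) ^ (0.45 : ℝ) ≤ κ / (10 * C) * √T := by
    have f1 : ∀ y : ℝ, 0 < y → y ^ (0.45 : ℝ) = √y * y ^ (-0.05 : ℝ) := by
      intro y hy
      rw [Real.sqrt_eq_rpow, ← Real.rpow_add hy]; norm_num
    have f2 : (MM i : ℝ) ^ (-0.05 : ℝ) ≤ κ / (10 * C) := by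
      have g1 : (MM i : ℝ) ^ (0.45 : ℝ) ≤ κ / (10 * C) * √(MM i) := by
        refine le_trans ?_ h2
        exact le_mul_of_one_le_left (by positivity) hi2
      rw [f1 _ hM, mul_comm] at g1
      exact le_of_mul_le_mul_right g1 (Real.sqrt_pos.2 hM)
    have f3 : (T : ℝ) ^ (-0.05 : ℝ) ≤ (MM i : ℝ) ^ (-0.05 : ℝ) :=
      Real.rpow_le_rpow_of_nonpos hM hTR (by norm_num)
    rw [f1 _ hT0, mul_comm]
    apply mul_le_mul_of_nonneg_right (f3.trans f2) (Real.sqrt_nonneg _)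
  have e6 : C * (T : ℝ) ^ (0.45 : ℝ) ≤ κ / 10 * √T := by
    calc _ ≤ C * (κ / (10 * C) * √T) := by gcongr
      _ = _ := by field_simp
  have e7 : C * (MM i : ℝ) ^ (0.45 : ℝ) ≤ C * (T : ℝ) ^ (0.45 : ℝ) := by gcongr
  have e8 : (i : ℝ) * r ≤ κ / 5 * √T := by
    calc (i : ℝ) * r ≤ (i : ℝ) ^ 2 * r := by gcongr; nlinarith
      _ ≤ κ / (5 * r) * √(MM i) * r := by gcongr
      _ = κ / 5 * √(MM i) := by field_simp
      _ ≤ _ := by gcongr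
  have e9 : 1 ≤ κ / 5 * √T := by
    have : κ / 5 * √(MM i) ≤ κ / 5 * √T := by gcongr
    linarith
  have e10 : κ / 5 * √(MM i) ≤ κ / 5 * √T := by gcongr
  have e11 : 0 ≤ κ * √T := by positivity
  rw [e4]
  rw [abs_le] at *
  constructor <;> linarith [e1.1, e1.2, e2.1, e2.2, e3.1, e3.2]

lemma MM_log (i : ℕ) : Real.log (MM i) = (i : ℝ) ^ 2 * Real.log 2 := by
  unfold MM; push_cast; rw [Real.log_pow]; push_cast; ring

lemma LL_lower (κ : ℝ) (hκ : 0 < κ) (hκ1 : κ < 1) : ∀ᶠ i : ℕ in atTop, ∀ N : ℝ, (MM i : ℝ) / 2 ≤ N →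
    (1 - κ) ^ 2 * (2 * Real.log i) ≤ Real.log (Real.log N) := by
  have hlog : Tendsto (fun i : ℕ => Real.log i) atTop atTop :=
    Real.tendsto_log_atTop.comp tendsto_natCast_atTop_atTop
  filter_upwards [hlog.eventually_ge_atTop (1 / κ), eventually_ge_atTop 2] with i h1 hi N hN
  have hiR : (2 : ℝ) ≤ i := by exact_mod_cast hi
  have hM := MM_pos i
  have l2 := Real.log_two_gt_d9
  have l3 := Real.log_two_lt_d9
  have e1 : (i : ℝ) ^ 2 / 2 ≤ Real.log N := by
    have : Real.log ((MM i : ℝ) / 2) ≤ Real.log N := Real.log_le_log (by positivity) hN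
    rw [Real.log_div hM.ne' (by norm_num), MM_log] at this
    nlinarith
  have e2 : Real.log ((i : ℝ) ^ 2 / 2) ≤ Real.log (Real.log N) := Real.log_le_log (by positivity) e1
  rw [Real.log_div (by positivity) (by norm_num), Real.log_pow] at e2
  push_cast at e2
  have e3 : 1 ≤ κ * Real.log i := by
    rw [div_le_iff₀ hκ] at h1; linarith
  have e4 : 0 ≤ Real.log i := Real.log_natCast_nonneg i
  have e5 : κ * κ * Real.log i ≤ κ * Real.log i := by
    apply mul_le_mul_of_nonneg_right _ e4; nlinarith
  nlinarith

lemma LL_upper (i : ℕ) (hi : 2 ≤ i) (N : ℝ) (h1 : 1 < N) (h2 : N ≤ 2 * MM i) :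
    Real.log (Real.log N) ≤ 2 * Real.log i := by
  have hiR : (2 : ℝ) ≤ i := by exact_mod_cast hi
  have hM := MM_pos i
  have l3 := Real.log_two_lt_d9
  have e1 : Real.log N ≤ (i : ℝ) ^ 2 := by
    have : Real.log N ≤ Real.log (2 * MM i) := Real.log_le_log (by linarith) h2
    rw [Real.log_mul (by norm_num) hM.ne', MM_log] at this
    nlinarith
  have e2 : Real.log (Real.log N) ≤ Real.log ((i : ℝ) ^ 2) := Real.log_le_log (Real.log_pos h1) e1
  rw [Real.log_pow] at e2
  exact_mod_cast e2

lemma half_sqrt (L y : ℝ) (hL : 0 ≤ L) :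
    1 / 2 * (√L * √(y / 2)) = √(2 * L) * √(y / 16) := by
  rw [← Real.sqrt_mul hL, ← Real.sqrt_mul (by positivity)]
  rw [show 2 * L * (y / 16) = (1 / 2) ^ 2 * (L * (y / 2)) by ring,
    Real.sqrt_mul (by positivity : (0 : ℝ) ≤ (1 / 2) ^ 2), Real.sqrt_sq (by norm_num)]

lemma log_ge_one : ∀ᶠ i : ℕ in atTop, (1 : ℝ) ≤ Real.log i :=
  (Real.tendsto_log_atTop.comp tendsto_natCast_atTop_atTop).eventually_ge_atTop 1

set_option maxHeartbeats 1000000 in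
lemma upper_final {r : ℕ} (hr : 0 < r) {ρ : ℝ} (hρ : 0 < ρ) (hρ1 : ρ ≤ 1 / 2) (ω : Om r ρ) (x : ℝ)
    (hx : KB (2 * x)) (hU : HU ω x) (Λ : ℝ) (hΛ : 0 < Λ)
    (hrho : ρ * (r / 16 - 3 / 2 * Λ ^ 2) = Λ ^ 2) (κ : ℝ) (hκ : 0 < κ) (hκ1 : κ ≤ 1 / 2) :
    ∀ᶠ i : ℕ in atTop, ∀ T, MM i ≤ T → T ≤ MM (i + 1) → ∀ a, 0 ≤ a → a ≤ 1 →
      (1 - κ) ^ 2 * |Er ω x a T| ≤ (Λ + κ) * √(Nr ω T * Real.log (Real.log (Nr ω T))) := by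
  have q2 : (1 - κ) ^ 2 ≤ 1 - κ := pow_le_of_le_one (by linarith) (by linarith) two_ne_zero
  filter_upwards [Er_asymp hr hρ hρ1 ω x hx hU (κ / 4) (by positivity),
    count_asymp hr hρ hρ1 ω x hU (κ / 2) (by positivity), hU κ hκ,
    LL_lower κ hκ (by linarith), log_ge_one, MM_poly' (κ / 2) (by positivity),
    eventually_ge_atTop 1] with i h1 h2 h3 h4 hL h5 hi T hT hT2 a a0 a1
  have hi1R : (1 : ℝ) ≤ i := by exact_mod_cast hi
  have hM := MM_pos i
  have hrR : (0 : ℝ) < r := by exact_mod_cast hr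
  have hTR : (MM i : ℝ) ≤ T := by exact_mod_cast hT
  set k : ℝ := (kk r ρ i T : ℝ) with hk
  have hk0 : 0 ≤ k := Nat.cast_nonneg _
  have hkT : 2 * k ≤ T - MM i + 1 := by
    have : 2 * kk r ρ i T + MM i ≤ T + 1 := by
      have : kk r ρ i T ≤ (T - MM i + 1) / 2 := min_le_right _ _
      omega
    have : ((2 * kk r ρ i T + MM i : ℕ) : ℝ) ≤ ((T + 1 : ℕ) : ℝ) := by exact_mod_cast this
    push_cast at this
    linarith
  have hkM : k ≤ ρ * MM i := by
    refine le_trans ?_ (nn_le r hr ρ hρ i)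
    have : kk r ρ i T ≤ nn r ρ i := min_le_left _ _
    unfold nn at this
    rw [hk]
    exact_mod_cast this
  set X : ℝ := T + 1 - k / 2 with hX
  have hX1 : MM i + 3 / 2 * k ≤ X := by rw [hX]; linarith
  have hXM : MM i ≤ X := by linarith
  have hX0 : 0 < X := by linarith
  have hXT : (T : ℝ) ≤ 4 * X := by rw [hX]; linarith
  set L := Real.log i with hLdef
  set l := √(2 * L) with hl
  have hl1 : 1 ≤ l := Real.one_le_sqrt.2 (by linarith)
  have hc := h2 T hT hT2
  have h1T := h1 T hT hT2 a a0 a1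
  have h3T := (h3 _ (bb_le r ρ i T)).1 a a0 a1
  -- lower bound for N
  have hone : 1 ≤ κ / 2 * MM i := le_trans (one_le_pow₀ (by linarith)) h5
  have hN1 : (1 - κ) * X ≤ Nr ω T := by
    unfold Nr
    have := (abs_le.1 hc).2
    have : κ * MM i ≤ κ * X := by gcongr
    rw [hX] at *
    linarith
  have hN2 : (MM i : ℝ) / 2 ≤ Nr ω T := by
    refine le_trans ?_ hN1
    have : 1 / 2 * X ≤ (1 - κ) * X := mul_le_mul_of_nonneg_right (by linarith) hX0.le
    linarith
  have hLL := h4 _ hN2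
  have hden : (1 - κ) ^ 2 * (l * √X) ≤ √(Nr ω T * Real.log (Real.log (Nr ω T))) := by
    apply Real.le_sqrt_of_sq_le
    rw [mul_pow, mul_pow, hl, Real.sq_sqrt (by linarith), Real.sq_sqrt hX0.le]
    have g1 : (1 - κ) ^ 2 * X ≤ Nr ω T := by
      refine le_trans ?_ hN1
      exact mul_le_mul_of_nonneg_right q2 hX0.le
    have g2 : 0 ≤ (1 - κ) ^ 2 * (2 * L) := by
      apply mul_nonneg (sq_nonneg _); linarith
    calc ((1 - κ) ^ 2) ^ 2 * (2 * L * X) = ((1 - κ) ^ 2 * X) * ((1 - κ) ^ 2 * (2 * L)) := by ring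
      _ ≤ _ := mul_le_mul g1 hLL g2 (by linarith)
  -- upper bound for E
  have hE : |Er ω x a T| ≤ (Λ + κ) * (l * √X) := by
    have g1 : 1 / 2 * (√L * √(r * ((bb r ρ i T * qq i * r : ℕ) : ℝ) / 2)) ≤ l * (Λ * √X) := by
      rw [half_sqrt L _ (by linarith)]
      apply mul_le_mul_of_nonneg_left _ (Real.sqrt_nonneg _)
      rw [Real.sqrt_le_left (by positivity), mul_pow, Real.sq_sqrt hX0.le]
      have f1 : ((bb r ρ i T * qq i * r : ℕ) : ℝ) ≤ k := by
        rw [hk]; exact_mod_cast bb_kk r ρ i T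
      have f2 : (r : ℝ) * ((bb r ρ i T * qq i * r : ℕ) : ℝ) ≤ r * k := by gcongr
      have f3 : Λ ^ 2 * (MM i + 3 / 2 * k) ≤ Λ ^ 2 * X := by gcongr
      have hcpos : 0 < (r / 16 - 3 / 2 * Λ ^ 2 : ℝ) := by
        have : 0 < Λ ^ 2 := by positivity
        rw [← hrho] at this
        exact (mul_pos_iff_of_pos_left hρ).1 this
      have f4 : k * (r / 16 - 3 / 2 * Λ ^ 2) ≤ ρ * MM i * (r / 16 - 3 / 2 * Λ ^ 2) := by gcongr
      have f5 : ρ * MM i * (r / 16 - 3 / 2 * Λ ^ 2) = Λ ^ 2 * MM i := by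
        calc ρ * MM i * (r / 16 - 3 / 2 * Λ ^ 2) = (ρ * (r / 16 - 3 / 2 * Λ ^ 2)) * MM i := by ring
          _ = _ := by rw [hrho]
      linarith
    have g2 : 1 / 2 * (√L * (κ * √(MM i))) ≤ κ / 2 * (l * √X) := by
      have f1 : √L ≤ l := Real.sqrt_le_sqrt (by linarith)
      have f2 : √(MM i) ≤ √X := Real.sqrt_le_sqrt hXM
      calc 1 / 2 * (√L * (κ * √(MM i))) = κ / 2 * (√L * √(MM i)) := by ring
        _ ≤ _ := by gcongr
    have g3 : κ / 4 * √T ≤ κ / 2 * (l * √X) := by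
      have f1 : √(T : ℝ) ≤ 2 * √X := by
        rw [Real.sqrt_le_left (by positivity), mul_pow, Real.sq_sqrt hX0.le]; linarith
      have f2 : √X ≤ l * √X := le_mul_of_one_le_left (Real.sqrt_nonneg _) hl1
      calc κ / 4 * √T ≤ κ / 4 * (2 * (l * √X)) := by gcongr; linarith
        _ = _ := by ring
    have g4 := abs_le.1 h3T
    have g5 := abs_le.1 h1T
    rw [mul_add] at g4
    rw [abs_le]
    constructor <;> linarith [g4.1, g4.2, g5.1, g5.2]
  calc (1 - κ) ^ 2 * |Er ω x a T| ≤ (1 - κ) ^ 2 * ((Λ + κ) * (l * √X)) := by gcongr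
    _ = (Λ + κ) * ((1 - κ) ^ 2 * (l * √X)) := by ring
    _ ≤ _ := by gcongr

set_option maxHeartbeats 1000000 in
lemma lower_final {r : ℕ} (hr : 0 < r) {ρ : ℝ} (hρ : 0 < ρ) (hρ1 : ρ ≤ 1 / 2) (ω : Om r ρ) (x : ℝ)
    (hx : KB (2 * x)) (hU : HU ω x) (Λ : ℝ) (hΛ : 0 < Λ)
    (hrho : ρ * (r / 16 - 3 / 2 * Λ ^ 2) = Λ ^ 2) (κ : ℝ) (hκ : 0 < κ) (hκ1 : κ ≤ 1 / 2)
    (hκ2 : 0 ≤ (1 - κ) ^ 2 * Λ - κ) :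
    ∀ᶠ i : ℕ in atTop, x ∈ Hs r ρ κ i (ω i) →
      ((1 - κ) ^ 2 * Λ - κ) * √(Nr ω (MM i + 2 * nn r ρ i) *
        Real.log (Real.log (Nr ω (MM i + 2 * nn r ρ i)))) ≤
      (1 + κ) * |Er ω x (1 / 2) (MM i + 2 * nn r ρ i)| := by
  have hcpos : 0 < (r / 16 - 3 / 2 * Λ ^ 2 : ℝ) := by
    have : 0 < Λ ^ 2 := by positivity
    rw [← hrho] at this
    exact (mul_pos_iff_of_pos_left hρ).1 this
  set c0 : ℝ := r / 16 - 3 / 2 * Λ ^ 2 with hc0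
  have q1 : (1 + κ) ≤ (1 + κ) ^ 2 := le_self_pow₀ (by linarith) two_ne_zero
  have q2 : (1 - κ) ^ 2 ≤ 1 - κ := pow_le_of_le_one (by linarith) (by linarith) two_ne_zero
  have hrR : (0 : ℝ) < r := by exact_mod_cast hr
  filter_upwards [Er_asymp hr hρ hρ1 ω x hx hU (κ / 2) (by positivity),
    count_asymp hr hρ hρ1 ω x hU (κ / 2) (by positivity),
    LL_lower κ hκ (by linarith), log_ge_one, MM_poly' (κ / 2) (by positivity),
    MM_poly' (κ * Λ ^ 2 / (Λ ^ 2 + c0 * r)) (by positivity),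
    eventually_ge_atTop 2] with i h1 h2 h4 hL h5 h6 hi hH
  have hi1R : (2 : ℝ) ≤ i := by exact_mod_cast hi
  have hM := MM_pos i
  set T := MM i + 2 * nn r ρ i with hTdef
  have hn2 := nn_two r hr ρ hρ hρ1 i
  have hT : MM i ≤ T := by omega
  have hT2 : T ≤ MM (i + 1) := by have := MM_double i; omega
  have hkn : kk r ρ i T = nn r ρ i := by unfold kk; omega
  have hbn : bb r ρ i T = BB r ρ i := by
    unfold bb
    rw [hkn, nn, mul_assoc]
    exact Nat.mul_div_cancel _ (Nat.mul_pos (qq_pos i) hr)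
  set n : ℝ := (nn r ρ i : ℝ) with hn
  have hn0 : 0 ≤ n := Nat.cast_nonneg _
  have hTR : (T : ℝ) = MM i + 2 * n := by rw [hTdef]; push_cast; rfl
  have hnM : 2 * n ≤ MM i := by rw [hn]; exact_mod_cast hn2
  have hnge : ρ * MM i - i * r ≤ n := by
    have e1 := nn_ge r hr ρ i
    have e2 : (qq i : ℝ) ≤ i := by exact_mod_cast qq_le i (by omega)
    have : (qq i : ℝ) * r ≤ i * r := by gcongr
    rw [hn, nn]; linarith
  set X : ℝ := MM i + 3 / 2 * n + 1 with hX
  have hXM : MM i ≤ X := by linarith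
  have hX0 : 0 < X := by linarith
  set L := Real.log i with hLdef
  set l := √(2 * L) with hl
  have hl1 : 1 ≤ l := Real.one_le_sqrt.2 (by linarith)
  have hc := h2 T hT hT2
  have h1T := h1 T hT hT2 (1 / 2) (by norm_num) (by norm_num)
  rw [hbn] at h1T
  rw [hkn] at hc
  unfold Hs at hH
  rw [Set.mem_ofPred_eq] at hH
  change (1 - κ) * (√L * √(r * n / 2)) ≤ _ at hH
  have hone : 1 ≤ κ / 2 * MM i := le_trans (one_le_pow₀ (by linarith)) h5
  have hκM : κ * MM i ≤ κ * X := by gcongr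
  have hc' := abs_le.1 hc
  have hN1 : Nr ω T ≤ (1 + κ) * X := by
    unfold Nr
    rw [hTR]
    linarith [hc'.1]
  have hN3 : Nr ω T ≤ 2 * MM i := by
    unfold Nr
    rw [hTR]
    have : 0 ≤ Del ω (fun _ => 1) T := by
      unfold Del
      apply sum_nonneg; intro s _
      rw [mul_one]; exact (DD_abs ω s).1
    linarith
  have hN2 : (1 : ℝ) < Nr ω T := by
    unfold Nr
    rw [hTR]
    have : κ / 2 * MM i ≤ 1 / 4 * MM i :=
      mul_le_mul_of_nonneg_right (by linarith) hM.le
    linarith [hc'.2]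
  have hLL := LL_upper i hi _ hN2 hN3
  have hden : √(Nr ω T * Real.log (Real.log (Nr ω T))) ≤ (1 + κ) * (l * √X) := by
    rw [Real.sqrt_le_left (by positivity), mul_pow, mul_pow, hl, Real.sq_sqrt (by linarith),
      Real.sq_sqrt hX0.le]
    have g1 : Nr ω T * Real.log (Real.log (Nr ω T)) ≤ Nr ω T * (2 * L) := by
      apply mul_le_mul_of_nonneg_left hLL; linarith
    have g2 : Nr ω T * (2 * L) ≤ ((1 + κ) * X) * (2 * L) := by
      apply mul_le_mul_of_nonneg_right hN1; linarith
    have g3 : (1 + κ) * (X * (2 * L)) ≤ (1 + κ) ^ 2 * (X * (2 * L)) := by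
      exact mul_le_mul_of_nonneg_right q1 (by positivity)
    linarith
  have hE : ((1 - κ) ^ 2 * Λ - κ) * (l * √X) ≤ |Er ω x (1 / 2) T| := by
    have g1 : (1 - κ) * ((1 - κ) * (Λ * (l * √X))) ≤ 1 / 2 * ((1 - κ) * (√L * √(r * n / 2))) := by
      rw [show 1 / 2 * ((1 - κ) * (√L * √(r * n / 2))) = (1 - κ) * (1 / 2 * (√L * √(r * n / 2))) by ring,
        half_sqrt L _ (by linarith)]
      apply mul_le_mul_of_nonneg_left _ (by linarith)
      rw [show (1 - κ) * (Λ * (l * √X)) = l * ((1 - κ) * Λ * √X) by ring]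
      apply mul_le_mul_of_nonneg_left _ (Real.sqrt_nonneg _)
      apply Real.le_sqrt_of_sq_le
      rw [mul_pow, mul_pow, Real.sq_sqrt hX0.le]
      have f1 : c0 * (ρ * MM i - i * r) ≤ c0 * n := by gcongr
      have f2 : c0 * (ρ * MM i) = Λ ^ 2 * MM i := by rw [← hrho]; ring
      have f3 : c0 * n = r * n / 16 - 3 / 2 * Λ ^ 2 * n := by rw [hc0]; ring
      have f4 : Λ ^ 2 + c0 * r * i ≤ κ * Λ ^ 2 * MM i := by
        rw [div_mul_eq_mul_div, le_div_iff₀ (by positivity)] at h6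
        have p1 : 0 < c0 * r := by positivity
        have p2 : 0 < Λ ^ 2 := by positivity
        have p3 : (1 : ℝ) ≤ (i : ℝ) ^ 2 := one_le_pow₀ (by linarith)
        have p4 : (i : ℝ) ≤ (i : ℝ) ^ 2 := le_self_pow₀ (by linarith) two_ne_zero
        have p5 : Λ ^ 2 * 1 ≤ Λ ^ 2 * (i : ℝ) ^ 2 := by gcongr
        have p6 : c0 * r * i ≤ c0 * r * (i : ℝ) ^ 2 := by gcongr
        linarith
      have f5 : κ * Λ ^ 2 * MM i ≤ κ * Λ ^ 2 * X := by gcongr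
      have f6 : (1 - κ) ^ 2 * (Λ ^ 2 * X) ≤ (1 - κ) * (Λ ^ 2 * X) := by
        exact mul_le_mul_of_nonneg_right q2 (by positivity)
      have f7 : Λ ^ 2 * X = Λ ^ 2 * MM i + 3 / 2 * Λ ^ 2 * n + Λ ^ 2 := by rw [hX]; ring
      linarith
    have g3 : κ / 2 * √T ≤ κ * (l * √X) := by
      have f1 : √(T : ℝ) ≤ 2 * √X := by
        rw [Real.sqrt_le_left (by positivity), mul_pow, Real.sq_sqrt hX0.le]; linarith
      have f2 : √X ≤ l * √X := le_mul_of_one_le_left (Real.sqrt_nonneg _) hl1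
      calc κ / 2 * √T ≤ κ / 2 * (2 * (l * √X)) := by gcongr; linarith
        _ = _ := by ring
    have g5 := abs_le.1 h1T
    have g6 := neg_abs_le (Er ω x (1 / 2) T)
    linarith [g5.1, g5.2]
  calc ((1 - κ) ^ 2 * Λ - κ) * √(Nr ω T * Real.log (Real.log (Nr ω T)))
      ≤ ((1 - κ) ^ 2 * Λ - κ) * ((1 + κ) * (l * √X)) := by gcongr
    _ = (1 + κ) * (((1 - κ) ^ 2 * Λ - κ) * (l * √X)) := by ring
    _ ≤ _ := by gcongr

/-! Part M: final assembly -/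

lemma params (Λ : ℝ) (hΛ : 0 < Λ) : ∃ r : ℕ, 0 < r ∧ ∃ ρ : ℝ, 0 < ρ ∧ ρ ≤ 1 / 2 ∧
    ρ * (r / 16 - 3 / 2 * Λ ^ 2) = Λ ^ 2 := by
  obtain ⟨r, hr⟩ := exists_nat_ge (56 * Λ ^ 2)
  have h2 : 0 < Λ ^ 2 := by positivity
  have hr0 : (0 : ℝ) < r := by linarith
  have hc : 2 * Λ ^ 2 ≤ (r : ℝ) / 16 - 3 / 2 * Λ ^ 2 := by linarith
  have hc0 : 0 < (r : ℝ) / 16 - 3 / 2 * Λ ^ 2 := by linarith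
  refine ⟨r, by exact_mod_cast hr0, Λ ^ 2 / ((r : ℝ) / 16 - 3 / 2 * Λ ^ 2), by positivity, ?_, ?_⟩
  · rw [div_le_iff₀ hc0]; linarith
  · exact div_mul_cancel₀ _ hc0.ne'

lemma exists_om {r : ℕ} (hr : 0 < r) {ρ : ℝ} (hρ : 0 < ρ) (hρ1 : ρ ≤ 1 / 2) :
    ∃ ω : Om r ρ, ∀ᵐ x ∂(volume : Measure ℝ), KB (2 * x) ∧ HU ω x ∧
      ∀ p : ℕ, ∃ᶠ i in atTop, x ∈ Hs r ρ (1 / ((p : ℝ) + 2)) i (ω i) := by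
  have hρ2 : ρ ≤ 1 := by linarith
  have hD := fun p : ℕ => D_upper r hr ρ hρ hρ2 (1 / ((p : ℝ) + 1)) (by positivity)
  choose Bd hBm hBs hBc using hD
  obtain ⟨ω, hω⟩ := selection (fun i => BB r ρ i * qq i) Bd
    (fun p i e => Hs r ρ (1 / ((p : ℝ) + 2)) i e) hBm (fun p i e => Hs_meas r ρ _ i e)
    (by filter_upwards [ae_kb] with x hx p using hBs p x hx.2)
    (by
      filter_upwards [ae_kb] with x hx p
      refine Hs_div r hr ρ hρ hρ2 _ (by positivity) ?_ x hx.2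
      rw [div_lt_one (by positivity)]
      have : (0 : ℝ) ≤ p := by positivity
      linarith)
  refine ⟨ω, ?_⟩
  filter_upwards [ae_kb, hω] with x hx hw
  refine ⟨hx.2, ?_, fun p => (hw p).2⟩
  intro δ hδ
  obtain ⟨p, hp⟩ := exists_nat_one_div_lt hδ
  filter_upwards [(hw p).1, eventually_ge_atTop 1] with i hi h1 b hb
  obtain ⟨h3, h4⟩ := hBc p i h1 (ω i) x hi b hb
  refine ⟨fun a a0 a1 => (h3 a a0 a1).trans ?_, h4⟩
  gcongr

def kp {r : ℕ} {ρ : ℝ} (ω : Om r ρ) (s : ℕ) : Prop := 0 < s ∧ ¬ del ω s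

lemma kp_even {r : ℕ} {ρ : ℝ} (ω : Om r ρ) (s : ℕ) (h0 : 0 < s) (h : 2 ∣ s) : kp ω s := by
  refine ⟨h0, ?_⟩
  rintro ⟨i, u, hi, -, hs, -⟩
  have := MM_even i hi
  omega

lemma kp_inf {r : ℕ} {ρ : ℝ} (ω : Om r ρ) : (Set.ofPred (kp ω)).Infinite := by
  rw [Set.infinite_iff_exists_gt]
  intro a
  exact ⟨2 * (a + 1), kp_even ω _ (by omega) ⟨_, rfl⟩, by omega⟩

noncomputable def sqn {r : ℕ} {ρ : ℝ} (ω : Om r ρ) (k : ℕ) : ℕ := Nat.nth (kp ω) (k - 1)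

lemma sqn_mem {r : ℕ} {ρ : ℝ} (ω : Om r ρ) (k : ℕ) : kp ω (sqn ω k) :=
  Nat.nth_mem_of_infinite (kp_inf ω) _

lemma sqn_lt {r : ℕ} {ρ : ℝ} (ω : Om r ρ) (k : ℕ) (hk : 1 ≤ k) : sqn ω k < sqn ω (k + 1) :=
  Nat.nth_strictMono (kp_inf ω) (by omega)

lemma sqn_gap {r : ℕ} {ρ : ℝ} (ω : Om r ρ) (k : ℕ) (hk : 1 ≤ k) :
    sqn ω (k + 1) - sqn ω k = 1 ∨ sqn ω (k + 1) - sqn ω k = 2 := by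
  have h1 := sqn_lt ω k hk
  have key : ∀ s, kp ω s → s < sqn ω (k + 1) → s ≤ sqn ω k := by
    intro s hs hlt
    have e : sqn ω (k + 1) = Nat.nth (kp ω) (k - 1 + 1) := by unfold sqn; congr 1; omega
    rw [e] at hlt
    exact Nat.le_nth_of_lt_nth_succ hlt hs
  by_contra hcon
  have h3 : sqn ω k + 2 < sqn ω (k + 1) := by omega
  rcases Nat.even_or_odd' (sqn ω k) with ⟨c, hc | hc⟩
  · have := key (sqn ω k + 2) (kp_even ω _ (by omega) ⟨c + 1, by omega⟩) h3
    omega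
  · have := key (sqn ω k + 1) (kp_even ω _ (by omega) ⟨c + 1, by omega⟩) (by omega)
    omega

lemma sqn_ge {r : ℕ} {ρ : ℝ} (ω : Om r ρ) (N : ℕ) : N ≤ sqn ω N := by
  have h := (Nat.nth_strictMono (kp_inf ω)).le_apply (x := N - 1)
  have h0 := (sqn_mem ω 1).1
  have h1 : Nat.nth (kp ω) 0 + (N - 1) ≤ Nat.nth (kp ω) (N - 1) := by
    induction (N - 1) with
    | zero => simp
    | succ m ih =>
      have := Nat.nth_strictMono (kp_inf ω) (Nat.lt_succ_self m)
      simp only [Nat.succ_eq_add_one] at this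
      omega
  unfold sqn at h0 ⊢
  simp only [Nat.sub_self] at h0
  omega

lemma sqn_sum {r : ℕ} {ρ : ℝ} (ω : Om r ρ) (g : ℕ → ℝ) (N : ℕ) (hN : 1 ≤ N) :
    ∑ k ∈ Icc 1 N, g (sqn ω k) = ∑ s ∈ Ioc 0 (sqn ω N), (1 - DD ω s) * g s := by
  classical
  unfold sqn
  rw [sum_nth' (kp ω) (kp_inf ω) (fun h => absurd h.1 (lt_irrefl _)) g N hN]
  apply sum_congr rfl
  intro s hs
  have hs0 := (mem_Ioc.1 hs).1
  unfold DD kp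
  by_cases h : del ω s <;> simp [h, hs0]

lemma sqn_Nr {r : ℕ} {ρ : ℝ} (ω : Om r ρ) (N : ℕ) (hN : 1 ≤ N) : Nr ω (sqn ω N) = N := by
  have := sqn_sum ω (fun _ => 1) N hN
  unfold Nr Del
  simp only [sum_const, Nat.card_Icc, sum_sub_distrib, Nat.card_Ioc,
    nsmul_eq_mul, mul_one, Nat.sub_zero, add_tsub_cancel_right] at this ⊢
  exact this.symm

lemma sqn_Er {r : ℕ} {ρ : ℝ} (ω : Om r ρ) (x a : ℝ) (N : ℕ) (hN : 1 ≤ N) :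
    N * |(∑ k ∈ Icc 1 N, (if 0 ≤ Int.fract ((sqn ω k : ℝ) * x) ∧ Int.fract ((sqn ω k : ℝ) * x) ≤ a
      then (1 : ℝ) else 0)) / N - a| = |Er ω x a (sqn ω N)| := by
  have hN0 : (0 : ℝ) < N := by exact_mod_cast hN
  have := sqn_sum ω (fun s => fa a (s * x)) N hN
  unfold Er
  rw [← this]
  unfold fa
  rw [sum_sub_distrib]
  simp only [Int.fract_nonneg, true_and, sum_const, Nat.card_Icc, add_tsub_cancel_right,
    nsmul_eq_mul]
  conv_lhs => rw [← abs_of_pos hN0]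
  rw [← abs_mul]
  congr 1
  rw [abs_of_pos hN0, mul_sub, mul_div_cancel₀ _ hN0.ne']

lemma disc_le {r : ℕ} {ρ : ℝ} (ω : Om r ρ) (x : ℝ) (N : ℕ) (hN : 1 ≤ N) (B : ℝ)
    (h : ∀ a, 0 ≤ a → a ≤ 1 → |Er ω x a (sqn ω N)| ≤ B) :
    N * starDiscrepancy N (fun k => Int.fract ((sqn ω k : ℝ) * x)) ≤ B := by
  have hN0 : (0 : ℝ) < N := by exact_mod_cast hN
  rw [mul_comm, ← le_div_iff₀ hN0]
  unfold starDiscrepancy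
  refine csSup_le ⟨_, ⟨0, le_rfl, zero_le_one, rfl⟩⟩ ?_
  rintro v ⟨a, a0, a1, rfl⟩
  rw [le_div_iff₀ hN0, mul_comm, sqn_Er ω x a N hN]
  exact h a a0 a1

lemma le_disc {r : ℕ} {ρ : ℝ} (ω : Om r ρ) (x : ℝ) (N : ℕ) (hN : 1 ≤ N) (B : ℝ)
    (h : ∀ a, 0 ≤ a → a ≤ 1 → |Er ω x a (sqn ω N)| ≤ B) (a : ℝ) (a0 : 0 ≤ a) (a1 : a ≤ 1) :
    |Er ω x a (sqn ω N)| ≤ N * starDiscrepancy N (fun k => Int.fract ((sqn ω k : ℝ) * x)) := by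
  have hN0 : (0 : ℝ) < N := by exact_mod_cast hN
  rw [← sqn_Er ω x a N hN]
  apply mul_le_mul_of_nonneg_left _ hN0.le
  unfold starDiscrepancy
  refine le_csSup ?_ ⟨a, a0, a1, rfl⟩
  refine ⟨B / N, ?_⟩
  rintro v ⟨a, a0, a1, rfl⟩
  rw [le_div_iff₀ hN0, mul_comm, sqn_Er ω x a N hN]
  exact h a a0 a1

lemma Er_triv {r : ℕ} {ρ : ℝ} (ω : Om r ρ) (x a : ℝ) (a0 : 0 ≤ a) (a1 : a ≤ 1) (T : ℕ) :
    |Er ω x a T| ≤ T := by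
  unfold Er
  refine (abs_sum_le_sum_abs _ _).trans ?_
  calc _ ≤ ∑ s ∈ Ioc 0 T, (1 : ℝ) := by
        apply sum_le_sum; intro s _
        have := DD_abs ω s
        rw [abs_mul, abs_of_nonneg (by linarith)]
        nlinarith [fa_abs_le a0 a1 (s * x), abs_nonneg (fa a (s * x))]
    _ = T := by simp

lemma MM_ge (i : ℕ) : i ≤ MM i := by
  unfold MM
  have h1 : i ≤ i ^ 2 := Nat.le_self_pow two_ne_zero i
  exact (h1.trans (Nat.lt_two_pow_self (n := i ^ 2)).le)

lemma MM_between (i0 T : ℕ) (h : MM i0 ≤ T) : ∃ i, i0 ≤ i ∧ MM i ≤ T ∧ T ≤ MM (i + 1) := by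
  classical
  have hb : ∀ j, MM j ≤ T → j ≤ T := fun j hj => (MM_ge j).trans hj
  refine ⟨Nat.findGreatest (fun j => MM j ≤ T) T, Nat.le_findGreatest (hb _ h) h,
    Nat.findGreatest_spec (P := fun j => MM j ≤ T) (hb _ h) h, ?_⟩
  by_contra hc
  push Not at hc
  have := Nat.le_findGreatest (P := fun j => MM j ≤ T) (hb _ hc.le) hc.le
  omega

noncomputable def ff {r : ℕ} {ρ : ℝ} (ω : Om r ρ) (x : ℝ) (N : ℕ) : ℝ :=
  (N * starDiscrepancy N (fun k => Int.fract ((sqn ω k : ℝ) * x))) /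
    Real.sqrt (N * Real.log (Real.log N))

lemma ff_upper {r : ℕ} (hr : 0 < r) {ρ : ℝ} (hρ : 0 < ρ) (hρ1 : ρ ≤ 1 / 2) (ω : Om r ρ) (x : ℝ)
    (hx : KB (2 * x)) (hU : HU ω x) (Λ : ℝ) (hΛ : 0 < Λ)
    (hrho : ρ * (r / 16 - 3 / 2 * Λ ^ 2) = Λ ^ 2) (κ : ℝ) (hκ : 0 < κ) (hκ1 : κ ≤ 1 / 2) :
    ∀ᶠ N : ℕ in atTop, ff ω x N ≤ (Λ + κ) / (1 - κ) ^ 2 := by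
  obtain ⟨i0, h0⟩ := eventually_atTop.1 (upper_final hr hρ hρ1 ω x hx hU Λ hΛ hrho κ hκ hκ1)
  have hk : (0 : ℝ) < (1 - κ) ^ 2 := by
    have : 0 < 1 - κ := by linarith
    positivity
  filter_upwards [eventually_ge_atTop (MM i0), eventually_ge_atTop 1] with N hN hN1
  obtain ⟨i, hi, hi1, hi2⟩ := MM_between i0 (sqn ω N) (hN.trans (sqn_ge ω N))
  have h := h0 i hi _ hi1 hi2
  rw [sqn_Nr ω N hN1] at h
  unfold ff
  apply div_le_of_le_mul₀ (Real.sqrt_nonneg _) (by positivity)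
  apply disc_le ω x N hN1
  intro a a0 a1
  have := h a a0 a1
  rw [div_mul_eq_mul_div, le_div_iff₀ hk]
  linarith

lemma sqn_surj {r : ℕ} {ρ : ℝ} (ω : Om r ρ) (s : ℕ) (hs : kp ω s) :
    ∃ N, 1 ≤ N ∧ sqn ω N = s := by
  classical
  exact ⟨Nat.count (kp ω) s + 1, by omega, by unfold sqn; simpa using Nat.nth_count hs⟩

lemma ff_lower {r : ℕ} (hr : 0 < r) {ρ : ℝ} (hρ : 0 < ρ) (hρ1 : ρ ≤ 1 / 2) (ω : Om r ρ) (x : ℝ)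
    (hx : KB (2 * x)) (hU : HU ω x) (Λ : ℝ) (hΛ : 0 < Λ)
    (hrho : ρ * (r / 16 - 3 / 2 * Λ ^ 2) = Λ ^ 2) (κ : ℝ) (hκ : 0 < κ) (hκ1 : κ ≤ 1 / 2)
    (hκ2 : 0 ≤ (1 - κ) ^ 2 * Λ - κ) (hH : ∃ᶠ i in atTop, x ∈ Hs r ρ κ i (ω i)) :
    ∃ᶠ N : ℕ in atTop, ((1 - κ) ^ 2 * Λ - κ) / (1 + κ) ≤ ff ω x N := by
  have hl := lower_final hr hρ hρ1 ω x hx hU Λ hΛ hrho κ hκ hκ1 hκ2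
  rw [frequently_atTop]
  intro N0
  obtain ⟨i, hi⟩ := (hH.and_eventually (hl.and (eventually_ge_atTop (sqn ω (N0 + 16) + 1)))).exists
  obtain ⟨hi1, hi2, hi3⟩ := hi
  have h := hi2 hi1
  have hM := MM_ge i
  have hMe := MM_even i (by omega)
  obtain ⟨N, hN1, hN⟩ := sqn_surj ω (MM i + 2 * nn r ρ i)
    (kp_even ω _ (by omega) (by omega))
  rw [← hN, sqn_Nr ω N hN1] at h
  have hNN : N0 + 16 < N := by
    by_contra hc
    have : sqn ω N ≤ sqn ω (N0 + 16) := (Nat.nth_strictMono (kp_inf ω)).monotone (by omega)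
    omega
  refine ⟨N, by omega, ?_⟩
  have hd := le_disc ω x N hN1 (sqn ω N) (fun a a0 a1 => Er_triv ω x a a0 a1 _) (1 / 2)
    (by norm_num) (by norm_num)
  have hNR : (16 : ℝ) ≤ N := by exact_mod_cast (by omega : 16 ≤ N)
  have hl1 : 1 < Real.log N := by
    rw [Real.lt_log_iff_exp_lt (by linarith)]
    exact (Real.exp_one_lt_d9.trans (by norm_num)).trans_le hNR
  have hl2 : 0 < Real.log (Real.log N) := Real.log_pos hl1
  have hs : 0 < √(N * Real.log (Real.log N)) := by positivity
  unfold ff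
  rw [div_le_div_iff₀ (by positivity) hs]
  nlinarith

lemma ff_limsup {r : ℕ} (hr : 0 < r) {ρ : ℝ} (hρ : 0 < ρ) (hρ1 : ρ ≤ 1 / 2) (ω : Om r ρ) (x : ℝ)
    (hx : KB (2 * x)) (hU : HU ω x) (Λ : ℝ) (hΛ : 0 < Λ)
    (hrho : ρ * (r / 16 - 3 / 2 * Λ ^ 2) = Λ ^ 2)
    (hH : ∀ p : ℕ, ∃ᶠ i in atTop, x ∈ Hs r ρ (1 / ((p : ℝ) + 2)) i (ω i)) :
    Filter.atTop.limsup (fun N : ℕ => ((ff ω x N : ℝ) : EReal)) = ((Λ : ℝ) : EReal) := by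
  have hk : Tendsto (fun p : ℕ => 1 / ((p : ℝ) + 2)) atTop (nhds 0) := by
    have h := (tendsto_one_div_add_atTop_nhds_zero_nat (𝕜 := ℝ))
    have h2 := h.comp (tendsto_add_atTop_nat 1)
    refine h2.congr fun p => ?_
    simp only [Function.comp]
    push_cast
    ring_nf
  have hk0 : ∀ p : ℕ, 0 < 1 / ((p : ℝ) + 2) := fun p => by positivity
  have hk1 : ∀ p : ℕ, 1 / ((p : ℝ) + 2) ≤ 1 / 2 := fun p => by
    apply one_div_le_one_div_of_le (by norm_num)
    have : (0 : ℝ) ≤ p := by positivity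
    linarith
  apply le_antisymm
  · have hc : Tendsto (fun κ : ℝ => (Λ + κ) / (1 - κ) ^ 2) (nhds 0) (nhds Λ) := by
      have : ContinuousAt (fun κ : ℝ => (Λ + κ) / (1 - κ) ^ 2) 0 := by
        apply ContinuousAt.div (by fun_prop) (by fun_prop) (by norm_num)
      simpa [ContinuousAt] using this
    have hc2 := (continuous_coe_real_ereal.tendsto Λ).comp (hc.comp hk)
    refine ge_of_tendsto' hc2 fun p => ?_
    refine Filter.limsup_le_of_le (h := ?_)
    filter_upwards [ff_upper hr hρ hρ1 ω x hx hU Λ hΛ hrho _ (hk0 p) (hk1 p)] with N hN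
    exact EReal.coe_le_coe_iff.2 hN
  · have hc : Tendsto (fun κ : ℝ => ((1 - κ) ^ 2 * Λ - κ) / (1 + κ)) (nhds 0) (nhds Λ) := by
      have : ContinuousAt (fun κ : ℝ => ((1 - κ) ^ 2 * Λ - κ) / (1 + κ)) 0 := by
        apply ContinuousAt.div (by fun_prop) (by fun_prop) (by norm_num)
      simpa [ContinuousAt] using this
    have hc2 := (continuous_coe_real_ereal.tendsto Λ).comp (hc.comp hk)
    have hev : ∀ᶠ p : ℕ in atTop,
        0 < (1 - 1 / ((p : ℝ) + 2)) ^ 2 * Λ - 1 / ((p : ℝ) + 2) := by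
      have hc3 : Tendsto (fun κ : ℝ => (1 - κ) ^ 2 * Λ - κ) (nhds 0) (nhds Λ) := by
        have : ContinuousAt (fun κ : ℝ => (1 - κ) ^ 2 * Λ - κ) 0 := by fun_prop
        simpa [ContinuousAt] using this
      exact (hc3.comp hk).eventually_const_lt hΛ
    refine le_of_tendsto hc2 ?_
    filter_upwards [hev] with p hp
    refine Filter.le_limsup_of_frequently_le ?_
    refine (ff_lower hr hρ hρ1 ω x hx hU Λ hΛ hrho _ (hk0 p) (hk1 p) hp.le (hH p)).mono ?_
    intro N hN
    exact EReal.coe_le_coe_iff.2 hN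

/-- **Theorem 2.** For any `Λ > 0` there is a strictly increasing sequence of positive integers
with gaps in `{1,2}` such that the limsup in the Chung–Smirnov LIL for the star-discrepancy of
`(⟨n_k x⟩)` equals `Λ` almost everywhere. -/
theorem discrepancy_lil_bounded_gaps
    (Λ : ℝ) (hΛ : 0 < Λ) :
    ∃ n : ℕ → ℕ,
      (∀ k, 1 ≤ k → 0 < n k) ∧
      (∀ k, 1 ≤ k → n k < n (k + 1)) ∧
      (∀ k, 1 ≤ k → n (k + 1) - n k = 1 ∨ n (k + 1) - n k = 2) ∧
      (∀ᵐ x ∂(volume : Measure ℝ),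
        Filter.atTop.limsup (fun N : ℕ =>
            (((N * starDiscrepancy N (fun k => Int.fract ((n k : ℝ) * x))) /
              Real.sqrt (N * Real.log (Real.log N)) : ℝ) : EReal))
          = ((Λ : ℝ) : EReal)) := by
  obtain ⟨r, hr, ρ, hρ, hρ1, hrho⟩ := params Λ hΛ
  obtain ⟨ω, hω⟩ := exists_om hr hρ hρ1
  refine ⟨sqn ω, fun k _ => (sqn_mem ω k).1, sqn_lt ω, sqn_gap ω, ?_⟩
  filter_upwards [hω] with x hx
  exact ff_limsup hr hρ hρ1 ω x hx.1 hx.2.1 Λ hΛ hrho hx.2.2
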